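/- Suppose: (A1) a(x,t) = σ(x,t)σ(x,t)ᵀ is a symmetric N×N matrix field whose entries σ_{ij} are bounded on ℝ^N × [0,T], Lipschitz continuous on compact subsets of ℝ^N × [0,T], and Lipschitz continuous in x uniformly with respect to t, and there is μ > 0 with ξᵀ a(x,t) ξ ≥ μ|ξ|² for all ξ ∈ ℝ^N and all (x,t) ∈ ℝ^N × [0,T]; (A2) β : ℝ^N → ℝ is bounded and uniformly Lipschitz continuous; (A3) H : ℝ^N × ℝ × ℝ^N × [0,T] → ℝ is Hölder continuous on compact subsets and there is K > 0 such that |H(p,u,x,t)| ≤ K(1 + |u| + |p|) and |H(p,u,x,t) − H(p̄,ū,x,t)| ≤ K(|u − ū| + |p − p̄|) for all p,p̄ ∈ ℝ^N, u,ū ∈ ℝ, (x,t) ∈ ℝ^N × [0,T]. Then there exists a classical solution u of u_t + (1/2)·Tr(a(x,t) D²_x u) + H(D_x u, u, x, t) = 0 on ℝ^N × [0,T) with u(x,T) = β(x), and moreover u and its spatial gradient D_x u are bounded on ℝ^N × [0,T]. -/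

import Mathlib

open scoped BigOperators
open MeasureTheory Set Matrix

noncomputable section

abbrev Euc (N : ℕ) : Type := EuclideanSpace ℝ (Fin N)

/-- A classical solution of the terminal-value problem
`u_t + (1/2)·Tr(a(x,t) D²_x u) + H(D_x u, u, x, t) = 0` on `ℝ^N × [0,T)`,
`u(x,T) = β(x)`: `u` is continuous on `ℝ^N × [0,T]`, has continuous spatial
gradient `Du`, continuous spatial Hessian `D2u` and continuous time derivative
`ut` on `ℝ^N × [0,T)`, and satisfies the equation pointwise together with the
terminal condition. -/
def IsClassicalSolution (N : ℕ) (T : ℝ)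
    (a : Euc N → ℝ → Matrix (Fin N) (Fin N) ℝ)
    (H : Euc N → ℝ → Euc N → ℝ → ℝ)
    (β : Euc N → ℝ)
    (u : Euc N → ℝ → ℝ) (Du : Euc N → ℝ → Euc N)
    (D2u : Euc N → ℝ → (Euc N →L[ℝ] Euc N)) (ut : Euc N → ℝ → ℝ) : Prop :=
  ContinuousOn (fun q : Euc N × ℝ => u q.1 q.2) (Set.univ ×ˢ Set.Icc 0 T)
  ∧ (∀ x t, t ∈ Set.Ico 0 T → HasGradientAt (fun y => u y t) (Du x t) x)
  ∧ (∀ x t, t ∈ Set.Ico 0 T → HasFDerivAt (fun y => Du y t) (D2u x t) x)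
  ∧ (∀ x t, t ∈ Set.Ico 0 T →
        HasDerivWithinAt (fun s => u x s) (ut x t) (Set.Ico 0 T) t)
  ∧ ContinuousOn (fun q : Euc N × ℝ => Du q.1 q.2) (Set.univ ×ˢ Set.Ico 0 T)
  ∧ ContinuousOn (fun q : Euc N × ℝ => D2u q.1 q.2) (Set.univ ×ˢ Set.Ico 0 T)
  ∧ ContinuousOn (fun q : Euc N × ℝ => ut q.1 q.2) (Set.univ ×ˢ Set.Ico 0 T)
  ∧ (∀ x t, t ∈ Set.Ico 0 T →
      ut x t
        + (1/2) * (∑ i, ∑ j, a x t i j * (D2u x t (EuclideanSpace.single j 1)) i)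
        + H (Du x t) (u x t) x t = 0)
  ∧ (∀ x, u x T = β x)

namespace Parabolic

open Filter Topology
open scoped RealInnerProductSpace

section Gaussian

variable {N : ℕ} {F G W : Type*} [NormedAddCommGroup F] [NormedSpace ℝ F]
  [NormedAddCommGroup G] [NormedSpace ℝ G] [NormedAddCommGroup W] [NormedSpace ℝ W]

/-- Linear operators on `ℝ^N`. -/
abbrev Opr (N : ℕ) : Type := Euc N →L[ℝ] Euc N

/-- Self-adjoint operators with ellipticity constant `c` and norm at most `b`. -/
def Ell (N : ℕ) (c b : ℝ) : Set (Opr N) :=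
  {B | (∀ x y, ⟪B x, y⟫ = ⟪x, B y⟫) ∧ (∀ z, c * ‖z‖ ^ 2 ≤ ⟪B z, z⟫) ∧ ‖B‖ ≤ b}

/-- Kernels of size `exp (r ‖z‖²)`, locally Lipschitz in `(B, z)` with the same weight. -/
def GaussLip (c b r : ℝ) (Ψ : Opr N → Euc N → F) : Prop :=
  ∃ C, 0 ≤ C ∧ ∀ B ∈ Ell N c b, ∀ z, ‖Ψ B z‖ ≤ C * Real.exp (r * ‖z‖ ^ 2) ∧
    ∀ B' ∈ Ell N c b, ∀ z', ‖z - z'‖ ≤ 1 →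
      ‖Ψ B z - Ψ B' z'‖ ≤ C * (‖B - B'‖ + ‖z - z'‖) * Real.exp (r * ‖z‖ ^ 2)

theorem one_add_sq_le_exp {ε : ℝ} (hε : 0 < ε) (x : ℝ) :
    (1 + x) ^ 2 ≤ (2 + 2 / ε) * Real.exp (ε * x ^ 2) := by
  have h1 : 1 + ε * x ^ 2 ≤ Real.exp (ε * x ^ 2) := by
    linarith [Real.add_one_le_exp (ε * x ^ 2)]
  have h2 : (2 + 2 / ε) * (1 + ε * x ^ 2) ≤ (2 + 2 / ε) * Real.exp (ε * x ^ 2) := by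
    gcongr
  have h3 : (2 + 2 / ε) * (1 + ε * x ^ 2) = 2 + 2 / ε + 2 * ε * x ^ 2 + 2 * x ^ 2 := by
    field_simp; ring
  have : 0 < 2 / ε := by positivity
  nlinarith [sq_nonneg (1 - x), mul_nonneg hε.le (sq_nonneg x)]

theorem GaussLip.mono {c b r r' : ℝ} {Ψ : Opr N → Euc N → F} (h : GaussLip c b r Ψ) (hr : r ≤ r') :
    GaussLip c b r' Ψ := by
  obtain ⟨C, hC, h⟩ := h
  have he : ∀ z : Euc N, Real.exp (r * ‖z‖ ^ 2) ≤ Real.exp (r' * ‖z‖ ^ 2) := fun z => by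
    gcongr
  refine ⟨C, hC, fun B hB z => ⟨((h B hB z).1).trans ?_, fun B' hB' z' hz =>
    ((h B hB z).2 B' hB' z' hz).trans ?_⟩⟩
  · exact mul_le_mul_of_nonneg_left (he z) hC
  · exact mul_le_mul_of_nonneg_left (he z) (by positivity)

theorem ell_sub_le {c b : ℝ} {B B' : Opr N} (hB : B ∈ Ell N c b) (hB' : B' ∈ Ell N c b) :
    ‖B - B'‖ ≤ 2 * b := by
  have := norm_sub_le B B'
  linarith [hB.2.2, hB'.2.2]

theorem GaussLip.bilin {c b r s : ℝ} (L : F →L[ℝ] G →L[ℝ] W) {Φ : Opr N → Euc N → F}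
    {Ψ : Opr N → Euc N → G} (hΦ : GaussLip c b r Φ) (hΨ : GaussLip c b s Ψ) :
    GaussLip c b (r + s) (fun B z => L (Φ B z) (Ψ B z)) := by
  obtain ⟨C, hC, hΦ⟩ := hΦ
  obtain ⟨D, hD, hΨ⟩ := hΨ
  have hb' : 0 ≤ |b| := abs_nonneg b
  refine ⟨‖L‖ * C * D * (3 + 2 * |b|), by positivity, fun B hB z => ⟨?_, fun B' hB' z' hz => ?_⟩⟩
  · have h1 := (hΦ B hB z).1
    have h2 := (hΨ B hB z).1
    calc ‖L (Φ B z) (Ψ B z)‖ ≤ ‖L‖ * ‖Φ B z‖ * ‖Ψ B z‖ := L.le_opNorm₂ _ _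
      _ ≤ ‖L‖ * (C * Real.exp (r * ‖z‖ ^ 2)) * (D * Real.exp (s * ‖z‖ ^ 2)) := by gcongr
      _ = ‖L‖ * C * D * 1 * Real.exp ((r + s) * ‖z‖ ^ 2) := by
        rw [add_mul, Real.exp_add]; ring
      _ ≤ _ := by gcongr; linarith
  · have h1 := (hΦ B hB z).1
    have h2 := (hΨ B hB z).1
    have h3 := (hΦ B hB z).2 B' hB' z' hz
    have h4 := (hΨ B hB z).2 B' hB' z' hz
    set δ := ‖B - B'‖ + ‖z - z'‖ with hδ
    have hδ0 : 0 ≤ δ := by positivity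
    have hδ1 : δ ≤ 1 + 2 * |b| := by
      have := ell_sub_le hB hB'
      have := le_abs_self b
      linarith
    have h5 : ‖Ψ B' z'‖ ≤ D * (2 + 2 * |b|) * Real.exp (s * ‖z‖ ^ 2) := by
      have : ‖Ψ B' z'‖ ≤ ‖Ψ B z‖ + ‖Ψ B z - Ψ B' z'‖ := by
        have := norm_sub_norm_le (Ψ B' z') (Ψ B z)
        rw [norm_sub_rev] at this; linarith
      calc ‖Ψ B' z'‖ ≤ D * Real.exp (s * ‖z‖ ^ 2) + D * δ * Real.exp (s * ‖z‖ ^ 2) := by linarith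
        _ = D * (1 + δ) * Real.exp (s * ‖z‖ ^ 2) := by ring
        _ ≤ _ := mul_le_mul_of_nonneg_right (mul_le_mul_of_nonneg_left (by linarith) hD)
          (Real.exp_pos _).le
    have h6 : L (Φ B z) (Ψ B z) - L (Φ B' z') (Ψ B' z')
        = L (Φ B z) (Ψ B z - Ψ B' z') + L (Φ B z - Φ B' z') (Ψ B' z') := by
      simp
    rw [h6]
    calc _ ≤ ‖L (Φ B z) (Ψ B z - Ψ B' z')‖ + ‖L (Φ B z - Φ B' z') (Ψ B' z')‖ := norm_add_le _ _
      _ ≤ ‖L‖ * ‖Φ B z‖ * ‖Ψ B z - Ψ B' z'‖ + ‖L‖ * ‖Φ B z - Φ B' z'‖ * ‖Ψ B' z'‖ :=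
        add_le_add (L.le_opNorm₂ _ _) (L.le_opNorm₂ _ _)
      _ ≤ ‖L‖ * (C * Real.exp (r * ‖z‖ ^ 2)) * (D * δ * Real.exp (s * ‖z‖ ^ 2)) +
          ‖L‖ * (C * δ * Real.exp (r * ‖z‖ ^ 2)) * (D * (2 + 2 * |b|) * Real.exp (s * ‖z‖ ^ 2)) := by
        gcongr
      _ = _ := by rw [add_mul r, Real.exp_add]; ring

theorem GaussLip.sub {c b r : ℝ} {Φ Ψ : Opr N → Euc N → F} (hΦ : GaussLip c b r Φ) (hΨ : GaussLip c b r Ψ) :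
    GaussLip c b r (fun B z => Φ B z - Ψ B z) := by
  obtain ⟨C, hC, hΦ⟩ := hΦ
  obtain ⟨D, hD, hΨ⟩ := hΨ
  refine ⟨C + D, by positivity, fun B hB z => ⟨?_, fun B' hB' z' hz => ?_⟩⟩
  · have h1 := (hΦ B hB z).1
    have h2 := (hΨ B hB z).1
    have := norm_sub_le (Φ B z) (Ψ B z)
    linarith
  · have h1 := (hΦ B hB z).2 B' hB' z' hz
    have h2 := (hΨ B hB z).2 B' hB' z' hz
    have h3 : Φ B z - Ψ B z - (Φ B' z' - Ψ B' z') = (Φ B z - Φ B' z') - (Ψ B z - Ψ B' z') := by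
      abel
    have := norm_sub_le (Φ B z - Φ B' z') (Ψ B z - Ψ B' z')
    rw [h3]; linarith

theorem GaussLip.clm {c b r : ℝ} (L : F →L[ℝ] G) {Φ : Opr N → Euc N → F} (hΦ : GaussLip c b r Φ) :
    GaussLip c b r (fun B z => L (Φ B z)) := by
  obtain ⟨C, hC, hΦ⟩ := hΦ
  refine ⟨‖L‖ * C, by positivity, fun B hB z => ⟨?_, fun B' hB' z' hz => ?_⟩⟩
  · have h1 := (hΦ B hB z).1
    calc _ ≤ ‖L‖ * ‖Φ B z‖ := L.le_opNorm _
      _ ≤ ‖L‖ * (C * Real.exp (r * ‖z‖ ^ 2)) := by gcongr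
      _ = _ := by ring
  · have h1 := (hΦ B hB z).2 B' hB' z' hz
    rw [← map_sub]
    calc _ ≤ ‖L‖ * ‖Φ B z - Φ B' z'‖ := L.le_opNorm _
      _ ≤ ‖L‖ * (C * (‖B - B'‖ + ‖z - z'‖) * Real.exp (r * ‖z‖ ^ 2)) := by gcongr
      _ = _ := by ring

theorem GaussLip.continuousOn {c b r : ℝ} {Ψ : Opr N → Euc N → F} (h : GaussLip c b r Ψ) :
    ContinuousOn (fun p : Opr N × Euc N => Ψ p.1 p.2) (Ell N c b ×ˢ univ) := by
  obtain ⟨C, hC, h⟩ := h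
  rintro ⟨B, z⟩ ⟨hB, -⟩
  rw [ContinuousWithinAt, tendsto_iff_norm_sub_tendsto_zero]
  have h1 : Tendsto (fun p : Opr N × Euc N =>
      C * (‖B - p.1‖ + ‖z - p.2‖) * Real.exp (r * ‖z‖ ^ 2)) (𝓝[Ell N c b ×ˢ univ] (B, z)) (𝓝 0) := by
    have : Continuous (fun p : Opr N × Euc N =>
      C * (‖B - p.1‖ + ‖z - p.2‖) * Real.exp (r * ‖z‖ ^ 2)) := by fun_prop
    have := this.tendsto (B, z)
    simp only [sub_self, norm_zero, add_zero, mul_zero, zero_mul] at this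
    exact this.mono_left nhdsWithin_le_nhds
  refine tendsto_of_tendsto_of_tendsto_of_le_of_le' tendsto_const_nhds h1
    (Eventually.of_forall fun _ => norm_nonneg _) ?_
  have h2 : ∀ᶠ p : Opr N × Euc N in 𝓝[Ell N c b ×ˢ univ] (B, z), ‖z - p.2‖ ≤ 1 := by
    have : Continuous (fun p : Opr N × Euc N => ‖z - p.2‖) := by fun_prop
    have := this.tendsto (B, z)
    simp only [sub_self, norm_zero] at this
    exact (this.mono_left nhdsWithin_le_nhds).eventually (Iic_mem_nhds one_pos)
  filter_upwards [h2, self_mem_nhdsWithin] with p hp hp'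
  rw [norm_sub_rev]
  exact (h B hB z).2 p.1 hp'.1 p.2 hp

theorem GaussLip.continuous_snd {c b r : ℝ} {Ψ : Opr N → Euc N → F} (h : GaussLip c b r Ψ) {B : Opr N}
    (hB : B ∈ Ell N c b) : Continuous (Ψ B) := by
  have := h.continuousOn.comp_continuous (f := fun z : Euc N => (B, z)) (by fun_prop)
    (fun z => ⟨hB, mem_univ _⟩)
  exact this

theorem GaussLip.apply {c b ε : ℝ} (hε : 0 < ε) : GaussLip (N := N) c b ε (fun B z => B z) := by
  have hb : 0 ≤ |b| := abs_nonneg b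
  have hx : ∀ x : ℝ, 0 ≤ x → x ≤ (2 + 2 / ε) * Real.exp (ε * x ^ 2) := fun x hx => by
    have := one_add_sq_le_exp hε x
    nlinarith
  have h1 : ∀ x : ℝ, 1 ≤ (2 + 2 / ε) * Real.exp (ε * x ^ 2) := fun x => by
    have := Real.one_le_exp (show 0 ≤ ε * x ^ 2 by positivity)
    have : 0 < 2 / ε := by positivity
    nlinarith
  refine ⟨(|b| + 1) * (2 + 2 / ε), by positivity, fun B hB z => ⟨?_, fun B' hB' z' hz => ?_⟩⟩
  · calc ‖B z‖ ≤ ‖B‖ * ‖z‖ := B.le_opNorm z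
      _ ≤ (|b| + 1) * ((2 + 2 / ε) * Real.exp (ε * ‖z‖ ^ 2)) := by
        gcongr
        · linarith [hB.2.2, le_abs_self b]
        · exact hx _ (norm_nonneg _)
      _ = _ := by ring
  · have h2 : B z - B' z' = (B - B') z + B' (z - z') := by simp
    set e := (2 + 2 / ε) * Real.exp (ε * ‖z‖ ^ 2)
    have he : 1 ≤ e := h1 _
    calc ‖B z - B' z'‖ ≤ ‖(B - B') z‖ + ‖B' (z - z')‖ := by rw [h2]; exact norm_add_le _ _
      _ ≤ ‖B - B'‖ * ‖z‖ + ‖B'‖ * ‖z - z'‖ := add_le_add ((B - B').le_opNorm z) (B'.le_opNorm _)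
      _ ≤ ‖B - B'‖ * e + |b| * ‖z - z'‖ * e := by
        refine add_le_add (mul_le_mul_of_nonneg_left (hx _ (norm_nonneg _)) (norm_nonneg _)) ?_
        calc ‖B'‖ * ‖z - z'‖ ≤ |b| * ‖z - z'‖ := by
              gcongr; linarith [hB'.2.2, le_abs_self b]
          _ = |b| * ‖z - z'‖ * 1 := by ring
          _ ≤ _ := by gcongr
      _ ≤ (|b| + 1) * (‖B - B'‖ + ‖z - z'‖) * e := by
        nlinarith [mul_nonneg (mul_nonneg hb (norm_nonneg (B - B'))) (zero_le_one.trans he),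
          mul_nonneg (norm_nonneg (z - z')) (zero_le_one.trans he)]
      _ = _ := by simp only [e]; ring

theorem GaussLip.of_const {c b ε K : ℝ} (hε : 0 ≤ ε) {m : Opr N → F} (hb : ∀ B ∈ Ell N c b, ‖m B‖ ≤ K)
    (hl : ∀ B ∈ Ell N c b, ∀ B' ∈ Ell N c b, ‖m B - m B'‖ ≤ K * ‖B - B'‖) :
    GaussLip (N := N) c b ε (fun B _ => m B) := by
  refine ⟨|K|, abs_nonneg K, fun B hB z => ⟨?_, fun B' hB' z' hz => ?_⟩⟩ <;>
  have h1 := Real.one_le_exp (show 0 ≤ ε * ‖z‖ ^ 2 by positivity)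
  · calc ‖m B‖ ≤ |K| * 1 := by linarith [hb B hB, le_abs_self K]
      _ ≤ _ := by gcongr
  · calc ‖m B - m B'‖ ≤ K * ‖B - B'‖ := hl B hB B' hB'
      _ ≤ |K| * (‖B - B'‖ + 0) * 1 := by
        rw [add_zero, mul_one]; gcongr; exact le_abs_self K
      _ ≤ _ := by gcongr; exact norm_nonneg _

/-- The unnormalised Gaussian with precision operator `B`. -/
def ge (B : Opr N) (z : Euc N) : ℝ := Real.exp (-(1 / 2) * ⟪B z, z⟫)

/-- Total mass of the unnormalised Gaussian. -/
def gm (B : Opr N) : ℝ := ∫ z : Euc N, ge B z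

/-- The normalised Gaussian density. -/
def g0 (B : Opr N) (z : Euc N) : ℝ := (gm B)⁻¹ * ge B z

/-- The gradient of the Gaussian density. -/
def g1 (B : Opr N) (z : Euc N) : Euc N := -(g0 B z • B z)

/-- The Hessian of the Gaussian density. -/
def g2 (B : Opr N) (z : Euc N) : Opr N :=
  g0 B z • ((innerSL ℝ (B z)).smulRight (B z) - B)

theorem abs_exp_neg_sub_le (p q : ℝ) :
    |Real.exp (-p) - Real.exp (-q)| ≤ |p - q| * (Real.exp (-p) + Real.exp (-q)) := by
  have key : ∀ p q : ℝ, Real.exp (-p) - Real.exp (-q) ≤ |p - q| * Real.exp (-p) := by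
    intro p q
    have h1 := Real.add_one_le_exp (p - q)
    have h2 : Real.exp (-q) = Real.exp (p - q) * Real.exp (-p) := by
      rw [← Real.exp_add]; ring_nf
    have h3 := Real.exp_pos (-p)
    have h4 := neg_abs_le (p - q)
    rw [h2]; nlinarith
  rw [abs_le]
  have h1 := key p q
  have h2 := key q p
  rw [abs_sub_comm] at h2
  have := mul_nonneg (abs_nonneg (p - q)) (Real.exp_pos (-p)).le
  have := mul_nonneg (abs_nonneg (p - q)) (Real.exp_pos (-q)).le
  constructor <;> nlinarith

theorem GaussLip.ge {c b : ℝ} (hc : 0 < c) : GaussLip (N := N) c b (-(c / 8)) ge := by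
  have hb : 0 ≤ |b| := abs_nonneg b
  set ε := c / 8 with hε
  have hε0 : 0 < ε := by positivity
  have e1 : ∀ B ∈ Ell N c b, ∀ z, Parabolic.ge B z ≤ Real.exp (-(2 * ε) * ‖z‖ ^ 2) := by
    intro B hB z
    unfold Parabolic.ge
    refine Real.exp_le_exp.2 ?_
    nlinarith [hB.2.1 z, sq_nonneg ‖z‖]
  refine ⟨1 + (2 + 4 * |b|) * (1 + Real.exp (c / 2)) * (2 + 2 / ε), by positivity,
    fun B hB z => ⟨?_, fun B' hB' z' hz => ?_⟩⟩
  · rw [Real.norm_of_nonneg (show 0 ≤ Parabolic.ge B z from (Real.exp_pos _).le)]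
    calc Parabolic.ge B z ≤ 1 * Real.exp (-(2 * ε) * ‖z‖ ^ 2) := by rw [one_mul]; exact e1 B hB z
      _ ≤ 1 * Real.exp (-ε * ‖z‖ ^ 2) := by gcongr; linarith
      _ ≤ _ := by
        gcongr
        have : 0 ≤ (2 + 4 * |b|) * (1 + Real.exp (c / 2)) * (2 + 2 / ε) := by positivity
        linarith
  · have e2 : Parabolic.ge B' z' ≤ Real.exp (c / 2) * Real.exp (-(2 * ε) * ‖z‖ ^ 2) := by
      unfold Parabolic.ge
      rw [← Real.exp_add]
      refine Real.exp_le_exp.2 ?_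
      have h1 := hB'.2.1 z'
      have h2 : ‖z‖ ≤ ‖z'‖ + 1 := by
        have := norm_sub_norm_le z z'; linarith
      have h3 : ‖z‖ ^ 2 ≤ (‖z'‖ + 1) ^ 2 := by gcongr
      nlinarith [sq_nonneg (‖z'‖ - 1)]
    have e3 : |⟪B z, z⟫ - ⟪B' z', z'⟫| ≤ (2 + 4 * |b|) * (‖B - B'‖ + ‖z - z'‖) * (1 + ‖z‖) ^ 2 := by
      have h1 : ⟪B z, z⟫ - ⟪B' z', z'⟫ = ⟪(B - B') z, z⟫ + ⟪B' (z - z'), z⟫ + ⟪B' z', z - z'⟫ := by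
        simp only [_root_.sub_apply, map_sub, inner_sub_left, inner_sub_right]; ring
      have h2 : |⟪(B - B') z, z⟫| ≤ ‖B - B'‖ * ‖z‖ * ‖z‖ :=
        (abs_real_inner_le_norm _ _).trans (by gcongr; exact (B - B').le_opNorm z)
      have hB'b : ‖B'‖ ≤ |b| := by linarith [hB'.2.2, le_abs_self b]
      have h3 : |⟪B' (z - z'), z⟫| ≤ |b| * ‖z - z'‖ * ‖z‖ :=
        (abs_real_inner_le_norm _ _).trans (by
          gcongr; exact (B'.le_opNorm _).trans (by gcongr))
      have h5 : ‖z'‖ ≤ ‖z‖ + 1 := by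
        have := norm_sub_norm_le z' z
        rw [norm_sub_rev] at this; linarith
      have h4 : |⟪B' z', z - z'⟫| ≤ |b| * (‖z‖ + 1) * ‖z - z'‖ :=
        (abs_real_inner_le_norm _ _).trans (by
          gcongr; exact (B'.le_opNorm _).trans (by gcongr))
      rw [h1]
      refine (abs_add_three _ _ _).trans ?_
      have hz0 := norm_nonneg z
      have hd0 := norm_nonneg (B - B')
      have hd1 := norm_nonneg (z - z')
      have t1 : ‖B - B'‖ * ‖z‖ * ‖z‖ ≤ ‖B - B'‖ * (1 + ‖z‖) ^ 2 := by nlinarith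
      have t2 : |b| * ‖z - z'‖ * ‖z‖ ≤ |b| * ‖z - z'‖ * (1 + ‖z‖) ^ 2 :=
        mul_le_mul_of_nonneg_left (by nlinarith) (by positivity)
      have t3 : |b| * (‖z‖ + 1) * ‖z - z'‖ ≤ |b| * ‖z - z'‖ * (1 + ‖z‖) ^ 2 := by
        rw [mul_right_comm]
        exact mul_le_mul_of_nonneg_left (by nlinarith) (by positivity)
      have t4 : 0 ≤ |b| * ‖B - B'‖ * (1 + ‖z‖) ^ 2 := by positivity
      have t5 : 0 ≤ ‖z - z'‖ * (1 + ‖z‖) ^ 2 := by positivity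
      have t6 : 0 ≤ ‖B - B'‖ * (1 + ‖z‖) ^ 2 := by positivity
      have t7 : 0 ≤ |b| * ‖z - z'‖ * (1 + ‖z‖) ^ 2 := by positivity
      nlinarith
    have e4 := abs_exp_neg_sub_le ((1 / 2) * ⟪B z, z⟫) ((1 / 2) * ⟪B' z', z'⟫)
    have e5 := one_add_sq_le_exp hε0 ‖z‖
    rw [Real.norm_eq_abs]
    calc |Parabolic.ge B z - Parabolic.ge B' z'|
        ≤ |(1 / 2) * ⟪B z, z⟫ - (1 / 2) * ⟪B' z', z'⟫| * (Parabolic.ge B z + Parabolic.ge B' z') := by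
          simpa only [Parabolic.ge, neg_mul] using e4
      _ ≤ ((2 + 4 * |b|) * (‖B - B'‖ + ‖z - z'‖) * (1 + ‖z‖) ^ 2) *
          (Real.exp (-(2 * ε) * ‖z‖ ^ 2) + Real.exp (c / 2) * Real.exp (-(2 * ε) * ‖z‖ ^ 2)) := by
        gcongr
        · exact add_nonneg (Real.exp_pos _).le (Real.exp_pos _).le
        · rw [← mul_sub, abs_mul, abs_of_pos (by norm_num : (0 : ℝ) < 1 / 2)]
          have := abs_nonneg (⟪B z, z⟫ - ⟪B' z', z'⟫)
          linarith
        · exact e1 B hB z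
      _ ≤ ((2 + 4 * |b|) * (‖B - B'‖ + ‖z - z'‖) * ((2 + 2 / ε) * Real.exp (ε * ‖z‖ ^ 2))) *
          (Real.exp (-(2 * ε) * ‖z‖ ^ 2) + Real.exp (c / 2) * Real.exp (-(2 * ε) * ‖z‖ ^ 2)) := by
        gcongr
      _ = ((2 + 4 * |b|) * (1 + Real.exp (c / 2)) * (2 + 2 / ε)) * (‖B - B'‖ + ‖z - z'‖) *
          Real.exp (-ε * ‖z‖ ^ 2) := by
        have : Real.exp (-ε * ‖z‖ ^ 2) =
            Real.exp (ε * ‖z‖ ^ 2) * Real.exp (-(2 * ε) * ‖z‖ ^ 2) := by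
          rw [← Real.exp_add]; ring_nf
        rw [this]; ring
      _ ≤ _ := by gcongr; linarith

theorem integrable_gauss {r : ℝ} (hr : r < 0) :
    Integrable (fun z : Euc N => Real.exp (r * ‖z‖ ^ 2)) := by
  have := (GaussianFourier.integrable_cexp_neg_mul_sq_norm_add (V := Euc N) (b := (-r : ℂ))
    (by simpa using hr) 0 0).norm
  refine this.congr (Eventually.of_forall fun z => ?_)
  simp only [Complex.norm_exp]
  simp [← Complex.ofReal_pow]

theorem integrable_one_add_gauss {r : ℝ} (hr : r < 0) :
    Integrable (fun z : Euc N => (1 + ‖z‖) * Real.exp (r * ‖z‖ ^ 2)) := by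
  have h2 : 0 < -r / 2 := by linarith
  refine ((integrable_gauss (N := N) (r := r / 2) (by linarith)).const_mul
    (2 + 2 / (-r / 2))).mono' (by fun_prop) (Eventually.of_forall fun z => ?_)
  rw [Real.norm_of_nonneg (by positivity)]
  have h1 : 1 + ‖z‖ ≤ (2 + 2 / (-r / 2)) * Real.exp ((-r / 2) * ‖z‖ ^ 2) := by
    have := one_add_sq_le_exp h2 ‖z‖
    nlinarith [norm_nonneg z]
  calc (1 + ‖z‖) * Real.exp (r * ‖z‖ ^ 2)
      ≤ (2 + 2 / (-r / 2)) * Real.exp ((-r / 2) * ‖z‖ ^ 2) * Real.exp (r * ‖z‖ ^ 2) := by gcongr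
    _ = _ := by rw [mul_assoc, ← Real.exp_add]; ring_nf

theorem GaussLip.integrable {c b r : ℝ} (hr : r < 0) {Ψ : Opr N → Euc N → F} (h : GaussLip c b r Ψ)
    {B : Opr N} (hB : B ∈ Ell N c b) : Integrable (Ψ B) := by
  have hc := h.continuous_snd hB
  obtain ⟨C, hC, h⟩ := h
  exact ((integrable_gauss (N := N) hr).const_mul C).mono' hc.aestronglyMeasurable
    (Eventually.of_forall fun z => (h B hB z).1)

theorem gm_lower {c b : ℝ} (hc : 0 < c) (hb : 0 < b) :
    ∃ m, 0 < m ∧ ∀ B ∈ Ell N c b, m ≤ gm B := by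
  refine ⟨∫ z : Euc N, Real.exp (-(b / 2) * ‖z‖ ^ 2), ?_, fun B hB => ?_⟩
  · rw [integral_pos_iff_support_of_nonneg (fun _ => (Real.exp_pos _).le)
      (integrable_gauss (by linarith))]
    have : Function.support (fun z : Euc N => Real.exp (-(b / 2) * ‖z‖ ^ 2)) = univ := by
      ext z; simp [Real.exp_ne_zero]
    rw [this]
    simp [MeasureTheory.Measure.measure_univ_pos, NeZero.ne]
  · refine integral_mono (integrable_gauss (by linarith))
      ((GaussLip.ge (b := b) hc).integrable (by linarith) hB) fun z => ?_
    unfold ge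
    refine Real.exp_le_exp.2 ?_
    have h1 : ⟪B z, z⟫ ≤ b * ‖z‖ ^ 2 := by
      calc ⟪B z, z⟫ ≤ ‖B z‖ * ‖z‖ := real_inner_le_norm _ _
        _ ≤ ‖B‖ * ‖z‖ * ‖z‖ := by gcongr; exact B.le_opNorm z
        _ ≤ b * ‖z‖ * ‖z‖ := by gcongr; exact hB.2.2
        _ = _ := by ring
    linarith

theorem gm_lip {c b : ℝ} (hc : 0 < c) :
    ∃ C, 0 ≤ C ∧ ∀ B ∈ Ell N c b, ∀ B' ∈ Ell N c b, |gm B - gm B'| ≤ C * ‖B - B'‖ := by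
  have hG := GaussLip.ge (N := N) (b := b) hc
  have hr : -(c / 8) < 0 := by linarith
  obtain ⟨C, hC, h⟩ := id hG
  refine ⟨C * ∫ z : Euc N, Real.exp (-(c / 8) * ‖z‖ ^ 2),
    mul_nonneg hC (integral_nonneg fun _ => (Real.exp_pos _).le), fun B hB B' hB' => ?_⟩
  unfold gm
  rw [← integral_sub (hG.integrable hr hB) (hG.integrable hr hB'), ← Real.norm_eq_abs]
  refine (norm_integral_le_of_norm_le
    ((integrable_gauss hr).const_mul (C * ‖B - B'‖)) (Eventually.of_forall fun z => ?_)).trans ?_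
  · simpa using (h B hB z).2 B' hB' z (by simp)
  · rw [integral_const_mul]
    exact le_of_eq (by ring)

theorem GaussLip.gm_inv {c b ε : ℝ} (hc : 0 < c) (hb : 0 < b) (hε : 0 ≤ ε) :
    GaussLip (N := N) c b ε (fun B _ => (gm B)⁻¹) := by
  obtain ⟨m, hm, hlow⟩ := gm_lower (N := N) hc hb
  obtain ⟨C, hC, hlip⟩ := gm_lip (N := N) (b := b) hc
  refine GaussLip.of_const (K := m⁻¹ + C / m ^ 2) hε (fun B hB => ?_) (fun B hB B' hB' => ?_)
  · have h1 := hlow B hB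
    have h2 : 0 < gm B := by linarith
    rw [Real.norm_of_nonneg (inv_nonneg.2 h2.le)]
    have : (gm B)⁻¹ ≤ m⁻¹ := by gcongr
    have : 0 ≤ C / m ^ 2 := by positivity
    linarith
  · have h1 := hlow B hB
    have h2 := hlow B' hB'
    have h1' : 0 < gm B := by linarith
    have h2' : 0 < gm B' := by linarith
    have h3 := hlip B' hB' B hB
    rw [norm_sub_rev] at h3
    rw [inv_sub_inv h1'.ne' h2'.ne', Real.norm_eq_abs, abs_div, abs_of_pos (mul_pos h1' h2')]
    calc |gm B' - gm B| / (gm B * gm B') ≤ (C * ‖B - B'‖) / (m * m) := by gcongr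
      _ = C / m ^ 2 * ‖B - B'‖ := by field_simp
      _ ≤ _ := by gcongr; have : 0 < m⁻¹ := by positivity
                  linarith

theorem GaussLip.g0 {c b : ℝ} (hc : 0 < c) (hb : 0 < b) : GaussLip (N := N) c b (-(c / 8)) g0 := by
  have := GaussLip.bilin (ContinuousLinearMap.mul ℝ ℝ) (GaussLip.gm_inv (N := N) (ε := 0) hc hb le_rfl)
    (GaussLip.ge (b := b) hc)
  rw [zero_add] at this
  exact this

theorem GaussLip.g1 {c b : ℝ} (hc : 0 < c) (hb : 0 < b) : GaussLip (N := N) c b (-(c / 16)) g1 := by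
  have h1 := GaussLip.bilin (ContinuousLinearMap.lsmul ℝ ℝ) (GaussLip.g0 (N := N) hc hb)
    (GaussLip.apply (N := N) (c := c) (b := b) (ε := c / 16) (by linarith))
  have h2 := GaussLip.clm (-ContinuousLinearMap.id ℝ (Euc N)) h1
  exact h2.mono (by linarith)

theorem GaussLip.g2 {c b : ℝ} (hc : 0 < c) (hb : 0 < b) : GaussLip (N := N) c b (-(c / 16)) g2 := by
  have ha := GaussLip.apply (N := N) (c := c) (b := b) (ε := c / 32) (by linarith)
  have h1 := GaussLip.bilin (W := Opr N)
    ((ContinuousLinearMap.smulRightL ℝ (Euc N) (Euc N)).comp (innerSL ℝ)) ha ha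
  have h2 : GaussLip (N := N) c b (c / 32 + c / 32) (fun B _ => B) :=
    GaussLip.of_const (K := b + 1) (by linarith) (fun B hB => by linarith [hB.2.2])
      (fun B _ B' _ => by nlinarith [norm_nonneg (B - B')])
  have h3 := GaussLip.bilin (ContinuousLinearMap.lsmul ℝ ℝ) (GaussLip.g0 (N := N) hc hb) (h1.sub h2)
  exact h3.mono (by linarith)

end Gaussian

end Parabolic

namespace Parabolic

open Filter Topology
open scoped RealInnerProductSpace

section Derivatives

variable {N : ℕ} {F : Type*} [NormedAddCommGroup F] [NormedSpace ℝ F]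

theorem hasFDerivAt_g0 {c b : ℝ} {B : Opr N} (hB : B ∈ Ell N c b) (z : Euc N) :
    HasFDerivAt (g0 B) (innerSL ℝ (g1 B z)) z := by
  have h1 : HasFDerivAt (fun z : Euc N => ⟪B z, z⟫) _ z := B.hasFDerivAt.inner ℝ (hasFDerivAt_id z)
  have h2 := ((h1.const_mul (-(1 / 2))).exp).const_mul (gm B)⁻¹
  refine h2.congr_fderiv ?_
  ext v
  have h3 := hB.1 v z
  simp [g1, g0, ge, h3, real_inner_comm]
  ring

theorem hasFDerivAt_g1 {c b : ℝ} {B : Opr N} (hB : B ∈ Ell N c b) (z : Euc N) :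
    HasFDerivAt (g1 B) (g2 B z) z := by
  have h2 := ((hasFDerivAt_g0 hB z).smul (B.hasFDerivAt (x := z))).neg
  refine h2.congr_fderiv ?_
  ext1 v
  simp [g1, g2, smul_smul, smul_sub, ← sub_eq_add_neg]

theorem gm_pos {c b : ℝ} (hc : 0 < c) (hb : 0 < b) {B : Opr N} (hB : B ∈ Ell N c b) :
    0 < gm B := by
  obtain ⟨m, hm, h⟩ := gm_lower (N := N) hc hb
  linarith [h B hB]

theorem integral_g0 {c b : ℝ} (hc : 0 < c) (hb : 0 < b) {B : Opr N} (hB : B ∈ Ell N c b) :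
    ∫ z, g0 B z = 1 := by
  simp only [g0]
  rw [integral_const_mul]
  exact inv_mul_cancel₀ (gm_pos hc hb hB).ne'

theorem integral_fderiv_eq_zero [CompleteSpace F] {g : Euc N → F} {g' : Euc N → Euc N →L[ℝ] F}
    (hg : Integrable g) (hg' : Integrable g') (h : ∀ z, HasFDerivAt g (g' z) z) :
    ∫ z, g' z = 0 := by
  ext1 v
  rw [ContinuousLinearMap.integral_apply hg']
  have := integral_bilinear_hasLineDerivAt_right_eq_neg_left_of_integrable (μ := volume)
    (f := fun _ : Euc N => (1 : ℝ)) (f' := fun _ => 0) (g := g) (g' := fun z => g' z v) (v := v)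
    (B := ContinuousLinearMap.lsmul ℝ ℝ) (by simp) (by simpa using hg'.apply_continuousLinearMap v)
    (by simpa using hg) (fun _ _ => by simpa using (hasFDerivAt_const (1 : ℝ) _).hasLineDerivAt v)
    (fun z _ => (h z).hasLineDerivAt v)
  simpa using this

theorem integral_g1 {c b : ℝ} (hc : 0 < c) (hb : 0 < b) {B : Opr N} (hB : B ∈ Ell N c b) :
    ∫ z, g1 B z = 0 := by
  have i1 := (GaussLip.g1 (N := N) hc hb).integrable (by linarith) hB
  have h := integral_fderiv_eq_zero ((GaussLip.g0 (N := N) hc hb).integrable (by linarith) hB)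
    ((innerSL ℝ).integrable_comp i1) (hasFDerivAt_g0 hB)
  rw [ContinuousLinearMap.integral_comp_comm _ i1] at h
  have := congrArg norm h
  rwa [innerSL_apply_norm, norm_zero, norm_eq_zero] at this

theorem integral_g2 {c b : ℝ} (hc : 0 < c) (hb : 0 < b) {B : Opr N} (hB : B ∈ Ell N c b) :
    ∫ z, g2 B z = 0 :=
  integral_fderiv_eq_zero ((GaussLip.g1 (N := N) hc hb).integrable (by linarith) hB)
    ((GaussLip.g2 (N := N) hc hb).integrable (by linarith) hB) (hasFDerivAt_g1 hB)

theorem gm_smul {l : ℝ} (hl : 0 < l) (B : Opr N) : gm ((l⁻¹ ^ 2) • B) = l ^ N * gm B := by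
  have h : ∀ z, ge ((l⁻¹ ^ 2) • B) z = ge B (l⁻¹ • z) := fun z => by
    simp only [ge, _root_.smul_apply, map_smul, inner_smul_left, inner_smul_right]
    congr 1
    simp; ring
  unfold gm
  simp_rw [h]
  rw [Measure.integral_comp_inv_smul volume (ge B) l]
  simp [abs_of_pos hl]

theorem g0_smul {l : ℝ} (hl : 0 < l) (B : Opr N) (z : Euc N) :
    g0 ((l⁻¹ ^ 2) • B) z = (l ^ N)⁻¹ * g0 B (l⁻¹ • z) := by
  have h : ge ((l⁻¹ ^ 2) • B) z = ge B (l⁻¹ • z) := by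
    simp only [ge, _root_.smul_apply, map_smul, inner_smul_left, inner_smul_right]
    congr 1
    simp; ring
  rw [g0, gm_smul hl, h, g0, mul_inv, mul_assoc]

theorem g2_smul {l : ℝ} (hl : 0 < l) (B : Opr N) (z : Euc N) :
    g2 ((l⁻¹ ^ 2) • B) z = ((l ^ N)⁻¹ * l⁻¹ ^ 2) • g2 B (l⁻¹ • z) := by
  ext1 v
  simp only [g2, g0_smul hl, _root_.smul_apply, map_smul, _root_.sub_apply,
    ContinuousLinearMap.smulRight_apply, innerSL_apply_apply, smul_smul, smul_sub]
  congr 2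
  · simp; ring
  · ring

end Derivatives

end Parabolic

namespace Parabolic

open Filter Topology
open scoped RealInnerProductSpace

section Operators

variable {N : ℕ} {F : Type*} [NormedAddCommGroup F] [NormedSpace ℝ F]

/-- The scaled convolution-type operator with kernel `Ψ (B y)`, frozen at the integration point. -/
def Op (Ψ : Opr N → Euc N → F) (B : Euc N → Opr N) (l : ℝ) (φ : Euc N → ℝ) (x : Euc N) : F :=
  ∫ z, φ (x - l • z) • Ψ (B (x - l • z)) z

theorem op_eq_scaled (Ψ : Opr N → Euc N → F) (B : Euc N → Opr N) {l : ℝ} (hl : 0 < l)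
    (φ : Euc N → ℝ) (x : Euc N) :
    Op Ψ B l φ x = (l ^ N)⁻¹ • ∫ y, φ y • Ψ (B y) (l⁻¹ • (x - y)) := by
  have h1 := integral_sub_left_eq_self
    (fun w : Euc N => φ (x - w) • Ψ (B (x - w)) (l⁻¹ • w)) volume x
  have h2 := Measure.integral_comp_smul volume
    (fun w : Euc N => φ (x - w) • Ψ (B (x - w)) (l⁻¹ • w)) l
  simp only [sub_sub_cancel, smul_smul, inv_mul_cancel₀ hl.ne', one_smul] at h1 h2
  rw [Op, h2, h1]
  simp [abs_of_pos hl]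

theorem integrable_comp_scaled {G : Type*} [NormedAddCommGroup G] {g : Euc N → G} (hg : Integrable g)
    {l : ℝ} (hl : l ≠ 0) (x : Euc N) :
    Integrable (fun y => g (l⁻¹ • (x - y))) := by
  have h1 := hg.comp_smul (inv_ne_zero hl)
  exact h1.comp_sub_left x

theorem integral_comp_scaled [CompleteSpace F] (g : Euc N → F)
    {l : ℝ} (hl : 0 < l) (x : Euc N) :
    ∫ y, g (l⁻¹ • (x - y)) = l ^ N • ∫ y, g y := by
  rw [integral_sub_left_eq_self (fun w : Euc N => g (l⁻¹ • w)) volume x,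
    Measure.integral_comp_inv_smul]
  simp [abs_of_pos hl]

variable {c b r : ℝ} {Ψ : Opr N → Euc N → F}

theorem GaussLip.continuous_comp (h : GaussLip c b r Ψ) {X : Type*} [TopologicalSpace X]
    {f : X → Opr N} {g : X → Euc N} (hf : Continuous f) (hg : Continuous g)
    (hB : ∀ x, f x ∈ Ell N c b) : Continuous (fun x => Ψ (f x) (g x)) :=
  h.continuousOn.comp_continuous (f := fun x => (f x, g x)) (by fun_prop) (fun x => ⟨hB x, mem_univ _⟩)

theorem op_integrable (hr : r < 0) (h : GaussLip c b r Ψ) {B : Euc N → Opr N}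
    (hB : ∀ y, B y ∈ Ell N c b) (hBc : Continuous B) {φ : Euc N → ℝ} (hφ : Continuous φ)
    {M : ℝ} (hM : ∀ y, |φ y| ≤ M) (l : ℝ) (x : Euc N) :
    Integrable (fun z => φ (x - l • z) • Ψ (B (x - l • z)) z) := by
  have hc : Continuous (fun z => φ (x - l • z) • Ψ (B (x - l • z)) z) :=
    (hφ.comp (by fun_prop)).smul
      (h.continuous_comp (hBc.comp (by fun_prop)) continuous_id (fun _ => hB _))
  obtain ⟨C, hC, h⟩ := h
  refine ((integrable_gauss (N := N) hr).const_mul (M * C)).mono' hc.aestronglyMeasurable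
    (Eventually.of_forall fun z => ?_)
  rw [norm_smul, mul_assoc]
  exact mul_le_mul (hM _) (h _ (hB _) z).1 (norm_nonneg _) ((abs_nonneg _).trans (hM 0))

theorem op_integrable_y (hr : r < 0) (h : GaussLip c b r Ψ) {B : Euc N → Opr N}
    (hB : ∀ y, B y ∈ Ell N c b) (hBc : Continuous B) {φ : Euc N → ℝ} (hφ : Continuous φ)
    {M : ℝ} (hM : ∀ y, |φ y| ≤ M) {l : ℝ} (hl : l ≠ 0) (x : Euc N) :
    Integrable (fun y => φ y • Ψ (B y) (l⁻¹ • (x - y))) := by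
  have := integrable_comp_scaled (op_integrable hr h hB hBc hφ hM l x) hl x
  refine this.congr (Eventually.of_forall fun y => ?_)
  simp [smul_smul, mul_inv_cancel₀ hl]

theorem rpow_le_one_add {x γ : ℝ} (hx : 0 ≤ x) (h0 : 0 ≤ γ) (h1 : γ ≤ 1) : x ^ γ ≤ 1 + x :=
  calc x ^ γ ≤ (1 + x) ^ γ := Real.rpow_le_rpow hx (by linarith) h0
    _ ≤ (1 + x) ^ (1 : ℝ) := Real.rpow_le_rpow_of_exponent_le (by linarith) h1
    _ = _ := Real.rpow_one _

theorem op_bound (hr : r < 0) (h : GaussLip c b r Ψ) :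
    ∃ C, 0 ≤ C ∧ ∀ B : Euc N → Opr N, (∀ y, B y ∈ Ell N c b) → ∀ (φ : Euc N → ℝ) (x : Euc N)
      (Q γ : ℝ), 0 ≤ Q → 0 ≤ γ → γ ≤ 1 → (∀ y, |φ y| ≤ Q * ‖x - y‖ ^ γ) → ∀ l, 0 ≤ l →
      ‖Op Ψ B l φ x‖ ≤ C * Q * l ^ γ := by
  obtain ⟨C, hC, h⟩ := h
  refine ⟨C * ∫ z : Euc N, (1 + ‖z‖) * Real.exp (r * ‖z‖ ^ 2),
    mul_nonneg hC (integral_nonneg fun _ => by positivity), ?_⟩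
  intro B hB φ x Q γ hQ hγ0 hγ1 hφ l hl
  refine (norm_integral_le_of_norm_le ((integrable_one_add_gauss hr).const_mul (C * Q * l ^ γ))
    (Eventually.of_forall fun z => ?_)).trans (le_of_eq ?_)
  · have h1 := (h _ (hB (x - l • z)) z).1
    have h2 := hφ (x - l • z)
    rw [sub_sub_cancel, norm_smul, Real.norm_of_nonneg hl, Real.mul_rpow hl (norm_nonneg _)] at h2
    have h3 := rpow_le_one_add (norm_nonneg z) hγ0 hγ1
    rw [norm_smul]
    calc _ ≤ (Q * (l ^ γ * ‖z‖ ^ γ)) * (C * Real.exp (r * ‖z‖ ^ 2)) := by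
          rw [Real.norm_eq_abs]; gcongr
      _ ≤ (Q * (l ^ γ * (1 + ‖z‖))) * (C * Real.exp (r * ‖z‖ ^ 2)) := by gcongr
      _ = _ := by ring
  · rw [integral_const_mul]; ring

theorem op_lip [CompleteSpace F] (hr : r < 0) (h : GaussLip c b r Ψ) :
    ∃ C, 0 ≤ C ∧ ∀ B : Euc N → Opr N, (∀ y, B y ∈ Ell N c b) → Continuous B →
      ∀ (φ : Euc N → ℝ) (x : Euc N) (Q γ M : ℝ), Continuous φ → (∀ y, |φ y| ≤ M) →
      0 ≤ Q → 0 ≤ γ → γ ≤ 1 → (∀ y, |φ y| ≤ Q * ‖x - y‖ ^ γ) → ∀ l, 0 < l →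
      ∀ x', ‖x - x'‖ ≤ l → ‖Op Ψ B l φ x - Op Ψ B l φ x'‖ ≤ C * Q * l ^ γ * (‖x - x'‖ / l) := by
  obtain ⟨C, hC, hb⟩ := id h
  refine ⟨C * ∫ z : Euc N, (1 + ‖z‖) * Real.exp (r * ‖z‖ ^ 2),
    mul_nonneg hC (integral_nonneg fun _ => by positivity), ?_⟩
  intro B hB hBc φ x Q γ M hφc hM hQ hγ0 hγ1 hφ l hl x' hx'
  rw [op_eq_scaled Ψ B hl, op_eq_scaled Ψ B hl, ← smul_sub, ← integral_sub
    (op_integrable_y hr h hB hBc hφc hM hl.ne' x) (op_integrable_y hr h hB hBc hφc hM hl.ne' x'),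
    norm_smul]
  have hi := integrable_comp_scaled (integrable_one_add_gauss (N := N) hr) hl.ne' x
  have h1 : ‖∫ y, φ y • Ψ (B y) (l⁻¹ • (x - y)) - φ y • Ψ (B y) (l⁻¹ • (x' - y))‖ ≤
      ∫ y, C * Q * l ^ γ * (‖x - x'‖ / l) *
        ((1 + ‖l⁻¹ • (x - y)‖) * Real.exp (r * ‖l⁻¹ • (x - y)‖ ^ 2)) := by
    refine norm_integral_le_of_norm_le (hi.const_mul _) (Eventually.of_forall fun y => ?_)
    set z := l⁻¹ • (x - y) with hz
    have hzz : z - l⁻¹ • (x' - y) = l⁻¹ • (x - x') := by rw [hz, ← smul_sub]; congr 1; abel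
    have hn : ‖z - l⁻¹ • (x' - y)‖ = ‖x - x'‖ / l := by
      rw [hzz, norm_smul, norm_inv, Real.norm_of_nonneg hl.le]; ring
    have h2 := (hb _ (hB y) z).2 _ (hB y) (l⁻¹ • (x' - y)) (by
      rw [hn]; exact (div_le_one hl).2 hx')
    rw [hn, sub_self, norm_zero, zero_add] at h2
    have h3 := hφ y
    have hxy : x - y = l • z := by rw [hz, smul_smul, mul_inv_cancel₀ hl.ne', one_smul]
    rw [hxy, norm_smul, Real.norm_of_nonneg hl.le, Real.mul_rpow hl.le (norm_nonneg _)] at h3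
    have h4 := rpow_le_one_add (norm_nonneg z) hγ0 hγ1
    rw [← smul_sub, norm_smul]
    calc _ ≤ (Q * (l ^ γ * ‖z‖ ^ γ)) * (C * (‖x - x'‖ / l) * Real.exp (r * ‖z‖ ^ 2)) := by
          rw [Real.norm_eq_abs]; gcongr
      _ ≤ (Q * (l ^ γ * (1 + ‖z‖))) * (C * (‖x - x'‖ / l) * Real.exp (r * ‖z‖ ^ 2)) := by gcongr
      _ = _ := by ring
  have hlN : 0 < l ^ N := pow_pos hl N
  calc _ ≤ ‖(l ^ N)⁻¹‖ * (∫ y, C * Q * l ^ γ * (‖x - x'‖ / l) *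
        ((1 + ‖l⁻¹ • (x - y)‖) * Real.exp (r * ‖l⁻¹ • (x - y)‖ ^ 2))) := by gcongr
    _ = _ := by
      rw [integral_const_mul, integral_comp_scaled
        (fun z : Euc N => (1 + ‖z‖) * Real.exp (r * ‖z‖ ^ 2)) hl, norm_inv,
        Real.norm_of_nonneg hlN.le, smul_eq_mul]
      generalize (∫ z : Euc N, (1 + ‖z‖) * Real.exp (r * ‖z‖ ^ 2)) = I
      field_simp

theorem op_cancel [CompleteSpace F] (hr : r < 0) (h : GaussLip c b r Ψ)
    (h0 : ∀ B ∈ Ell N c b, ∫ z, Ψ B z = 0) :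
    ∃ C, 0 ≤ C ∧ ∀ B : Euc N → Opr N, (∀ y, B y ∈ Ell N c b) → Continuous B →
      ∀ L, 0 ≤ L → (∀ x y, ‖B x - B y‖ ≤ L * ‖x - y‖) →
      ∀ (φ : Euc N → ℝ) (x : Euc N) (Q γ M : ℝ), Continuous φ → (∀ y, |φ y| ≤ M) →
      0 ≤ Q → 0 ≤ γ → γ ≤ 1 → (∀ y, |φ y - φ x| ≤ Q * ‖x - y‖ ^ γ) → ∀ l, 0 ≤ l →
      ‖Op Ψ B l φ x‖ ≤ C * (Q * l ^ γ + L * M * l) := by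
  obtain ⟨C, hC, hb⟩ := id h
  refine ⟨C * ∫ z : Euc N, (1 + ‖z‖) * Real.exp (r * ‖z‖ ^ 2),
    mul_nonneg hC (integral_nonneg fun _ => by positivity), ?_⟩
  intro B hB hBc L hL0 hL φ x Q γ M hφc hM hQ hγ0 hγ1 hφ l hl
  have hM0 : 0 ≤ M := (abs_nonneg _).trans (hM 0)
  have e1 : Op Ψ B l φ x = ∫ z, (φ (x - l • z) • Ψ (B (x - l • z)) z - φ x • Ψ (B x) z) := by
    rw [integral_sub (op_integrable hr h hB hBc hφc hM l x) (((h.integrable hr (hB x)).smul (φ x) :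
        Integrable (fun z => φ x • Ψ (B x) z))),
      integral_smul, h0 _ (hB x), smul_zero, sub_zero, Op]
  rw [e1]
  refine (norm_integral_le_of_norm_le ((integrable_one_add_gauss hr).const_mul
    (C * (Q * l ^ γ + L * M * l))) (Eventually.of_forall fun z => ?_)).trans (le_of_eq ?_)
  · have h1 := (hb _ (hB (x - l • z)) z).1
    have h2 := hφ (x - l • z)
    have h3 := rpow_le_one_add (norm_nonneg z) hγ0 hγ1
    have h4 := (hb _ (hB (x - l • z)) z).2 _ (hB x) z (by simp)
    have h5 := hL (x - l • z) x
    rw [sub_sub_cancel, norm_smul, Real.norm_of_nonneg hl, Real.mul_rpow hl (norm_nonneg _)] at h2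
    rw [sub_sub_cancel_left, norm_neg, norm_smul, Real.norm_of_nonneg hl] at h5
    rw [sub_self, norm_zero, add_zero] at h4
    have e2 : φ (x - l • z) • Ψ (B (x - l • z)) z - φ x • Ψ (B x) z
        = (φ (x - l • z) - φ x) • Ψ (B (x - l • z)) z
          + φ x • (Ψ (B (x - l • z)) z - Ψ (B x) z) := by
      rw [sub_smul, smul_sub]; abel
    rw [e2]
    refine (norm_add_le _ _).trans ?_
    rw [norm_smul, norm_smul]
    calc _ ≤ (Q * (l ^ γ * ‖z‖ ^ γ)) * (C * Real.exp (r * ‖z‖ ^ 2)) +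
          M * (C * (L * (l * ‖z‖)) * Real.exp (r * ‖z‖ ^ 2)) := by
          rw [Real.norm_eq_abs, Real.norm_eq_abs]
          refine add_le_add (by gcongr) (mul_le_mul (hM x) (h4.trans ?_) (norm_nonneg _) hM0)
          gcongr
      _ ≤ (Q * (l ^ γ * (1 + ‖z‖))) * (C * Real.exp (r * ‖z‖ ^ 2)) +
          M * (C * (L * (l * (1 + ‖z‖))) * Real.exp (r * ‖z‖ ^ 2)) := by gcongr; linarith
      _ = _ := by ring
  · rw [integral_const_mul]; ring

theorem op_continuousAt (hr : r < 0) (h : GaussLip c b r Ψ) {X : Type*} [TopologicalSpace X]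
    [FirstCountableTopology X] {B : X → Euc N → Opr N} {φ : X → Euc N → ℝ} {l : X → ℝ}
    {p : X → Euc N} {ξ : X} {M : ℝ} (hB : ∀ η y, B η y ∈ Ell N c b)
    (hBc : ∀ᶠ η in 𝓝 ξ, Continuous (B η)) (hφc : ∀ᶠ η in 𝓝 ξ, Continuous (φ η))
    (hM : ∀ᶠ η in 𝓝 ξ, ∀ y, |φ η y| ≤ M)
    (hB' : ∀ z, ContinuousAt (fun η => B η (p η - l η • z)) ξ)
    (hφ' : ∀ z, ContinuousAt (fun η => φ η (p η - l η • z)) ξ) :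
    ContinuousAt (fun η => Op Ψ (B η) (l η) (φ η) (p η)) ξ := by
  obtain ⟨C, hC, hb⟩ := id h
  refine continuousAt_of_dominated (bound := fun z => M * C * Real.exp (r * ‖z‖ ^ 2)) ?_ ?_
    ((integrable_gauss hr).const_mul _) (Eventually.of_forall fun z => ?_)
  · filter_upwards [hBc, hφc, hM] with η h1 h2 h3
    exact (op_integrable hr h (hB η) h1 h2 h3 (l η) (p η)).aestronglyMeasurable
  · filter_upwards [hM] with η h3
    refine Eventually.of_forall fun z => ?_
    rw [norm_smul, mul_assoc]
    exact mul_le_mul (h3 _) (hb _ (hB _ _) z).1 (norm_nonneg _) ((abs_nonneg _).trans (h3 0))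
  · refine (hφ' z).smul ?_
    have h1 := h.continuousOn (B ξ (p ξ - l ξ • z), z) ⟨hB _ _, mem_univ _⟩
    refine Tendsto.comp (g := fun p : Opr N × Euc N => Ψ p.1 p.2)
      (f := fun η => (B η (p η - l η • z), z)) (ContinuousWithinAt.tendsto h1) ?_
    refine tendsto_nhdsWithin_iff.2 ⟨?_, Eventually.of_forall fun η => ⟨hB _ _, mem_univ _⟩⟩
    exact (hB' z).prodMk continuousAt_const

theorem op_hasFDerivAt [CompleteSpace F] (hr : r < 0) (h : GaussLip c b r Ψ)
    {Ψ' : Opr N → Euc N → Euc N →L[ℝ] F} {r' : ℝ} (hr' : r' < 0) (h' : GaussLip c b r' Ψ')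
    (hd : ∀ B ∈ Ell N c b, ∀ z, HasFDerivAt (Ψ B) (Ψ' B z) z)
    {B : Euc N → Opr N} (hB : ∀ y, B y ∈ Ell N c b) (hBc : Continuous B) {φ : Euc N → ℝ}
    (hφ : Continuous φ) {M : ℝ} (hM : ∀ y, |φ y| ≤ M) {l : ℝ} (hl : 0 < l) (x : Euc N) :
    HasFDerivAt (Op Ψ B l φ) (l⁻¹ • Op Ψ' B l φ x) x := by
  have hM0 : 0 ≤ M := (abs_nonneg _).trans (hM 0)
  obtain ⟨C, hC, hb⟩ := id h
  have e1 : Op Ψ B l φ = fun x => (l ^ N)⁻¹ • ∫ y, φ y • Ψ (B y) (l⁻¹ • (x - y)) :=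
    funext fun x => op_eq_scaled Ψ B hl φ x
  rw [e1, op_eq_scaled Ψ' B hl φ x, smul_comm, ← integral_smul]
  refine HasFDerivAt.fun_const_smul ?_ _
  have hi := (integrable_comp_scaled (integrable_gauss (N := N) hr) hl.ne' x).const_mul
    (M * (C * l⁻¹))
  refine (hasFDerivAt_integral_of_dominated_loc_of_lip' (Metric.ball_mem_nhds x hl)
    (fun x' _ => (op_integrable_y hr h hB hBc hφ hM hl.ne' x').aestronglyMeasurable)
    (op_integrable_y hr h hB hBc hφ hM hl.ne' x)
    ((op_integrable_y hr' h' hB hBc hφ hM hl.ne' x).smul l⁻¹).aestronglyMeasurable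
    (Eventually.of_forall fun y x' hx' => ?_) hi (Eventually.of_forall fun y => ?_)).2
  · rw [mem_ball_iff_norm'] at hx'
    have hzz : l⁻¹ • (x - y) - l⁻¹ • (x' - y) = l⁻¹ • (x - x') := by rw [← smul_sub]; congr 1; abel
    have hn : ‖l⁻¹ • (x - y) - l⁻¹ • (x' - y)‖ = l⁻¹ * ‖x - x'‖ := by
      rw [hzz, norm_smul, norm_inv, Real.norm_of_nonneg hl.le]
    have h2 := (hb _ (hB y) (l⁻¹ • (x - y))).2 _ (hB y) (l⁻¹ • (x' - y)) (by
      rw [hn, inv_mul_le_iff₀ hl, mul_one]; exact hx'.le)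
    rw [hn, sub_self, norm_zero, zero_add, norm_sub_rev] at h2
    rw [← smul_sub, norm_smul, norm_sub_rev x' x]
    calc _ ≤ M * (C * (l⁻¹ * ‖x - x'‖) * Real.exp (r * ‖l⁻¹ • (x - y)‖ ^ 2)) :=
          mul_le_mul (hM y) h2 (norm_nonneg _) hM0
      _ = _ := by ring
  · have h1 : HasFDerivAt (fun x : Euc N => l⁻¹ • (x - y)) (l⁻¹ • ContinuousLinearMap.id ℝ _) x :=
      ((hasFDerivAt_id x).sub_const y).const_smul l⁻¹
    refine (((hd _ (hB y) _).comp x h1).const_smul (φ y)).congr_fderiv ?_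
    ext1 v
    simp [smul_smul, mul_comm]

theorem op_clm [CompleteSpace F] {G : Type*} [NormedAddCommGroup G] [NormedSpace ℝ G]
    [CompleteSpace G] (hr : r < 0) (h : GaussLip c b r Ψ) {B : Euc N → Opr N}
    (hB : ∀ y, B y ∈ Ell N c b) (hBc : Continuous B) {φ : Euc N → ℝ} (hφ : Continuous φ)
    {M : ℝ} (hM : ∀ y, |φ y| ≤ M) (l : ℝ) (x : Euc N) (T : F →L[ℝ] G) :
    Op (fun B z => T (Ψ B z)) B l φ x = T (Op Ψ B l φ x) := by
  rw [Op, Op, ← ContinuousLinearMap.integral_comp_comm _ (op_integrable hr h hB hBc hφ hM l x)]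
  simp only [map_smul]

theorem op_add (hr : r < 0) (h : GaussLip c b r Ψ) {B : Euc N → Opr N}
    (hB : ∀ y, B y ∈ Ell N c b) (hBc : Continuous B) {φ ψ : Euc N → ℝ} (hφ : Continuous φ)
    (hψ : Continuous ψ) {M M' : ℝ} (hM : ∀ y, |φ y| ≤ M) (hM' : ∀ y, |ψ y| ≤ M')
    (l : ℝ) (x : Euc N) :
    Op Ψ B l (fun y => φ y + ψ y) x = Op Ψ B l φ x + Op Ψ B l ψ x := by
  simp only [Op, add_smul]
  exact integral_add (op_integrable hr h hB hBc hφ hM l x) (op_integrable hr h hB hBc hψ hM' l x)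

theorem op_const_mul (B : Euc N → Opr N) (φ : Euc N → ℝ) (k l : ℝ) (x : Euc N) :
    Op Ψ B l (fun y => k * φ y) x = k • Op Ψ B l φ x := by
  simp only [Op, mul_smul]
  exact integral_smul _ _

end Operators

end Parabolic

namespace Parabolic

open Filter Topology
open scoped RealInnerProductSpace

section Coefficients

variable {N : ℕ}

/-- The trace of `m D` for a matrix `m` and an operator `D`. -/
def trL (m : Matrix (Fin N) (Fin N) ℝ) : Opr N →L[ℝ] ℝ :=
  ∑ i, ∑ j, m i j • (EuclideanSpace.proj i : Euc N →L[ℝ] ℝ).comp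
    (ContinuousLinearMap.apply ℝ (Euc N) (EuclideanSpace.single j (1 : ℝ)))

theorem trL_apply (m : Matrix (Fin N) (Fin N) ℝ) (D : Opr N) :
    trL m D = ∑ i, ∑ j, m i j * (D (EuclideanSpace.single j 1)) i := by
  simp [trL, _root_.sum_apply]

/-- The matrix unit `e_i e_jᵀ` as an operator. -/
def eij (i j : Fin N) : Opr N :=
  (EuclideanSpace.proj j : Euc N →L[ℝ] ℝ).smulRight (EuclideanSpace.single i (1 : ℝ))

/-- The operator on Euclidean space given by a matrix. -/
def mop (m : Matrix (Fin N) (Fin N) ℝ) : Opr N := ∑ i, ∑ j, m i j • eij i j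

theorem inner_mop (m : Matrix (Fin N) (Fin N) ℝ) (v w : Euc N) :
    ⟪mop m v, w⟫ = ∑ i, ∑ j, m i j * v j * w i := by
  simp only [mop, eij, _root_.sum_apply, _root_.smul_apply,
    ContinuousLinearMap.smulRight_apply, sum_inner, inner_smul_left, EuclideanSpace.inner_single_left]
  simp [mul_assoc]

theorem trL_smulRight (m : Matrix (Fin N) (Fin N) ℝ) (v : Euc N) :
    trL m ((innerSL ℝ v).smulRight v) = ⟪mop m v, v⟫ := by
  rw [trL_apply, inner_mop]
  simp [EuclideanSpace.inner_single_right, mul_assoc]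

/-- The sum of the operator norms of the matrix units. -/
def eijNorm (N : ℕ) : ℝ := ∑ i : Fin N, ∑ j : Fin N, ‖eij i j‖

theorem eijNorm_nonneg (N : ℕ) : 0 ≤ eijNorm N :=
  Finset.sum_nonneg fun _ _ => Finset.sum_nonneg fun _ _ => norm_nonneg _

theorem norm_mop_le {m : Matrix (Fin N) (Fin N) ℝ} {M : ℝ} (h : ∀ i j, |m i j| ≤ M) :
    ‖mop m‖ ≤ M * eijNorm N := by
  unfold mop eijNorm
  rw [Finset.mul_sum]
  refine (norm_sum_le _ _).trans (Finset.sum_le_sum fun i _ => ?_)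
  rw [Finset.mul_sum]
  refine (norm_sum_le _ _).trans (Finset.sum_le_sum fun j _ => ?_)
  rw [norm_smul]
  exact mul_le_mul_of_nonneg_right (h i j) (norm_nonneg _)

theorem mop_sub (m m' : Matrix (Fin N) (Fin N) ℝ) : mop m - mop m' = mop (m - m') := by
  simp only [mop, Matrix.sub_apply, ← Finset.sum_sub_distrib]
  refine Finset.sum_congr rfl fun i _ => Finset.sum_congr rfl fun j _ => ?_
  exact (sub_smul _ _ _).symm

/-- Uniformly elliptic, bounded, spatially Lipschitz diffusion coefficients, for all times. -/
structure Coef (N : ℕ) where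
  a : Euc N → ℝ → Matrix (Fin N) (Fin N) ℝ
  M : ℝ
  L : ℝ
  μ : ℝ
  M_nonneg : 0 ≤ M
  L_nonneg : 0 ≤ L
  μ_pos : 0 < μ
  cont : ∀ i j, Continuous (fun q : Euc N × ℝ => a q.1 q.2 i j)
  bdd : ∀ x t i j, |a x t i j| ≤ M
  lip : ∀ x x' t i j, |a x t i j - a x' t i j| ≤ L * ‖x - x'‖
  symm : ∀ x t i j, a x t i j = a x t j i
  ell : ∀ x t (ξ : Euc N), μ * ‖ξ‖ ^ 2 ≤ ∑ i, ∑ j, a x t i j * ξ j * ξ i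

namespace Coef

variable (q : Coef N)

/-- The coefficient operator. -/
def aop (y : Euc N) (t : ℝ) : Opr N := mop (q.a y t)

/-- Upper bound for the coefficient operators. -/
def Λ : ℝ := q.M * eijNorm N + 1

theorem Λ_pos : 0 < q.Λ := by
  have := mul_nonneg q.M_nonneg (eijNorm_nonneg N)
  unfold Λ; linarith

theorem continuous_aop : Continuous (fun p : Euc N × ℝ => q.aop p.1 p.2) := by
  unfold aop mop
  refine continuous_finsetSum _ fun i _ => continuous_finsetSum _ fun j _ => ?_
  exact (q.cont i j).smul continuous_const

theorem norm_aop_le (y : Euc N) (t : ℝ) : ‖q.aop y t‖ ≤ q.Λ :=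
  (norm_mop_le (q.bdd y t)).trans (by unfold Λ; linarith)

theorem norm_aop_sub_le (y y' : Euc N) (t : ℝ) :
    ‖q.aop y t - q.aop y' t‖ ≤ q.L * eijNorm N * ‖y - y'‖ := by
  unfold aop
  rw [mop_sub]
  exact (norm_mop_le (fun i j => q.lip y y' t i j)).trans (le_of_eq (by ring))

theorem aop_symm (y : Euc N) (t : ℝ) (v w : Euc N) : ⟪q.aop y t v, w⟫ = ⟪v, q.aop y t w⟫ := by
  rw [real_inner_comm _ v, aop, inner_mop, inner_mop, Finset.sum_comm]
  refine Finset.sum_congr rfl fun i _ => Finset.sum_congr rfl fun j _ => ?_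
  rw [q.symm y t j i]; ring

theorem aop_ell (y : Euc N) (t : ℝ) (v : Euc N) : q.μ * ‖v‖ ^ 2 ≤ ⟪q.aop y t v, v⟫ := by
  rw [aop, inner_mop]; exact q.ell y t v

/-- The time average of the coefficient operator over `[s, t]`. -/
def abar (y : Euc N) (s t : ℝ) : Opr N := ∫ ρ in (0 : ℝ)..1, q.aop y (s + ρ * (t - s))

theorem continuous_abar :
    Continuous (fun p : Euc N × ℝ × ℝ => q.abar p.1 p.2.1 p.2.2) := by
  unfold abar
  refine intervalIntegral.continuous_parametric_intervalIntegral_of_continuous' ?_ 0 1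
  exact q.continuous_aop.comp (f := fun z : (Euc N × ℝ × ℝ) × ℝ =>
    (z.1.1, z.1.2.1 + z.2 * (z.1.2.2 - z.1.2.1))) (by fun_prop)

theorem intervalIntegrable_abar (y : Euc N) (s t u v : ℝ) :
    IntervalIntegrable (fun ρ => q.aop y (s + ρ * (t - s))) volume u v :=
  Continuous.intervalIntegrable
    (q.continuous_aop.comp (f := fun ρ : ℝ => (y, s + ρ * (t - s))) (by fun_prop)) _ _

theorem inner_abar (y : Euc N) (s t : ℝ) (v w : Euc N) :
    ⟪q.abar y s t v, w⟫ = ∫ ρ in (0 : ℝ)..1, ⟪q.aop y (s + ρ * (t - s)) v, w⟫ := by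
  have := ContinuousLinearMap.intervalIntegral_comp_comm
    ((innerSL ℝ w).comp (ContinuousLinearMap.apply ℝ (Euc N) v))
    (q.intervalIntegrable_abar y s t 0 1)
  simp only [real_inner_comm w]
  exact this.symm

theorem norm_abar_le (y : Euc N) (s t : ℝ) : ‖q.abar y s t‖ ≤ q.Λ := by
  have := intervalIntegral.norm_integral_le_of_norm_le_const (a := 0) (b := 1)
    (f := fun ρ => q.aop y (s + ρ * (t - s))) (C := q.Λ) (fun _ _ => q.norm_aop_le _ _)
  simpa [abar] using this

theorem norm_abar_sub_le (y y' : Euc N) (s t : ℝ) :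
    ‖q.abar y s t - q.abar y' s t‖ ≤ q.L * eijNorm N * ‖y - y'‖ := by
  unfold abar
  rw [← intervalIntegral.integral_sub (q.intervalIntegrable_abar _ _ _ _ _)
    (q.intervalIntegrable_abar _ _ _ _ _)]
  have := intervalIntegral.norm_integral_le_of_norm_le_const (a := 0) (b := 1)
    (f := fun ρ => q.aop y (s + ρ * (t - s)) - q.aop y' (s + ρ * (t - s)))
    (fun _ _ => q.norm_aop_sub_le y y' _)
  simpa using this

theorem abar_symm (y : Euc N) (s t : ℝ) (v w : Euc N) :
    ⟪q.abar y s t v, w⟫ = ⟪v, q.abar y s t w⟫ := by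
  rw [real_inner_comm _ v, inner_abar, inner_abar]
  refine intervalIntegral.integral_congr fun ρ _ => ?_
  exact (q.aop_symm y _ v w).trans (real_inner_comm _ _)

theorem abar_ell (y : Euc N) (s t : ℝ) (v : Euc N) : q.μ * ‖v‖ ^ 2 ≤ ⟪q.abar y s t v, v⟫ := by
  rw [inner_abar]
  have hc : Continuous (fun ρ : ℝ => ⟪q.aop y (s + ρ * (t - s)) v, v⟫) := by
    have := (q.continuous_aop.comp (f := fun ρ : ℝ => (y, s + ρ * (t - s))) (by fun_prop))
    exact (this.clm_apply continuous_const).inner continuous_const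
  have := intervalIntegral.integral_mono_on (a := 0) (b := 1) zero_le_one
    (f := fun _ => q.μ * ‖v‖ ^ 2) (intervalIntegrable_const (μ := volume)) (hc.intervalIntegrable 0 1)
    (fun ρ _ => q.aop_ell y _ v)
  simpa using this

theorem integral_aop (y : Euc N) {s t : ℝ} (hst : s < t) :
    ∫ τ in s..t, q.aop y τ = (t - s) • q.abar y s t := by
  have h := intervalIntegral.integral_comp_add_mul (a := 0) (b := 1) (fun τ => q.aop y τ)
    (sub_pos.2 hst).ne' s
  simp only [mul_zero, add_zero, mul_one, add_sub_cancel] at h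
  unfold abar
  simp_rw [mul_comm _ (t - s)]
  rw [h, smul_smul, mul_inv_cancel₀ (sub_pos.2 hst).ne', one_smul]

end Coef

theorem isUnit_of_elliptic {A : Opr N} {μ : ℝ} (hμ : 0 < μ) (h : ∀ v, μ * ‖v‖ ^ 2 ≤ ⟪A v, v⟫) :
    IsUnit A := by
  have hinj : Function.Injective A := by
    refine (injective_iff_map_eq_zero A).2 fun v hv => ?_
    have h1 := h v
    rw [hv, inner_zero_left] at h1
    have h2 : ‖v‖ ^ 2 ≤ 0 := by
      by_contra hc
      push Not at hc
      nlinarith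
    exact norm_eq_zero.1 (pow_eq_zero_iff (two_ne_zero) |>.1 (le_antisymm h2 (sq_nonneg _)))
  let e := (LinearEquiv.ofInjectiveEndo (A : Euc N →ₗ[ℝ] Euc N) hinj).toContinuousLinearEquiv
  have he : A = (e : Euc N →L[ℝ] Euc N) := by ext1 v; rfl
  rw [he]
  exact ⟨ContinuousLinearEquiv.toUnit e, rfl⟩

theorem inverse_mem_ell {A : Opr N} {μ Λ : ℝ} (hμ : 0 < μ) (hΛ : 0 < Λ)
    (h : ∀ v, μ * ‖v‖ ^ 2 ≤ ⟪A v, v⟫) (hs : ∀ v w, ⟪A v, w⟫ = ⟪v, A w⟫) (hn : ‖A‖ ≤ Λ) :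
    Ring.inverse A ∈ Ell N (μ / Λ ^ 2) μ⁻¹ := by
  have hu := isUnit_of_elliptic hμ h
  set B := Ring.inverse A with hB
  have hAB : ∀ v, A (B v) = v := fun v => by
    have := congrArg (fun C : Opr N => C v) (Ring.mul_inverse_cancel A hu)
    simpa using this
  have hBn : ∀ v, ‖B v‖ ≤ μ⁻¹ * ‖v‖ := fun v => by
    have h1 := h (B v)
    rw [hAB] at h1
    have h2 := real_inner_le_norm v (B v)
    rw [inv_mul_eq_div, le_div_iff₀ hμ]
    rcases (norm_nonneg (B v)).eq_or_lt with h0 | h0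
    · rw [← h0]; simp
    · have : ‖B v‖ * μ * ‖B v‖ ≤ ‖v‖ * ‖B v‖ := by nlinarith
      exact le_of_mul_le_mul_right this h0
  refine ⟨fun v w => ?_, fun v => ?_, ?_⟩
  · calc ⟪B v, w⟫ = ⟪B v, A (B w)⟫ := by rw [hAB]
      _ = ⟪A (B v), B w⟫ := (hs _ _).symm
      _ = _ := by rw [hAB]
  · have h1 := h (B v)
    rw [hAB, real_inner_comm] at h1
    have h2 : ‖v‖ ≤ Λ * ‖B v‖ := by
      calc ‖v‖ = ‖A (B v)‖ := by rw [hAB]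
        _ ≤ ‖A‖ * ‖B v‖ := A.le_opNorm _
        _ ≤ _ := by gcongr
    have h3 : ‖v‖ ^ 2 ≤ (Λ * ‖B v‖) ^ 2 := by gcongr
    calc μ / Λ ^ 2 * ‖v‖ ^ 2 ≤ μ / Λ ^ 2 * (Λ * ‖B v‖) ^ 2 := by gcongr
      _ = μ * ‖B v‖ ^ 2 := by field_simp
      _ ≤ _ := h1
  · exact ContinuousLinearMap.opNorm_le_bound _ (by positivity) hBn

theorem norm_inverse_sub_le {A A' : Opr N} (h : IsUnit A) (h' : IsUnit A') {K : ℝ}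
    (hK : ‖Ring.inverse A‖ ≤ K) (hK' : ‖Ring.inverse A'‖ ≤ K) :
    ‖Ring.inverse A - Ring.inverse A'‖ ≤ K ^ 2 * ‖A - A'‖ := by
  have hK0 : 0 ≤ K := (norm_nonneg _).trans hK
  have e : Ring.inverse A - Ring.inverse A' = Ring.inverse A * (A' - A) * Ring.inverse A' := by
    rw [mul_sub, sub_mul, Ring.inverse_mul_cancel _ h, one_mul, mul_assoc,
      Ring.mul_inverse_cancel _ h', mul_one]
  rw [e]
  calc _ ≤ ‖Ring.inverse A‖ * ‖A' - A‖ * ‖Ring.inverse A'‖ := by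
        refine (norm_mul_le _ _).trans ?_
        gcongr
        exact norm_mul_le _ _
    _ ≤ K * ‖A' - A‖ * K := by gcongr
    _ = _ := by rw [norm_sub_rev]; ring

namespace Coef

variable (q : Coef N)

/-- The ellipticity constant of the precision operators. -/
def c : ℝ := q.μ / q.Λ ^ 2

/-- The bound for the precision operators. -/
def b : ℝ := q.μ⁻¹

theorem c_pos : 0 < q.c := div_pos q.μ_pos (pow_pos q.Λ_pos 2)

theorem b_pos : 0 < q.b := inv_pos.2 q.μ_pos

/-- The rescaled precision operator of the frozen Gaussian kernel. -/
def Bf (s t : ℝ) (y : Euc N) : Opr N := Ring.inverse (q.abar y s t)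

theorem isUnit_abar (s t : ℝ) (y : Euc N) : IsUnit (q.abar y s t) :=
  isUnit_of_elliptic q.μ_pos (q.abar_ell y s t)

theorem Bf_mem (s t : ℝ) (y : Euc N) : q.Bf s t y ∈ Ell N q.c q.b :=
  inverse_mem_ell q.μ_pos q.Λ_pos (q.abar_ell y s t) (q.abar_symm y s t) (q.norm_abar_le y s t)

/-- The Lipschitz constant of the precision operators. -/
def LB : ℝ := q.b ^ 2 * (q.L * eijNorm N)

theorem LB_nonneg : 0 ≤ q.LB :=
  mul_nonneg (sq_nonneg _) (mul_nonneg q.L_nonneg (eijNorm_nonneg N))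

theorem Bf_lip (s t : ℝ) (x y : Euc N) : ‖q.Bf s t x - q.Bf s t y‖ ≤ q.LB * ‖x - y‖ := by
  refine (norm_inverse_sub_le (q.isUnit_abar s t x) (q.isUnit_abar s t y)
    (q.Bf_mem s t x).2.2 (q.Bf_mem s t y).2.2).trans ?_
  unfold LB
  rw [mul_assoc]
  exact mul_le_mul_of_nonneg_left (q.norm_abar_sub_le x y s t) (sq_nonneg _)

theorem continuous_Bf : Continuous (fun p : Euc N × ℝ × ℝ => q.Bf p.2.1 p.2.2 p.1) := by
  refine continuous_iff_continuousAt.2 fun p => ?_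
  rw [ContinuousAt, tendsto_iff_norm_sub_tendsto_zero]
  have h1 := (tendsto_iff_norm_sub_tendsto_zero.1 (q.continuous_abar.tendsto p)).const_mul (q.b ^ 2)
  rw [mul_zero] at h1
  exact squeeze_zero (fun _ => norm_nonneg _) (fun p' => norm_inverse_sub_le (q.isUnit_abar _ _ _)
    (q.isUnit_abar _ _ _) (q.Bf_mem _ _ _).2.2 (q.Bf_mem _ _ _).2.2) h1

theorem continuous_Bf_y (s t : ℝ) : Continuous (q.Bf s t) :=
  q.continuous_Bf.comp (f := fun y : Euc N => (y, s, t)) (by fun_prop)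

theorem hasDerivAt_precision (y : Euc N) {s t : ℝ} (hst : s < t) :
    HasDerivAt (fun τ => (τ - s)⁻¹ • q.Bf s τ y)
      (-(((t - s)⁻¹ • q.Bf s t y) * q.aop y t * ((t - s)⁻¹ • q.Bf s t y))) t := by
  have hinv : ∀ τ, s < τ → ∃ x : (Opr N)ˣ, (x : Opr N) = ∫ ρ in s..τ, q.aop y ρ ∧
      ((x⁻¹ : (Opr N)ˣ) : Opr N) = (τ - s)⁻¹ • q.Bf s τ y := by
    intro τ hτ
    have hne := (sub_pos.2 hτ).ne'
    have hu := q.isUnit_abar s τ y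
    refine ⟨⟨(τ - s) • q.abar y s τ, (τ - s)⁻¹ • q.Bf s τ y, ?_, ?_⟩, (q.integral_aop y hτ).symm, rfl⟩
    · have h := Ring.mul_inverse_cancel _ hu
      ext1 v
      have hv := congrArg (fun C : Opr N => C v) h
      simp only [mul_apply_eq_comp] at hv
      simp [Bf, smul_smul, inv_mul_cancel₀ hne, hv]
    · have h := Ring.inverse_mul_cancel _ hu
      ext1 v
      have hv := congrArg (fun C : Opr N => C v) h
      simp only [mul_apply_eq_comp] at hv
      simp [Bf, smul_smul, mul_inv_cancel₀ hne, hv]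
  have hc : Continuous (fun τ => q.aop y τ) := q.continuous_aop.comp (f := fun τ => (y, τ)) (by fun_prop)
  have h1 : HasDerivAt (fun τ => ∫ ρ in s..τ, q.aop y ρ) (q.aop y t) t :=
    intervalIntegral.integral_hasDerivAt_right (hc.intervalIntegrable _ _)
      hc.stronglyMeasurable.stronglyMeasurableAtFilter hc.continuousAt
  obtain ⟨x, hx, h4⟩ := hinv t hst
  have h2 := hasFDerivAt_ringInverse (𝕜 := ℝ) x
  rw [hx] at h2
  have h3 := h2.comp_hasDerivAt t h1
  simp only [h4, _root_.neg_apply, ContinuousLinearMap.mulLeftRight_apply] at h3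
  refine h3.congr_of_eventuallyEq ?_
  filter_upwards [Ioi_mem_nhds hst] with τ hτ
  obtain ⟨x', hx', h5⟩ := hinv τ hτ
  rw [← h5, Function.comp_apply, ← hx', Ring.inverse_unit]

end Coef

end Coefficients

end Parabolic

namespace Parabolic

open Filter Topology
open scoped RealInnerProductSpace

theorem le_interpolate {D A l h : ℝ} (hA : 0 ≤ A) (hl : 0 < l) (hh : 0 ≤ h) (h1 : D ≤ A * l⁻¹)
    (h2 : h ≤ l → D ≤ A * l⁻¹ * (h / l)) : D ≤ A * l⁻¹ * (h / l) ^ (1 / 2 : ℝ) := by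
  have hA' : 0 ≤ A * l⁻¹ := by positivity
  have hx : 0 ≤ h / l := by positivity
  rcases le_total h l with hle | hle
  · refine (h2 hle).trans (mul_le_mul_of_nonneg_left ?_ hA')
    calc h / l = (h / l) ^ (1 : ℝ) := (Real.rpow_one _).symm
      _ ≤ _ := Real.rpow_le_rpow_of_exponent_ge' hx ((div_le_one hl).2 hle) (by norm_num)
        (by norm_num)
  · refine h1.trans ?_
    have : 1 ≤ (h / l) ^ (1 / 2 : ℝ) := Real.one_le_rpow ((one_le_div hl).2 hle) (by norm_num)
    nlinarith

theorem inv_sqrt {r : ℝ} (hr : 0 < r) : (√r)⁻¹ = r ^ (-(1 / 2) : ℝ) := by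
  rw [Real.sqrt_eq_rpow, Real.rpow_neg hr.le]

theorem inv_sqrt_mul_rpow {r h : ℝ} (hr : 0 < r) (hh : 0 ≤ h) :
    (√r)⁻¹ * (h / √r) ^ (1 / 2 : ℝ) = r ^ (-(3 / 4) : ℝ) * h ^ (1 / 2 : ℝ) := by
  rw [Real.div_rpow hh (Real.sqrt_nonneg _), inv_sqrt hr, Real.sqrt_eq_rpow, ← Real.rpow_mul hr.le,
    div_eq_mul_inv (h ^ _), ← Real.rpow_neg hr.le, mul_comm (h ^ (1 / 2 : ℝ)), ← mul_assoc,
    ← Real.rpow_add hr]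
  norm_num

section Parametrix

variable {N : ℕ}

namespace Coef

variable (q : Coef N)

/-- The parametrix operator. -/
def P (φ : Euc N → ℝ) (x : Euc N) (s t : ℝ) : ℝ := Op g0 (q.Bf s t) √(t - s) φ x

/-- The spatial gradient of the parametrix operator. -/
def P1 (φ : Euc N → ℝ) (x : Euc N) (s t : ℝ) : Euc N :=
  (√(t - s))⁻¹ • Op g1 (q.Bf s t) √(t - s) φ x

/-- The spatial Hessian of the parametrix operator. -/
def P2 (φ : Euc N → ℝ) (x : Euc N) (s t : ℝ) : Opr N :=
  (t - s)⁻¹ • Op g2 (q.Bf s t) √(t - s) φ x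

/-- Entries of the Hessian of the Gaussian density. -/
def h2 (i j : Fin N) (B : Opr N) (z : Euc N) : ℝ := (g2 B z (EuclideanSpace.single j 1)) i

/-- The parametrix defect operator. -/
def Kk (φ : Euc N → ℝ) (x : Euc N) (s t : ℝ) : ℝ :=
  ∑ i, ∑ j, (1 / 2) * (t - s)⁻¹ *
    Op (h2 i j) (q.Bf s t) √(t - s) (fun y => (q.a x t i j - q.a y t i j) * φ y) x

theorem gl0 : GaussLip (N := N) q.c q.b (-(q.c / 8)) g0 := GaussLip.g0 q.c_pos q.b_pos
theorem gl1 : GaussLip (N := N) q.c q.b (-(q.c / 16)) g1 := GaussLip.g1 q.c_pos q.b_pos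
theorem gl2 : GaussLip (N := N) q.c q.b (-(q.c / 16)) g2 := GaussLip.g2 q.c_pos q.b_pos
theorem glh (i j : Fin N) : GaussLip (N := N) q.c q.b (-(q.c / 16)) (h2 i j) :=
  GaussLip.clm ((EuclideanSpace.proj i : Euc N →L[ℝ] ℝ).comp
    (ContinuousLinearMap.apply ℝ (Euc N) (EuclideanSpace.single j (1 : ℝ)))) q.gl2

theorem neg_c8 : -(q.c / 8) < 0 := by have := q.c_pos; linarith
theorem neg_c16 : -(q.c / 16) < 0 := by have := q.c_pos; linarith

theorem continuous_a_left (t : ℝ) (i j : Fin N) : Continuous (fun y => q.a y t i j) :=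
  (q.cont i j).comp (f := fun y : Euc N => (y, t)) (by fun_prop)

theorem continuous_freeze (x : Euc N) (t : ℝ) (i j : Fin N) {φ : Euc N → ℝ} (hφ : Continuous φ) :
    Continuous (fun y => (q.a x t i j - q.a y t i j) * φ y) :=
  (continuous_const.sub (q.continuous_a_left t i j)).mul hφ

theorem freeze_bdd (x : Euc N) (t : ℝ) (i j : Fin N) {φ : Euc N → ℝ} {F : ℝ}
    (hF : ∀ y, |φ y| ≤ F) (y : Euc N) : |(q.a x t i j - q.a y t i j) * φ y| ≤ 2 * q.M * F := by
  rw [abs_mul]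
  have := q.M_nonneg
  refine mul_le_mul ?_ (hF y) (abs_nonneg _) (by linarith)
  refine (abs_sub _ _).trans ?_
  linarith [q.bdd x t i j, q.bdd y t i j]

theorem freeze_le (x : Euc N) (t : ℝ) (i j : Fin N) {φ : Euc N → ℝ} {F : ℝ}
    (hF : ∀ y, |φ y| ≤ F) (y : Euc N) :
    |(q.a x t i j - q.a y t i j) * φ y| ≤ q.L * F * ‖x - y‖ ^ (1 : ℝ) := by
  rw [abs_mul, Real.rpow_one, mul_right_comm]
  exact mul_le_mul (q.lip x y t i j) (hF y) (abs_nonneg _)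
    (mul_nonneg q.L_nonneg (norm_nonneg _))

theorem P_bound : ∃ C, 0 ≤ C ∧ ∀ (φ : Euc N → ℝ) (F : ℝ), (∀ y, |φ y| ≤ F) → ∀ x s t,
    |q.P φ x s t| ≤ C * F := by
  obtain ⟨C, hC, h⟩ := op_bound q.neg_c8 q.gl0
  refine ⟨C, hC, fun φ F hF x s t => ?_⟩
  have := h _ (q.Bf_mem s t) φ x F 0 ((abs_nonneg _).trans (hF 0)) le_rfl zero_le_one
    (by simpa using hF) _ (Real.sqrt_nonneg (t - s))
  rwa [Real.rpow_zero, mul_one] at this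

theorem P1_bound : ∃ C, 0 ≤ C ∧ ∀ (φ : Euc N → ℝ) (F : ℝ), (∀ y, |φ y| ≤ F) → ∀ x s t,
    ‖q.P1 φ x s t‖ ≤ C * F * (√(t - s))⁻¹ := by
  obtain ⟨C, hC, h⟩ := op_bound q.neg_c16 q.gl1
  refine ⟨C, hC, fun φ F hF x s t => ?_⟩
  have := h _ (q.Bf_mem s t) φ x F 0 ((abs_nonneg _).trans (hF 0)) le_rfl zero_le_one
    (by simpa using hF) _ (Real.sqrt_nonneg (t - s))
  rw [Real.rpow_zero, mul_one] at this
  rw [P1, norm_smul, norm_inv, Real.norm_of_nonneg (Real.sqrt_nonneg _), mul_comm]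
  gcongr

theorem P1_holder : ∃ C, 0 ≤ C ∧ ∀ (φ : Euc N → ℝ) (F : ℝ), Continuous φ → (∀ y, |φ y| ≤ F) →
    ∀ x x' s t, s < t → ‖q.P1 φ x s t - q.P1 φ x' s t‖ ≤
      C * F * (t - s) ^ (-(3 / 4) : ℝ) * ‖x - x'‖ ^ (1 / 2 : ℝ) := by
  obtain ⟨C, hC, h⟩ := q.P1_bound
  obtain ⟨D, hD, h'⟩ := op_lip q.neg_c16 q.gl1
  refine ⟨2 * C + D, by positivity, fun φ F hφ hF x x' s t hst => ?_⟩
  have hF0 : 0 ≤ F := (abs_nonneg _).trans (hF 0)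
  have hl : 0 < √(t - s) := Real.sqrt_pos.2 (sub_pos.2 hst)
  rw [mul_assoc, ← inv_sqrt_mul_rpow (sub_pos.2 hst) (norm_nonneg _), ← mul_assoc]
  refine le_interpolate (by positivity) hl (norm_nonneg _) ?_ fun hx => ?_
  · refine (norm_sub_le _ _).trans ?_
    have : 0 ≤ D * F * (√(t - s))⁻¹ := by positivity
    linarith [h φ F hF x s t, h φ F hF x' s t]
  · have h3 := h' _ (q.Bf_mem s t) (q.continuous_Bf_y s t) φ x F 0 F hφ hF hF0 le_rfl zero_le_one
      (by simpa using hF) _ hl x' hx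
    rw [Real.rpow_zero, mul_one] at h3
    rw [P1, P1, ← smul_sub, norm_smul, norm_inv, Real.norm_of_nonneg hl.le]
    calc _ ≤ (√(t - s))⁻¹ * (D * F * (‖x - x'‖ / √(t - s))) := by gcongr
      _ = D * F * (√(t - s))⁻¹ * (‖x - x'‖ / √(t - s)) := by ring
      _ ≤ _ := by gcongr; linarith

theorem P1_lip_bound : ∃ C, 0 ≤ C ∧ ∀ (φ : Euc N → ℝ) (F Q : ℝ), Continuous φ → (∀ y, |φ y| ≤ F) →
    0 ≤ Q → (∀ x y, |φ x - φ y| ≤ Q * ‖x - y‖) → ∀ x s t, s < t → ‖q.P1 φ x s t‖ ≤ C * (Q + F) := by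
  obtain ⟨C, hC, h⟩ := op_cancel q.neg_c16 q.gl1 (fun B hB => integral_g1 q.c_pos q.b_pos hB)
  have hLB := q.LB_nonneg
  refine ⟨C * (1 + q.LB), by positivity, fun φ F Q hφ hF hQ hL x s t hst => ?_⟩
  have hF0 : 0 ≤ F := (abs_nonneg _).trans (hF 0)
  have hl : 0 < √(t - s) := Real.sqrt_pos.2 (sub_pos.2 hst)
  have h1 := h _ (q.Bf_mem s t) (q.continuous_Bf_y s t) _ q.LB_nonneg (q.Bf_lip s t) φ x Q 1 F hφ hF
    hQ zero_le_one le_rfl (fun y => by rw [Real.rpow_one, norm_sub_rev]; exact hL y x) _ hl.le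
  rw [Real.rpow_one] at h1
  rw [P1, norm_smul, norm_inv, Real.norm_of_nonneg hl.le, inv_mul_le_iff₀ hl]
  refine h1.trans ?_
  have : 0 ≤ C * √(t - s) * (F + q.LB * Q) := by positivity
  nlinarith

theorem P2_bound : ∃ C, 0 ≤ C ∧ ∀ (φ : Euc N → ℝ) (F Q γ : ℝ) (x : Euc N), Continuous φ →
    (∀ y, |φ y| ≤ F) → 0 ≤ Q → 0 ≤ γ → γ ≤ 1 → (∀ y, |φ y - φ x| ≤ Q * ‖x - y‖ ^ γ) →
    ∀ s t, s < t →
    ‖q.P2 φ x s t‖ ≤ C * (t - s)⁻¹ * (Q * (√(t - s)) ^ γ + F * √(t - s)) := by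
  obtain ⟨C, hC, h⟩ := op_cancel q.neg_c16 q.gl2 (fun B hB => integral_g2 q.c_pos q.b_pos hB)
  have hLB := q.LB_nonneg
  refine ⟨C * (1 + q.LB), by positivity, fun φ F Q γ x hφ hF hQ hγ hγ1 hL s t hst => ?_⟩
  have hF0 : 0 ≤ F := (abs_nonneg _).trans (hF 0)
  have hr : 0 < t - s := sub_pos.2 hst
  have hl : 0 < √(t - s) := Real.sqrt_pos.2 hr
  have h1 := h _ (q.Bf_mem s t) (q.continuous_Bf_y s t) _ q.LB_nonneg (q.Bf_lip s t) φ x Q γ F hφ hF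
    hQ hγ hγ1 hL _ hl.le
  rw [P2, norm_smul, norm_inv, Real.norm_of_nonneg hr.le]
  have h2 : 0 ≤ Q * (√(t - s)) ^ γ := by positivity
  have h3 : 0 ≤ F * √(t - s) := by positivity
  calc _ ≤ (t - s)⁻¹ * (C * (Q * √(t - s) ^ γ + q.LB * F * √(t - s))) := by gcongr
    _ ≤ (t - s)⁻¹ * (C * ((1 + q.LB) * (Q * √(t - s) ^ γ + F * √(t - s)))) := by
      gcongr; nlinarith
    _ = _ := by ring

theorem Kk_bound : ∃ C, 0 ≤ C ∧ ∀ (φ : Euc N → ℝ) (F : ℝ), (∀ y, |φ y| ≤ F) → ∀ x s t, s < t →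
    |q.Kk φ x s t| ≤ C * F * (√(t - s))⁻¹ := by
  choose C hC h using fun i j => op_bound q.neg_c16 (q.glh i j)
  have hL := q.L_nonneg
  refine ⟨∑ i, ∑ j, C i j * q.L, Finset.sum_nonneg fun i _ => Finset.sum_nonneg fun j _ =>
    mul_nonneg (hC i j) hL, fun φ F hF x s t hst => ?_⟩
  have hF0 : 0 ≤ F := (abs_nonneg _).trans (hF 0)
  have hr : 0 < t - s := sub_pos.2 hst
  have hl : 0 < √(t - s) := Real.sqrt_pos.2 hr
  rw [Kk, Finset.sum_mul, Finset.sum_mul]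
  refine (Finset.abs_sum_le_sum_abs _ _).trans (Finset.sum_le_sum fun i _ => ?_)
  rw [Finset.sum_mul, Finset.sum_mul]
  refine (Finset.abs_sum_le_sum_abs _ _).trans (Finset.sum_le_sum fun j _ => ?_)
  have := h i j _ (q.Bf_mem s t) _ x (q.L * F) 1 (by positivity) zero_le_one le_rfl
    (q.freeze_le x t i j hF) _ hl.le
  rw [Real.rpow_one, Real.norm_eq_abs] at this
  have e : (t - s)⁻¹ = (√(t - s))⁻¹ * (√(t - s))⁻¹ := by
    rw [← mul_inv, Real.mul_self_sqrt hr.le]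
  rw [abs_mul, abs_of_pos (by positivity)]
  have h0 := hC i j
  calc _ ≤ 1 / 2 * (t - s)⁻¹ * (C i j * (q.L * F) * √(t - s)) := by gcongr
    _ = 1 / 2 * (C i j * q.L * F * (√(t - s))⁻¹) := by rw [e]; field_simp
    _ ≤ _ := by
      have : 0 ≤ C i j * q.L * F * (√(t - s))⁻¹ := by positivity
      linarith

theorem op_freeze_lip (i j : Fin N) : ∃ C, 0 ≤ C ∧ ∀ (φ : Euc N → ℝ) (F : ℝ), Continuous φ →
    (∀ y, |φ y| ≤ F) → ∀ x x' s t, s < t → ‖x - x'‖ ≤ √(t - s) →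
    |Op (h2 i j) (q.Bf s t) √(t - s) (fun y => (q.a x t i j - q.a y t i j) * φ y) x -
      Op (h2 i j) (q.Bf s t) √(t - s) (fun y => (q.a x' t i j - q.a y t i j) * φ y) x'|
      ≤ C * F * ‖x - x'‖ := by
  obtain ⟨C, hC, h⟩ := op_bound q.neg_c16 (q.glh i j)
  obtain ⟨D, hD, h'⟩ := op_lip q.neg_c16 (q.glh i j)
  have hL := q.L_nonneg
  refine ⟨C * q.L + D * q.L, by positivity, fun φ F hφ hF x x' s t hst hx => ?_⟩
  have hF0 : 0 ≤ F := (abs_nonneg _).trans (hF 0)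
  have hl : 0 < √(t - s) := Real.sqrt_pos.2 (sub_pos.2 hst)
  have e1 : Op (h2 i j) (q.Bf s t) √(t - s) (fun y => (q.a x' t i j - q.a y t i j) * φ y) x' =
      (q.a x' t i j - q.a x t i j) * Op (h2 i j) (q.Bf s t) √(t - s) φ x' +
      Op (h2 i j) (q.Bf s t) √(t - s) (fun y => (q.a x t i j - q.a y t i j) * φ y) x' := by
    rw [← smul_eq_mul, ← op_const_mul, ← op_add q.neg_c16 (q.glh i j) (q.Bf_mem s t)
      (q.continuous_Bf_y s t) (φ := fun y => (q.a x' t i j - q.a x t i j) * φ y)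
      (continuous_const.mul hφ) (q.continuous_freeze x t i j hφ)
      (M := |q.a x' t i j - q.a x t i j| * F)
      (fun y => by rw [abs_mul]; gcongr; exact hF y) (q.freeze_bdd x t i j hF)]
    congr 1
    funext y
    ring
  have h3 := h' _ (q.Bf_mem s t) (q.continuous_Bf_y s t) _ x (q.L * F) 1 _
    (q.continuous_freeze x t i j hφ) (q.freeze_bdd x t i j hF) (by positivity) zero_le_one le_rfl
    (q.freeze_le x t i j hF) _ hl x' hx
  have h4 := h _ (q.Bf_mem s t) φ x' F 0 hF0 le_rfl zero_le_one (by simpa using hF) _ hl.le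
  rw [Real.rpow_zero, mul_one, Real.norm_eq_abs] at h4
  rw [Real.rpow_one, mul_assoc, mul_div_cancel₀ _ hl.ne', Real.norm_eq_abs] at h3
  have h5 := q.lip x' x t i j
  rw [norm_sub_rev] at h5
  rw [e1, sub_add_eq_sub_sub_swap]
  refine (abs_sub _ _).trans ?_
  rw [abs_mul]
  have : |q.a x' t i j - q.a x t i j| * |Op (h2 i j) (q.Bf s t) √(t - s) φ x'| ≤
    (q.L * ‖x - x'‖) * (C * F) := by gcongr
  nlinarith

theorem Kk_holder : ∃ C, 0 ≤ C ∧ ∀ (φ : Euc N → ℝ) (F : ℝ), Continuous φ → (∀ y, |φ y| ≤ F) →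
    ∀ x x' s t, s < t → |q.Kk φ x s t - q.Kk φ x' s t| ≤
      C * F * (t - s) ^ (-(3 / 4) : ℝ) * ‖x - x'‖ ^ (1 / 2 : ℝ) := by
  obtain ⟨C, hC, h⟩ := q.Kk_bound
  choose D hD h' using fun i j => q.op_freeze_lip i j
  have hS : 0 ≤ ∑ i, ∑ j, D i j := Finset.sum_nonneg fun i _ => Finset.sum_nonneg fun j _ => hD i j
  refine ⟨2 * C + ∑ i, ∑ j, D i j, by positivity, fun φ F hφ hF x x' s t hst => ?_⟩
  have hF0 : 0 ≤ F := (abs_nonneg _).trans (hF 0)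
  have hr : 0 < t - s := sub_pos.2 hst
  have hl : 0 < √(t - s) := Real.sqrt_pos.2 hr
  rw [mul_assoc, ← inv_sqrt_mul_rpow hr (norm_nonneg _), ← mul_assoc]
  refine le_interpolate (by positivity) hl (norm_nonneg _) ?_ fun hx => ?_
  · refine (abs_sub _ _).trans ?_
    have : 0 ≤ (∑ i, ∑ j, D i j) * F * (√(t - s))⁻¹ := by positivity
    linarith [h φ F hF x s t hst, h φ F hF x' s t hst]
  · have e : (t - s)⁻¹ = (√(t - s))⁻¹ * (√(t - s))⁻¹ := by
      rw [← mul_inv, Real.mul_self_sqrt hr.le]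
    have h3 : |q.Kk φ x s t - q.Kk φ x' s t| ≤
        (∑ i, ∑ j, D i j) * (F * (t - s)⁻¹ * ‖x - x'‖) := by
      rw [Kk, Kk, Finset.sum_mul, ← Finset.sum_sub_distrib]
      refine (Finset.abs_sum_le_sum_abs _ _).trans (Finset.sum_le_sum fun i _ => ?_)
      rw [Finset.sum_mul, ← Finset.sum_sub_distrib]
      refine (Finset.abs_sum_le_sum_abs _ _).trans (Finset.sum_le_sum fun j _ => ?_)
      have h4 := h' i j φ F hφ hF x x' s t hst hx
      rw [← mul_sub, abs_mul, abs_of_pos (by positivity)]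
      have h0 := hD i j
      calc _ ≤ 1 / 2 * (t - s)⁻¹ * (D i j * F * ‖x - x'‖) := by gcongr
        _ = 1 / 2 * (D i j * (F * (t - s)⁻¹ * ‖x - x'‖)) := by ring
        _ ≤ _ := by
          have : 0 ≤ D i j * (F * (t - s)⁻¹ * ‖x - x'‖) := by positivity
          linarith
    refine h3.trans ?_
    rw [e]
    have : 0 ≤ C * F * (√(t - s))⁻¹ * (‖x - x'‖ / √(t - s)) := by positivity
    calc _ = (∑ i, ∑ j, D i j) * F * (√(t - s))⁻¹ * (‖x - x'‖ / √(t - s)) := by ring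
      _ ≤ _ := by linarith

end Coef

end Parametrix

end Parabolic

namespace Parabolic

open Filter Topology
open scoped RealInnerProductSpace

section TimeDerivative

theorem hasDerivAt_integral_of_lip_at {α : Type*} [MeasurableSpace α] {ν : Measure α}
    {G : ℝ → α → ℝ} {G' bound : α → ℝ} {t : ℝ} {U : Set ℝ} (hU : U ∈ 𝓝 t)
    (hG : ∀ τ ∈ U, AEStronglyMeasurable (G τ) ν) (hGi : Integrable (G t) ν)
    (hG' : AEStronglyMeasurable G' ν)
    (hlip : ∀ a, ∀ τ ∈ U, ‖G τ a - G t a‖ ≤ bound a * ‖τ - t‖) (hb : Integrable bound ν)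
    (hd : ∀ a, HasDerivAt (fun τ => G τ a) (G' a) t) :
    HasDerivAt (fun τ => ∫ a, G τ a ∂ν) (∫ a, G' a ∂ν) t := by
  set Λ : ℝ →L[ℝ] ℝ →L[ℝ] ℝ := ContinuousLinearMap.smulRightL ℝ ℝ ℝ 1
  have h := hasFDerivAt_integral_of_dominated_loc_of_lip' (F' := fun a => Λ (G' a)) hU hG hGi
    (Λ.continuous.comp_aestronglyMeasurable hG') (Eventually.of_forall fun a => hlip a) hb
    (Eventually.of_forall fun a => (hd a).hasFDerivAt.congr_fderiv (by ext; simp [Λ]))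
  have h2 := h.2.hasDerivAt
  rw [ContinuousLinearMap.integral_apply h.1] at h2
  simpa [Λ] using h2

variable {N : ℕ}

theorem hasDerivAt_ge {S : ℝ → Opr N} {S' : Opr N} {t : ℝ} (hS : HasDerivAt S S' t) (z : Euc N) :
    HasDerivAt (fun τ => ge (S τ) z) (-(1 / 2) * ⟪S' z, z⟫ * ge (S t) z) t := by
  have h1 : HasDerivAt (fun τ => ⟪S τ z, z⟫) ⟪S' z, z⟫ t := by
    have := (((innerSL ℝ z).comp (ContinuousLinearMap.apply ℝ (Euc N) z)).hasFDerivAt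
      (x := S t)).comp_hasDerivAt t hS
    simpa [Function.comp_def, real_inner_comm] using this
  have := (h1.const_mul (-(1 / 2))).exp
  refine this.congr_deriv ?_
  rw [ge]
  ring

theorem hasDerivAt_gm {c b : ℝ} (hc : 0 < c) (hb : 0 < b) {S : ℝ → Opr N} {t : ℝ}
    {m : Matrix (Fin N) (Fin N) ℝ} (hS : HasDerivAt S (-(S t * mop m * S t)) t)
    (hE : ∀ᶠ τ in 𝓝 t, S τ ∈ Ell N c b) :
    HasDerivAt (fun τ => gm (S τ)) (1 / 2 * gm (S t) * trL m (S t)) t := by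
  have hG := GaussLip.ge (N := N) (b := b) hc
  have hr : -(c / 8) < 0 := by linarith
  have hSt := hE.self_of_nhds
  obtain ⟨C, hC, h⟩ := id hG
  obtain ⟨K, hK⟩ := hS.hasFDerivAt.isBigO_sub.bound
  have hq : ∀ z, -(1 / 2) * ⟪(-(S t * mop m * S t)) z, z⟫ * ge (S t) z =
      (gm (S t)) * (1 / 2) * (trL m (g2 (S t) z) + g0 (S t) z * trL m (S t)) := fun z => by
    have e1 : ⟪(-(S t * mop m * S t)) z, z⟫ = -⟪mop m (S t z), S t z⟫ := by
      simp only [_root_.neg_apply, mul_apply_eq_comp, inner_neg_left, hSt.1]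
    rw [e1, g2, map_smul, map_sub, trL_smulRight, smul_eq_mul, g0]
    have := (gm_pos hc hb hSt).ne'
    field_simp
    ring
  have hi2 := (GaussLip.g2 (N := N) hc hb).integrable (by linarith) hSt
  have hi0 := (GaussLip.g0 (N := N) hc hb).integrable hr hSt
  have hi3 : Integrable (fun z => (gm (S t)) * (1 / 2) *
      (trL m (g2 (S t) z) + g0 (S t) z * trL m (S t))) :=
    (((trL m).integrable_comp hi2).add (hi0.mul_const _)).const_mul _
  have key := hasDerivAt_integral_of_lip_at (G := fun τ z => ge (S τ) z)
    (G' := fun z => -(1 / 2) * ⟪(-(S t * mop m * S t)) z, z⟫ * ge (S t) z)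
    (bound := fun z => C * K * Real.exp (-(c / 8) * ‖z‖ ^ 2))
    (hE.and hK) (fun τ hτ => (hG.continuous_snd hτ.1).aestronglyMeasurable)
    (hG.integrable hr hSt) (by simp_rw [hq]; exact hi3.aestronglyMeasurable)
    (fun z τ hτ => ?_) ((integrable_gauss hr).const_mul _) (fun z => hasDerivAt_ge hS z)
  · refine key.congr_deriv ?_
    simp_rw [hq]
    rw [integral_const_mul, integral_add ((trL m).integrable_comp hi2) (hi0.mul_const _),
      ContinuousLinearMap.integral_comp_comm _ hi2, integral_g2 hc hb hSt, integral_mul_const,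
      integral_g0 hc hb hSt, map_zero]
    ring
  · have h3 := (h _ hSt z).2 _ hτ.1 z (by simp)
    rw [sub_self, norm_zero, add_zero, norm_sub_rev, norm_sub_rev (S t)] at h3
    refine h3.trans ?_
    have := hτ.2
    calc _ ≤ C * (K * ‖τ - t‖) * Real.exp (-(c / 8) * ‖z‖ ^ 2) := by gcongr
      _ = _ := by ring

theorem hasDerivAt_g0 {c b : ℝ} (hc : 0 < c) (hb : 0 < b) {S : ℝ → Opr N} {t : ℝ}
    {m : Matrix (Fin N) (Fin N) ℝ} (hS : HasDerivAt S (-(S t * mop m * S t)) t)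
    (hE : ∀ᶠ τ in 𝓝 t, S τ ∈ Ell N c b) (w : Euc N) :
    HasDerivAt (fun τ => g0 (S τ) w) (1 / 2 * trL m (g2 (S t) w)) t := by
  have hSt := hE.self_of_nhds
  have hne := (gm_pos hc hb hSt).ne'
  have h1 := ((hasDerivAt_gm hc hb hS hE).inv hne).mul (hasDerivAt_ge hS w)
  refine h1.congr_deriv ?_
  have e1 : ⟪(-(S t * mop m * S t)) w, w⟫ = -⟪mop m (S t w), S t w⟫ := by
    simp only [_root_.neg_apply, mul_apply_eq_comp, inner_neg_left, hSt.1]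
  rw [e1, g2, map_smul, map_sub, trL_smulRight, smul_eq_mul, g0, Pi.inv_apply]
  field_simp
  ring

end TimeDerivative

section Parametrix

variable {N : ℕ}

namespace Coef

variable (q : Coef N)

/-- The inverse of the accumulated covariance. -/
def prec (s t : ℝ) (y : Euc N) : Opr N := (t - s)⁻¹ • q.Bf s t y

theorem prec_mem {s t r R : ℝ} (hr : 0 < r) (h1 : r ≤ t - s) (h2 : t - s ≤ R) (y : Euc N) :
    q.prec s t y ∈ Ell N (q.c / R) (q.b / r) := by
  have h := q.Bf_mem s t y
  have h0 : 0 < t - s := hr.trans_le h1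
  have hc := q.c_pos
  have hb := q.b_pos
  refine ⟨fun v w => ?_, fun z => ?_, ?_⟩
  · simp [prec, inner_smul_left, inner_smul_right, h.1 v w]
  · simp only [prec, _root_.smul_apply, inner_smul_left, conj_trivial]
    have h3 := h.2.1 z
    calc q.c / R * ‖z‖ ^ 2 = R⁻¹ * (q.c * ‖z‖ ^ 2) := by ring
      _ ≤ (t - s)⁻¹ * ⟪q.Bf s t y z, z⟫ := by gcongr
  · rw [prec, norm_smul, norm_inv, Real.norm_of_nonneg h0.le]
    calc _ ≤ r⁻¹ * q.b := by gcongr; exact h.2.2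
      _ = _ := by ring

theorem continuous_prec (s t : ℝ) : Continuous (q.prec s t) := by
  unfold prec
  exact (q.continuous_Bf_y s t).const_smul (t - s)⁻¹

theorem prec_eq {s t : ℝ} (hst : s < t) (y : Euc N) :
    q.prec s t y = ((√(t - s))⁻¹ ^ 2) • q.Bf s t y := by
  rw [prec, inv_pow, Real.sq_sqrt (sub_pos.2 hst).le]

theorem P_eq_integral {s t : ℝ} (hst : s < t) (φ : Euc N → ℝ) (x : Euc N) :
    q.P φ x s t = ∫ y, φ y * g0 (q.prec s t y) (x - y) := by
  have hl : 0 < √(t - s) := Real.sqrt_pos.2 (sub_pos.2 hst)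
  rw [P, op_eq_scaled _ _ hl, ← integral_smul]
  congr 1
  funext y
  rw [q.prec_eq hst, g0_smul hl, smul_eq_mul, smul_eq_mul]
  ring

theorem P2_eq_integral {s t : ℝ} (hst : s < t) (φ : Euc N → ℝ) (x : Euc N) :
    q.P2 φ x s t = ∫ y, φ y • g2 (q.prec s t y) (x - y) := by
  have hl : 0 < √(t - s) := Real.sqrt_pos.2 (sub_pos.2 hst)
  rw [P2, op_eq_scaled _ _ hl, ← integral_smul, ← integral_smul]
  congr 1
  funext y
  rw [q.prec_eq hst, g2_smul hl, smul_smul, smul_smul, smul_smul, inv_pow √(t - s) 2,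
    Real.sq_sqrt (sub_pos.2 hst).le]
  congr 1
  ring

theorem op_h2_eq_integral {s t : ℝ} (hst : s < t) (φ : Euc N → ℝ) (x : Euc N) (i j : Fin N) :
    (t - s)⁻¹ * Op (h2 i j) (q.Bf s t) √(t - s) φ x
      = ∫ y, φ y * h2 i j (q.prec s t y) (x - y) := by
  have hl : 0 < √(t - s) := Real.sqrt_pos.2 (sub_pos.2 hst)
  rw [op_eq_scaled _ _ hl, ← smul_eq_mul, ← integral_smul, ← integral_smul]
  congr 1
  funext y
  rw [q.prec_eq hst, h2, h2, g2_smul hl, inv_pow √(t - s) 2, Real.sq_sqrt (sub_pos.2 hst).le]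
  simp
  ring

theorem integrable_sub {F : Type*} [NormedAddCommGroup F] [NormedSpace ℝ F] {c b r : ℝ}
    {Ψ : Opr N → Euc N → F} (hr : r < 0) (h : GaussLip c b r Ψ) {B : Euc N → Opr N}
    (hB : ∀ y, B y ∈ Ell N c b) (hBc : Continuous B) {φ : Euc N → ℝ} (hφ : Continuous φ)
    {M : ℝ} (hM : ∀ y, |φ y| ≤ M) (x : Euc N) :
    Integrable (fun y => φ y • Ψ (B y) (x - y)) := by
  simpa using op_integrable_y hr h hB hBc hφ hM (one_ne_zero (α := ℝ)) x

theorem P_hasDerivAt_time {φ : Euc N → ℝ} (hφ : Continuous φ) {F : ℝ} (hF : ∀ y, |φ y| ≤ F)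
    (x : Euc N) {s t : ℝ} (hst : s < t) :
    HasDerivAt (fun τ => q.P φ x s τ) (1 / 2 * trL (q.a x t) (q.P2 φ x s t) - q.Kk φ x s t) t := by
  have hF0 : 0 ≤ F := (abs_nonneg _).trans (hF 0)
  have hr : 0 < t - s := sub_pos.2 hst
  set r := (t - s) / 2 with hrd
  set R := 2 * (t - s) with hRd
  have hr0 : 0 < r := by positivity
  have hc : 0 < q.c / R := div_pos q.c_pos (by positivity)
  have hb : 0 < q.b / r := div_pos q.b_pos hr0
  have hU : ∀ τ ∈ Ioo (s + r) (s + R), s < τ ∧ ∀ y, q.prec s τ y ∈ Ell N (q.c / R) (q.b / r) :=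
    fun τ hτ => ⟨by linarith [hτ.1], fun y => q.prec_mem hr0 (by linarith [hτ.1])
      (by linarith [hτ.2]) y⟩
  have htU : t ∈ Ioo (s + r) (s + R) := ⟨by linarith, by linarith⟩
  have hG2 := GaussLip.g2 (N := N) hc hb
  have hG0 := GaussLip.g0 (N := N) hc hb
  have hr8 : -(q.c / R / 8) < 0 := by linarith
  have hr16 : -(q.c / R / 16) < 0 := by linarith
  have htr : ∀ (m : Matrix (Fin N) (Fin N) ℝ) (ψ : Euc N → ℝ) y, ψ y * trL m (g2 (q.prec s t y) (x - y)) =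
      ∑ i, ∑ j, m i j * ψ y * h2 i j (q.prec s t y) (x - y) := fun m ψ y => by
    rw [trL_apply, Finset.mul_sum]
    refine Finset.sum_congr rfl fun i _ => ?_
    rw [Finset.mul_sum]
    refine Finset.sum_congr rfl fun j _ => ?_
    rw [h2]
    ring
  have hi2 : Integrable (fun y => φ y • g2 (q.prec s t y) (x - y)) :=
    integrable_sub hr16 hG2 (hU t htU).2 (q.continuous_prec s t) hφ hF x
  have hih : ∀ i j, Integrable (fun y => ((q.a x t i j - q.a y t i j) * φ y) •
      h2 i j (q.prec s t y) (x - y)) := fun i j => by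
    refine integrable_sub hr16 ?_ (hU t htU).2 (q.continuous_prec s t)
      (q.continuous_freeze x t i j hφ) (q.freeze_bdd x t i j hF) x
    exact GaussLip.clm ((EuclideanSpace.proj i : Euc N →L[ℝ] ℝ).comp
      (ContinuousLinearMap.apply ℝ (Euc N) (EuclideanSpace.single j (1 : ℝ)))) hG2
  have hdecomp : ∀ y, φ y * (1 / 2 * trL (q.a y t) (g2 (q.prec s t y) (x - y))) =
      1 / 2 * trL (q.a x t) (φ y • g2 (q.prec s t y) (x - y)) -
      ∑ i, ∑ j, 1 / 2 * (((q.a x t i j - q.a y t i j) * φ y) • h2 i j (q.prec s t y) (x - y)) := by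
    intro y
    have e1 := htr (q.a y t) φ y
    have e2 := htr (q.a x t) φ y
    rw [map_smul, smul_eq_mul, e2, show φ y * (1 / 2 * trL (q.a y t) (g2 (q.prec s t y) (x - y))) =
      1 / 2 * (φ y * trL (q.a y t) (g2 (q.prec s t y) (x - y))) by ring, e1]
    simp only [← Finset.mul_sum]
    rw [← mul_sub, ← Finset.sum_sub_distrib]
    congr 1
    refine Finset.sum_congr rfl fun i _ => ?_
    rw [← Finset.sum_sub_distrib]
    refine Finset.sum_congr rfl fun j _ => ?_
    rw [smul_eq_mul]
    ring
  have hsumi : Integrable (fun y => ∑ i, ∑ j, 1 / 2 *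
      (((q.a x t i j - q.a y t i j) * φ y) • h2 i j (q.prec s t y) (x - y))) :=
    integrable_finsetSum _ fun i _ => integrable_finsetSum _ fun j _ => (hih i j).const_mul _
  obtain ⟨C, hC, hb2⟩ := id hG2
  have htrb : ∀ y τ (D : Opr N), |trL (q.a y τ) D| ≤
      (∑ i : Fin N, ∑ j : Fin N, q.M * ‖trL (N := N) (Matrix.single i j 1)‖) * ‖D‖ := by
    intro y τ D
    have e : trL (q.a y τ) D = ∑ i, ∑ j, q.a y τ i j * trL (Matrix.single i j 1) D := by
      simp only [trL_apply, Matrix.single_apply]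
      refine Finset.sum_congr rfl fun i _ => Finset.sum_congr rfl fun j _ => ?_
      congr 1
      rw [Finset.sum_eq_single i, Finset.sum_eq_single j] <;> simp +contextual [eq_comm]
    rw [e, Finset.sum_mul]
    refine (Finset.abs_sum_le_sum_abs _ _).trans (Finset.sum_le_sum fun i _ => ?_)
    rw [Finset.sum_mul]
    refine (Finset.abs_sum_le_sum_abs _ _).trans (Finset.sum_le_sum fun j _ => ?_)
    rw [abs_mul, mul_assoc]
    exact mul_le_mul (q.bdd y τ i j) ((trL _).le_opNorm D) (abs_nonneg _) q.M_nonneg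
  set KK := ∑ i : Fin N, ∑ j : Fin N, q.M * ‖trL (N := N) (Matrix.single i j 1)‖ with hKK
  have hKK0 : 0 ≤ KK := Finset.sum_nonneg fun i _ => Finset.sum_nonneg fun j _ =>
    mul_nonneg q.M_nonneg (ContinuousLinearMap.opNorm_nonneg _)
  have key := hasDerivAt_integral_of_dominated_loc_of_deriv_le (μ := volume)
    (F := fun τ y => φ y * g0 (q.prec s τ y) (x - y))
    (F' := fun τ y => φ y * (1 / 2 * trL (q.a y τ) (g2 (q.prec s τ y) (x - y))))
    (bound := fun y => F * (1 / 2 * (KK * (C * Real.exp (-(q.c / R / 16) * ‖x - y‖ ^ 2)))))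
    (x₀ := t) (Ioo_mem_nhds htU.1 htU.2)
    (by
      filter_upwards [Ioo_mem_nhds htU.1 htU.2] with τ hτ
      exact (integrable_sub hr8 hG0 (hU τ hτ).2 (q.continuous_prec s τ) hφ hF x).aestronglyMeasurable)
    (integrable_sub hr8 hG0 (hU t htU).2 (q.continuous_prec s t) hφ hF x)
    (by
      simp_rw [hdecomp]
      exact ((((trL _).integrable_comp hi2).const_mul _).sub hsumi).aestronglyMeasurable)
    (Eventually.of_forall fun y τ hτ => by
      rw [Real.norm_eq_abs, abs_mul, abs_mul, abs_of_pos (by norm_num : (0 : ℝ) < 1 / 2)]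
      refine mul_le_mul (hF y) ?_ (by positivity) hF0
      refine mul_le_mul_of_nonneg_left ((htrb _ _ _).trans ?_) (by norm_num)
      exact mul_le_mul_of_nonneg_left (hb2 _ ((hU τ hτ).2 y) _).1 hKK0)
    (((((((integrable_gauss (N := N) hr16).comp_sub_left x)).const_mul C).const_mul
      KK).const_mul (1 / 2)).const_mul F)
    (Eventually.of_forall fun y τ hτ => by
      refine HasDerivAt.const_mul _ (hasDerivAt_g0 hc hb (q.hasDerivAt_precision y (hU τ hτ).1) ?_ _)
      filter_upwards [Ioo_mem_nhds hτ.1 hτ.2] with τ' hτ'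
      exact (hU τ' hτ').2 y)
  have h3 := key.2
  simp_rw [hdecomp] at h3
  rw [integral_sub (((trL _).integrable_comp hi2).const_mul _) hsumi, integral_const_mul,
    ContinuousLinearMap.integral_comp_comm _ hi2, ← q.P2_eq_integral hst,
    integral_finsetSum _ (fun i _ => integrable_finsetSum _ fun j _ => (hih i j).const_mul _)] at h3
  refine (h3.congr_of_eventuallyEq ?_).congr_deriv ?_
  · filter_upwards [Ioo_mem_nhds htU.1 htU.2] with τ hτ
    exact q.P_eq_integral (hU τ hτ).1 φ x
  · congr 1
    rw [Kk]
    refine Finset.sum_congr rfl fun i _ => ?_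
    rw [integral_finsetSum _ (fun j _ => (hih i j).const_mul _)]
    refine Finset.sum_congr rfl fun j _ => ?_
    rw [integral_const_mul, mul_assoc, q.op_h2_eq_integral hst]
    rfl

theorem P_hasFDerivAt {φ : Euc N → ℝ} (hφ : Continuous φ) {F : ℝ} (hF : ∀ y, |φ y| ≤ F)
    (x : Euc N) {s t : ℝ} (hst : s < t) :
    HasFDerivAt (fun x => q.P φ x s t) (innerSL ℝ (q.P1 φ x s t)) x := by
  have hl : 0 < √(t - s) := Real.sqrt_pos.2 (sub_pos.2 hst)
  have h := op_hasFDerivAt q.neg_c8 q.gl0 q.neg_c16 (GaussLip.clm (innerSL ℝ) q.gl1)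
    (fun B hB z => hasFDerivAt_g0 hB z) (q.Bf_mem s t) (q.continuous_Bf_y s t) hφ hF hl x
  rw [op_clm q.neg_c16 q.gl1 (q.Bf_mem s t) (q.continuous_Bf_y s t) hφ hF] at h
  refine h.congr_fderiv ?_
  rw [P1, map_smul]

theorem P1_hasFDerivAt {φ : Euc N → ℝ} (hφ : Continuous φ) {F : ℝ} (hF : ∀ y, |φ y| ≤ F)
    (x : Euc N) {s t : ℝ} (hst : s < t) :
    HasFDerivAt (fun x => q.P1 φ x s t) (q.P2 φ x s t) x := by
  have hr := sub_pos.2 hst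
  have hl : 0 < √(t - s) := Real.sqrt_pos.2 hr
  have h := (op_hasFDerivAt q.neg_c16 q.gl1 q.neg_c16 q.gl2 (fun B hB z => hasFDerivAt_g1 hB z)
    (q.Bf_mem s t) (q.continuous_Bf_y s t) hφ hF hl x).const_smul (√(t - s))⁻¹
  refine h.congr_fderiv ?_
  rw [P2, smul_smul, ← mul_inv, Real.mul_self_sqrt hr.le]

theorem P_self {φ : Euc N → ℝ} (x : Euc N) (t : ℝ) : q.P φ x t t = φ x := by
  simp only [P, Op, sub_self, Real.sqrt_zero, zero_smul, sub_zero, smul_eq_mul]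
  rw [integral_const_mul, integral_g0 q.c_pos q.b_pos (q.Bf_mem t t x), mul_one]

end Coef

end Parametrix

end Parabolic

namespace Parabolic

open Filter Topology
open scoped RealInnerProductSpace

section Families

variable {N : ℕ} {X : Type*} [TopologicalSpace X]

/-- A locally uniformly bounded family of functions, jointly continuous at a parameter value. -/
structure Fam (φ : X → Euc N → ℝ) (ξ : X) (M : ℝ) : Prop where
  cont : ∀ᶠ η in 𝓝 ξ, Continuous (φ η)
  bdd : ∀ᶠ η in 𝓝 ξ, ∀ y, |φ η y| ≤ M
  joint : ∀ y, ContinuousAt (fun p : X × Euc N => φ p.1 p.2) (ξ, y)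

theorem Fam.const {φ : Euc N → ℝ} (hφ : Continuous φ) {M : ℝ} (hM : ∀ y, |φ y| ≤ M) (ξ : X) :
    Fam (fun _ => φ) ξ M :=
  ⟨Eventually.of_forall fun _ => hφ, Eventually.of_forall fun _ => hM,
    fun _ => (hφ.comp continuous_snd).continuousAt⟩

namespace Coef

variable (q : Coef N)
variable {φ : X → Euc N → ℝ} {ξ : X} {M : ℝ} {x : X → Euc N} {s t : X → ℝ}

theorem freeze_fam (hφ : Fam φ ξ M) (hx : ContinuousAt x ξ) (ht : ContinuousAt t ξ) (i j : Fin N) :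
    Fam (fun η y => (q.a (x η) (t η) i j - q.a y (t η) i j) * φ η y) ξ (2 * q.M * M) where
  cont := by
    filter_upwards [hφ.cont] with η h
    exact q.continuous_freeze _ _ i j h
  bdd := by
    filter_upwards [hφ.bdd] with η h
    exact q.freeze_bdd _ _ i j h
  joint y := by
    refine ContinuousAt.mul (ContinuousAt.sub ?_ ?_) (hφ.joint y)
    · exact (q.cont i j).continuousAt.comp (f := fun p : X × Euc N => (x p.1, t p.1))
        ((hx.comp continuousAt_fst).prodMk (ht.comp continuousAt_fst))
    · exact (q.cont i j).continuousAt.comp (f := fun p : X × Euc N => (p.2, t p.1))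
        (continuousAt_snd.prodMk (ht.comp continuousAt_fst))

variable [FirstCountableTopology X]

theorem op_cont {F : Type*} [NormedAddCommGroup F] [NormedSpace ℝ F] {r : ℝ}
    {Ψ : Opr N → Euc N → F} (hr : r < 0) (h : GaussLip q.c q.b r Ψ) (hφ : Fam φ ξ M)
    (hx : ContinuousAt x ξ) (hs : ContinuousAt s ξ) (ht : ContinuousAt t ξ) :
    ContinuousAt (fun η => Op Ψ (q.Bf (s η) (t η)) √(t η - s η) (φ η) (x η)) ξ := by
  have hp : ∀ z : Euc N, ContinuousAt (fun η => x η - √(t η - s η) • z) ξ := fun z =>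
    hx.sub ((Real.continuous_sqrt.continuousAt.comp (ht.sub hs)).smul continuousAt_const)
  refine op_continuousAt hr h (fun η y => q.Bf_mem _ _ y)
    (Eventually.of_forall fun η => q.continuous_Bf_y _ _) hφ.cont hφ.bdd (fun z => ?_) (fun z => ?_)
  · exact (q.continuous_Bf.continuousAt).comp
      (f := fun η => (x η - √(t η - s η) • z, s η, t η)) ((hp z).prodMk (hs.prodMk ht))
  · exact (hφ.joint _).comp (f := fun η => (η, x η - √(t η - s η) • z))
      (continuousAt_id.prodMk (hp z))

theorem P_cont (hφ : Fam φ ξ M) (hx : ContinuousAt x ξ) (hs : ContinuousAt s ξ)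
    (ht : ContinuousAt t ξ) : ContinuousAt (fun η => q.P (φ η) (x η) (s η) (t η)) ξ :=
  q.op_cont q.neg_c8 q.gl0 hφ hx hs ht

theorem P1_cont (hφ : Fam φ ξ M) (hx : ContinuousAt x ξ) (hs : ContinuousAt s ξ)
    (ht : ContinuousAt t ξ) (hst : s ξ < t ξ) :
    ContinuousAt (fun η => q.P1 (φ η) (x η) (s η) (t η)) ξ :=
  ((Real.continuous_sqrt.continuousAt.comp (ht.sub hs)).inv₀
    (Real.sqrt_pos.2 (sub_pos.2 hst)).ne').smul (q.op_cont q.neg_c16 q.gl1 hφ hx hs ht)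

theorem P2_cont (hφ : Fam φ ξ M) (hx : ContinuousAt x ξ) (hs : ContinuousAt s ξ)
    (ht : ContinuousAt t ξ) (hst : s ξ < t ξ) :
    ContinuousAt (fun η => q.P2 (φ η) (x η) (s η) (t η)) ξ :=
  ((ht.sub hs).inv₀ (sub_pos.2 hst).ne').smul (q.op_cont q.neg_c16 q.gl2 hφ hx hs ht)

theorem Kk_cont (hφ : Fam φ ξ M) (hx : ContinuousAt x ξ) (hs : ContinuousAt s ξ)
    (ht : ContinuousAt t ξ) (hst : s ξ < t ξ) :
    ContinuousAt (fun η => q.Kk (φ η) (x η) (s η) (t η)) ξ := by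
  refine tendsto_finsetSum _ fun i _ => tendsto_finsetSum _ fun j _ => ?_
  exact (continuousAt_const.mul ((ht.sub hs).inv₀ (sub_pos.2 hst).ne')).mul
    (q.op_cont q.neg_c16 (q.glh i j) (q.freeze_fam hφ hx ht i j) hx hs ht)

end Coef

end Families

section Bundle

variable {N : ℕ}

namespace Coef

variable (q : Coef N)

theorem op_sub {F : Type*} [NormedAddCommGroup F] [NormedSpace ℝ F] {r : ℝ}
    {Ψ : Opr N → Euc N → F} (hr : r < 0) (h : GaussLip q.c q.b r Ψ) {φ ψ : Euc N → ℝ}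
    (hφ : Continuous φ) (hψ : Continuous ψ) {M M' : ℝ} (hM : ∀ y, |φ y| ≤ M) (hM' : ∀ y, |ψ y| ≤ M')
    (s t l : ℝ) (x : Euc N) :
    Op Ψ (q.Bf s t) l (fun y => φ y - ψ y) x = Op Ψ (q.Bf s t) l φ x - Op Ψ (q.Bf s t) l ψ x := by
  rw [eq_sub_iff_add_eq, ← op_add hr h (q.Bf_mem s t) (q.continuous_Bf_y s t)
    (φ := fun y => φ y - ψ y) (hφ.sub hψ) hψ (M := M + M') (fun y => (abs_sub _ _).trans (add_le_add (hM y) (hM' y))) hM']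
  simp

/-- The parametrix, its gradient and the defect, bundled. -/
def Th (φ : Euc N → ℝ) (x : Euc N) (s t : ℝ) : ℝ × Euc N × ℝ :=
  (q.P φ x s t, q.P1 φ x s t, q.Kk φ x s t)

theorem Th_sub {φ ψ : Euc N → ℝ} (hφ : Continuous φ) (hψ : Continuous ψ) {M M' : ℝ}
    (hM : ∀ y, |φ y| ≤ M) (hM' : ∀ y, |ψ y| ≤ M') (x : Euc N) (s t : ℝ) :
    q.Th (fun y => φ y - ψ y) x s t = q.Th φ x s t - q.Th ψ x s t := by
  refine Prod.ext ?_ (Prod.ext ?_ ?_)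
  · exact q.op_sub q.neg_c8 q.gl0 hφ hψ hM hM' _ _ _ _
  · simp only [Th, P1, q.op_sub q.neg_c16 q.gl1 hφ hψ hM hM', smul_sub, Prod.snd_sub, Prod.fst_sub]
  · simp only [Th, Kk, Prod.snd_sub, ← Finset.sum_sub_distrib, ← mul_sub]
    refine Finset.sum_congr rfl fun i _ => Finset.sum_congr rfl fun j _ => ?_
    rw [← q.op_sub q.neg_c16 (q.glh i j) (q.continuous_freeze x t i j hφ)
      (q.continuous_freeze x t i j hψ) (q.freeze_bdd x t i j hM) (q.freeze_bdd x t i j hM')]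
    congr 2
    funext y
    ring

theorem Th_bound : ∃ C, 0 ≤ C ∧ ∀ (φ : Euc N → ℝ) (F : ℝ), (∀ y, |φ y| ≤ F) → ∀ x s t, s < t →
    ‖q.Th φ x s t‖ ≤ C * F * ((t - s) ^ (-(1 / 2) : ℝ) * Real.exp (t - s)) := by
  obtain ⟨C0, hC0, h0⟩ := q.P_bound
  obtain ⟨C1, hC1, h1⟩ := q.P1_bound
  obtain ⟨C2, hC2, h2⟩ := q.Kk_bound
  refine ⟨C0 + C1 + C2, by positivity, fun φ F hF x s t hst => ?_⟩
  have hF0 : 0 ≤ F := (abs_nonneg _).trans (hF 0)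
  have hr := sub_pos.2 hst
  have hl : 0 < √(t - s) := Real.sqrt_pos.2 hr
  rw [← inv_sqrt hr]
  have e0 : √(t - s) ≤ Real.exp (t - s) := by
    have := Real.add_one_le_exp (t - s)
    nlinarith [Real.sq_sqrt hr.le, sq_nonneg (√(t - s) - 1)]
  have e1 : (√(t - s))⁻¹ ≤ (√(t - s))⁻¹ * Real.exp (t - s) :=
    le_mul_of_one_le_right (by positivity) (Real.one_le_exp hr.le)
  have e2 : 1 ≤ (√(t - s))⁻¹ * Real.exp (t - s) := by
    rw [inv_mul_eq_div, one_le_div hl]; exact e0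
  set E := (√(t - s))⁻¹ * Real.exp (t - s)
  have hE : 0 ≤ E := by positivity
  have hb0 : |q.P φ x s t| ≤ (C0 + C1 + C2) * F * E := by
    have a1 := h0 φ F hF x s t
    have : C0 * F ≤ C0 * F * E := le_mul_of_one_le_right (by positivity) e2
    have : 0 ≤ (C1 + C2) * F * E := by positivity
    linarith
  have hb1 : ‖q.P1 φ x s t‖ ≤ (C0 + C1 + C2) * F * E := by
    have a1 := h1 φ F hF x s t
    have : C1 * F * (√(t - s))⁻¹ ≤ C1 * F * E := by gcongr
    have : 0 ≤ (C0 + C2) * F * E := by positivity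
    linarith
  have hb2 : |q.Kk φ x s t| ≤ (C0 + C1 + C2) * F * E := by
    have a1 := h2 φ F hF x s t hst
    have : C2 * F * (√(t - s))⁻¹ ≤ C2 * F * E := by gcongr
    have : 0 ≤ (C0 + C1) * F * E := by positivity
    linarith
  exact max_le hb0 (max_le hb1 hb2)

theorem Th_cont {X : Type*} [TopologicalSpace X] [FirstCountableTopology X]
    {φ : X → Euc N → ℝ} {ξ : X} {M : ℝ} {x : X → Euc N} {s t : X → ℝ}
    (hφ : Fam φ ξ M) (hx : ContinuousAt x ξ) (hs : ContinuousAt s ξ)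
    (ht : ContinuousAt t ξ) (hst : s ξ < t ξ) :
    ContinuousAt (fun η => q.Th (φ η) (x η) (s η) (t η)) ξ :=
  (q.P_cont hφ hx hs ht).prodMk ((q.P1_cont hφ hx hs ht hst).prodMk (q.Kk_cont hφ hx hs ht hst))

end Coef

end Bundle

end Parabolic

namespace Parabolic

open Filter Topology

section Volterra

variable {W : Type*} [NormedAddCommGroup W] [NormedSpace ℝ W]

/-- The weakly singular kernel `s ^ (-p) * (t - s) ^ (-q)`. -/
def sker (p q s t : ℝ) : ℝ := s ^ (-p) * (t - s) ^ (-q)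

theorem sker_nonneg {p q s t : ℝ} (hs : 0 ≤ s) (hst : s ≤ t) : 0 ≤ sker p q s t :=
  mul_nonneg (Real.rpow_nonneg hs _) (Real.rpow_nonneg (sub_nonneg.2 hst) _)

theorem half_rpow_neg_le {t r q : ℝ} (ht : 0 < t) (hr : t / 2 ≤ r) (hq : 0 ≤ q) (hq1 : q < 1) :
    r ^ (-q) ≤ 2 * t ^ (-q) := by
  have h1 : r ^ (-q) ≤ (t / 2) ^ (-q) :=
    Real.rpow_le_rpow_of_nonpos (by positivity) hr (by linarith)
  have h2 : (t / 2) ^ (-q) = 2 ^ q * t ^ (-q) := by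
    rw [Real.div_rpow ht.le (by norm_num), Real.rpow_neg (by norm_num : (0:ℝ) ≤ 2), div_inv_eq_mul,
      mul_comm]
  have h3 : (2:ℝ) ^ q ≤ 2 := by
    simpa using Real.rpow_le_rpow_of_exponent_le (by norm_num : (1:ℝ) ≤ 2) hq1.le
  calc r ^ (-q) ≤ 2 ^ q * t ^ (-q) := h1.trans h2.le
    _ ≤ 2 * t ^ (-q) := by gcongr

theorem sker_le {p q s t : ℝ} (hp : 0 ≤ p) (hp1 : p < 1) (hq : 0 ≤ q) (hq1 : q < 1) (hs : 0 < s)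
    (hst : s < t) :
    sker p q s t ≤ 2 * (t ^ (-q) * s ^ (-p) + t ^ (-p) * (t - s) ^ (-q)) := by
  have ht : 0 < t := hs.trans hst
  have hr : 0 < t - s := sub_pos.2 hst
  have a1 : 0 ≤ t ^ (-q) * s ^ (-p) := by positivity
  have a2 : 0 ≤ t ^ (-p) * (t - s) ^ (-q) := by positivity
  unfold sker
  rcases le_total s (t / 2) with h | h
  · have := half_rpow_neg_le ht (by linarith : t / 2 ≤ t - s) hq hq1
    have : s ^ (-p) * (t - s) ^ (-q) ≤ s ^ (-p) * (2 * t ^ (-q)) := by gcongr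
    linarith
  · have := half_rpow_neg_le ht h hp hp1
    have : s ^ (-p) * (t - s) ^ (-q) ≤ (2 * t ^ (-p)) * (t - s) ^ (-q) := by gcongr
    linarith

theorem intervalIntegrable_rpow_sub {q : ℝ} (hq1 : q < 1) (t : ℝ) :
    IntervalIntegrable (fun s => (t - s) ^ (-q)) volume 0 t := by
  have := (intervalIntegral.intervalIntegrable_rpow' (a := t) (b := 0)
    (by linarith : -1 < -q)).comp_sub_left (c := t)
  simpa using this

theorem integral_rpow_sub {q : ℝ} (hq1 : q < 1) (t : ℝ) :
    ∫ s in 0..t, (t - s) ^ (-q) = t ^ (1 - q) / (1 - q) := by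
  rw [intervalIntegral.integral_comp_sub_left (fun s => s ^ (-q)) t]
  simp only [sub_self, sub_zero]
  rw [integral_rpow (Or.inl (by linarith)), Real.zero_rpow (by linarith)]
  ring_nf

theorem intervalIntegrable_sker {p q t : ℝ} (hp : 0 ≤ p) (hp1 : p < 1) (hq : 0 ≤ q) (hq1 : q < 1)
    (ht : 0 < t) : IntervalIntegrable (fun s => sker p q s t) volume 0 t := by
  have hi : IntervalIntegrable
      (fun s => 2 * (t ^ (-q) * s ^ (-p) + t ^ (-p) * (t - s) ^ (-q))) volume 0 t :=
    (((intervalIntegral.intervalIntegrable_rpow' (by linarith)).const_mul _).add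
      ((intervalIntegrable_rpow_sub hq1 t).const_mul _)).const_mul _
  rw [intervalIntegrable_iff_integrableOn_Ioo_of_le ht.le] at hi ⊢
  refine Integrable.mono' hi ?_ ?_
  · refine (Measurable.aestronglyMeasurable ?_)
    unfold sker
    fun_prop
  · refine (ae_restrict_iff' measurableSet_Ioo).2 (Eventually.of_forall fun s hs => ?_)
    rw [Real.norm_of_nonneg (sker_nonneg hs.1.le hs.2.le)]
    exact sker_le hp hp1 hq hq1 hs.1 hs.2

theorem integral_sker_le {p q t : ℝ} (hp : 0 ≤ p) (hp1 : p < 1) (hq : 0 ≤ q) (hq1 : q < 1)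
    (ht : 0 < t) :
    ∫ s in 0..t, sker p q s t ≤ 2 * (1 / (1 - p) + 1 / (1 - q)) * t ^ (1 - p - q) := by
  have i1 : IntervalIntegrable (fun s => t ^ (-q) * s ^ (-p)) volume 0 t :=
    (intervalIntegral.intervalIntegrable_rpow' (by linarith)).const_mul _
  have i2 : IntervalIntegrable (fun s => t ^ (-p) * (t - s) ^ (-q)) volume 0 t :=
    (intervalIntegrable_rpow_sub hq1 t).const_mul _
  have h := intervalIntegral.integral_mono_on_of_le_Ioo ht.le
    (intervalIntegrable_sker hp hp1 hq hq1 ht) ((i1.add i2).const_mul 2)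
    (fun s hs => sker_le hp hp1 hq hq1 hs.1 hs.2)
  refine h.trans_eq ?_
  rw [intervalIntegral.integral_const_mul, intervalIntegral.integral_add i1 i2,
    intervalIntegral.integral_const_mul, intervalIntegral.integral_const_mul,
    integral_rpow_sub hq1, integral_rpow (Or.inl (by linarith)), Real.zero_rpow (by linarith)]
  have e1 : t ^ (1 - p - q) = t ^ (-q) * t ^ (-p + 1) := by
    rw [← Real.rpow_add ht]; ring_nf
  have e2 : t ^ (1 - p - q) = t ^ (-p) * t ^ (1 - q) := by
    rw [← Real.rpow_add ht]; ring_nf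
  have d1 : -p + 1 = 1 - p := by ring
  rw [sub_zero, mul_add, mul_add, add_mul, mul_assoc 2 (1 / (1 - p)), e1, mul_assoc 2 (1 / (1 - q)),
    ← e1, e2, d1]
  rw [← e2, e1, d1]
  rw [show t ^ (-p) * (t ^ (1 - q) / (1 - q)) = (t ^ (-p) * t ^ (1 - q)) / (1 - q) by ring, ← e2,
    e1, d1]
  ring

/-- A function on `(0, t)` which is continuous and dominated by a weakly singular kernel. -/
structure Sing (Φ : ℝ → W) (C p q t : ℝ) : Prop where
  cont : ContinuousOn Φ (Ioo 0 t)
  bound : ∀ s ∈ Ioo 0 t, ‖Φ s‖ ≤ C * sker p q s t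

theorem Sing.integrable {Φ : ℝ → W} {C p q t : ℝ} (h : Sing Φ C p q t) (hp : 0 ≤ p) (hp1 : p < 1)
    (hq : 0 ≤ q) (hq1 : q < 1) (ht : 0 < t) : IntervalIntegrable Φ volume 0 t := by
  have hi := (intervalIntegrable_sker hp hp1 hq hq1 ht).const_mul C
  rw [intervalIntegrable_iff_integrableOn_Ioo_of_le ht.le] at hi ⊢
  exact Integrable.mono' hi (h.cont.aestronglyMeasurable measurableSet_Ioo)
    ((ae_restrict_iff' measurableSet_Ioo).2 (Eventually.of_forall h.bound))

theorem Sing.norm_integral_le {Φ : ℝ → W} {C p q t : ℝ} (h : Sing Φ C p q t) (hC : 0 ≤ C)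
    (hp : 0 ≤ p) (hp1 : p < 1) (hq : 0 ≤ q) (hq1 : q < 1) (ht : 0 < t) :
    ‖∫ s in 0..t, Φ s‖ ≤ C * (2 * (1 / (1 - p) + 1 / (1 - q)) * t ^ (1 - p - q)) := by
  have hi := intervalIntegrable_sker hp hp1 hq hq1 ht
  have h1 : ‖∫ s in 0..t, Φ s‖ ≤ ∫ s in 0..t, ‖Φ s‖ :=
    intervalIntegral.norm_integral_le_integral_norm ht.le
  refine h1.trans ((intervalIntegral.integral_mono_on_of_le_Ioo ht.le
    (h.integrable hp hp1 hq hq1 ht).norm (hi.const_mul C) h.bound).trans ?_)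
  rw [intervalIntegral.integral_const_mul]
  exact mul_le_mul_of_nonneg_left (integral_sker_le hp hp1 hq hq1 ht) hC

theorem sker_scale {p q t r : ℝ} (ht : 0 < t) (hr : 0 ≤ r) (hr1 : r ≤ 1) :
    sker p q (t * r) t = t ^ (-p - q) * sker p q r 1 := by
  unfold sker
  rw [show t - t * r = t * (1 - r) by ring, Real.mul_rpow ht.le hr,
    Real.mul_rpow ht.le (by linarith), sub_eq_add_neg (-p), Real.rpow_add ht]
  ring

theorem continuousAt_volterra {X : Type*} [TopologicalSpace X] [FirstCountableTopology X]
    {Φ : X → ℝ → W} {τ : X → ℝ} {ξ : X} {C p q : ℝ} (hp : 0 ≤ p) (hp1 : p < 1) (hq : 0 ≤ q)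
    (hq1 : q < 1) (hC : 0 ≤ C) (hτ : ContinuousAt τ ξ) (hτ0 : 0 < τ ξ)
    (hs : ∀ᶠ η in 𝓝 ξ, Sing (Φ η) C p q (τ η))
    (hj : ∀ s ∈ Ioo 0 (τ ξ), ContinuousAt (fun z : X × ℝ => Φ z.1 z.2) (ξ, s)) :
    ContinuousAt (fun η => ∫ s in 0..τ η, Φ η s) ξ := by
  have e : ∀ η, ∫ s in 0..τ η, Φ η s = τ η • ∫ r in (0:ℝ)..1, Φ η (τ η * r) := fun η => by
    rw [intervalIntegral.smul_integral_comp_mul_left, mul_zero, mul_one]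
  simp_rw [e]
  refine hτ.smul ?_
  have hne : ∀ᵐ r : ℝ, r ≠ 1 := by simp [ae_iff, measure_singleton]
  have hpos : ∀ᶠ η in 𝓝 ξ, 0 < τ η := hτ.eventually (lt_mem_nhds hτ0)
  have hsc : ∀ᶠ η in 𝓝 ξ, (τ η) ^ (-p - q) < (τ ξ) ^ (-p - q) + 1 :=
    (hτ.rpow_const (Or.inl hτ0.ne')).eventually (gt_mem_nhds (by linarith))
  refine intervalIntegral.continuousAt_of_dominated_interval
    (bound := fun r => C * (((τ ξ) ^ (-p - q) + 1) * sker p q r 1)) ?_ ?_ ?_ ?_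
  · filter_upwards [hs, hpos] with η h h0
    rw [uIoc_of_le zero_le_one, ← restrict_Ioo_eq_restrict_Ioc]
    refine ContinuousOn.aestronglyMeasurable ?_ measurableSet_Ioo
    refine h.cont.comp (by fun_prop) fun r hr => ⟨mul_pos h0 hr.1, ?_⟩
    exact mul_lt_of_lt_one_right h0 hr.2
  · filter_upwards [hs, hpos, hsc] with η h h0 h2
    filter_upwards [hne] with r hr1 hr
    rw [uIoc_of_le zero_le_one] at hr
    have hr2 : r < 1 := lt_of_le_of_ne hr.2 hr1
    refine (h.bound _ ⟨mul_pos h0 hr.1, mul_lt_of_lt_one_right h0 hr2⟩).trans ?_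
    rw [sker_scale h0 hr.1.le hr.2]
    have := sker_nonneg (p := p) (q := q) hr.1.le hr.2
    gcongr
  · exact ((intervalIntegrable_sker hp hp1 hq hq1 one_pos).const_mul _).const_mul _
  · filter_upwards [hne] with r hr1 hr
    rw [uIoc_of_le zero_le_one] at hr
    have hr2 : r < 1 := lt_of_le_of_ne hr.2 hr1
    exact (hj _ ⟨mul_pos hτ0 hr.1, mul_lt_of_lt_one_right hτ0 hr2⟩).comp
      (f := fun η => (η, τ η * r)) (continuousAt_id.prodMk (hτ.mul continuousAt_const))

theorem hasFDerivAt_volterra {E : Type*} [NormedAddCommGroup E] [NormedSpace ℝ E]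
    {Φ : E → ℝ → W} {Φ' : E → ℝ → E →L[ℝ] W} {x : E} {t ε C C' p q p' q' : ℝ} (hε : 0 < ε)
    (ht : 0 < t)
    (hp : 0 ≤ p) (hp1 : p < 1) (hq : 0 ≤ q) (hq1 : q < 1)
    (hp' : 0 ≤ p') (hp1' : p' < 1) (hq' : 0 ≤ q') (hq1' : q' < 1)
    (hΦ : ∀ y, Sing (Φ y) C p q t) (hΦ' : ∀ y ∈ Metric.ball x ε, Sing (Φ' y) C' p' q' t)
    (hd : ∀ y, ∀ s ∈ Ioo 0 t, HasFDerivAt (fun y => Φ y s) (Φ' y s) y) :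
    HasFDerivAt (fun y => ∫ s in 0..t, Φ y s) (∫ s in 0..t, Φ' x s) x := by
  simp only [intervalIntegral.integral_of_le ht.le, integral_Ioc_eq_integral_Ioo]
  have i1 := (hΦ x).integrable hp hp1 hq hq1 ht
  have i2 := (intervalIntegrable_sker hp' hp1' hq' hq1' ht).const_mul C'
  rw [intervalIntegrable_iff_integrableOn_Ioo_of_le ht.le] at i1 i2
  refine hasFDerivAt_integral_of_dominated_of_fderiv_le (Metric.ball_mem_nhds x hε)
    (Eventually.of_forall fun y => (hΦ y).cont.aestronglyMeasurable measurableSet_Ioo) i1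
    ((hΦ' x (Metric.mem_ball_self hε)).cont.aestronglyMeasurable measurableSet_Ioo)
    (bound := fun s => C' * sker p' q' s t) ?_ i2 ?_
  · exact (ae_restrict_iff' measurableSet_Ioo).2 (Eventually.of_forall fun s hs y hy =>
      (hΦ' y hy).bound s hs)
  · exact (ae_restrict_iff' measurableSet_Ioo).2 (Eventually.of_forall fun s hs y _ => hd y s hs)

end Volterra

end Parabolic

namespace Parabolic

open Filter Topology

section TimeDerivative

theorem sker_anti {p q s t τ : ℝ} (hq : 0 ≤ q) (hs : 0 < s) (hst : s < t) (h : t ≤ τ) :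
    sker p q s τ ≤ sker p q s t := by
  have : 0 < t - s := sub_pos.2 hst
  exact mul_le_mul_of_nonneg_left
    (Real.rpow_le_rpow_of_nonpos this (by linarith) (by linarith)) (Real.rpow_nonneg hs.le _)

/-- Continuity and growth conditions on a Volterra kernel `P` and its time derivative `Q`. -/
structure TimeKernel (P Q : ℝ → ℝ → ℝ) (C a b T : ℝ) : Prop where
  contP : ∀ s t, 0 < s → ContinuousAt (fun z : ℝ × ℝ => P z.1 z.2) (s, t)
  contQ : ∀ s t, 0 < s → s < t → ContinuousAt (fun z : ℝ × ℝ => Q z.1 z.2) (s, t)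
  boundP : ∀ s t, 0 < s → s < t → t ≤ T → |P s t| ≤ C * sker a 0 s t
  boundQ : ∀ s t, 0 < s → s < t → t ≤ T → |Q s t| ≤ C * sker a b s t
  deriv : ∀ s t, 0 < s → s < t → HasDerivAt (P s) (Q s t) t

variable {P Q : ℝ → ℝ → ℝ} {C a b T : ℝ}

theorem TimeKernel.singP (h : TimeKernel P Q C a b T) {t : ℝ} (htT : t ≤ T) :
    Sing (fun s => P s t) C a 0 t where
  cont s hs := ((h.contP s t hs.1).comp (f := fun s => (s, t))
    (continuousAt_id.prodMk continuousAt_const)).continuousWithinAt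
  bound s hs := h.boundP s t hs.1 hs.2 htT

theorem TimeKernel.singQ (h : TimeKernel P Q C a b T) {t : ℝ} (htT : t ≤ T) :
    Sing (fun s => Q s t) C a b t where
  cont s hs := ((h.contQ s t hs.1 hs.2).comp (f := fun s => (s, t))
    (continuousAt_id.prodMk continuousAt_const)).continuousWithinAt
  bound s hs := h.boundQ s t hs.1 hs.2 htT

theorem TimeKernel.continuousAt_P (h : TimeKernel P Q C a b T) (hC : 0 ≤ C) (ha : 0 ≤ a)
    (ha1 : a < 1) {t : ℝ} (ht : 0 < t) (htT : t < T) :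
    ContinuousAt (fun t => ∫ s in 0..t, P s t) t := by
  refine continuousAt_volterra (Φ := fun t s => P s t) ha ha1 le_rfl one_pos hC continuousAt_id ht
    ?_ fun s hs => ?_
  · filter_upwards [gt_mem_nhds htT] with η hη using h.singP hη.le
  · exact (h.contP s t hs.1).comp (f := fun z : ℝ × ℝ => (z.2, z.1)) (x := (t, s))
      (continuousAt_snd.prodMk continuousAt_fst)

theorem TimeKernel.continuousAt_Q (h : TimeKernel P Q C a b T) (hC : 0 ≤ C) (ha : 0 ≤ a)
    (ha1 : a < 1) (hb : 0 ≤ b) (hb1 : b < 1) {t : ℝ} (ht : 0 < t) (htT : t < T) :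
    ContinuousAt (fun t => ∫ s in 0..t, Q s t) t := by
  refine continuousAt_volterra (Φ := fun t s => Q s t) ha ha1 hb hb1 hC continuousAt_id ht
    ?_ fun s hs => ?_
  · filter_upwards [gt_mem_nhds htT] with η hη using h.singQ hη.le
  · exact (h.contQ s t hs.1 hs.2).comp (f := fun z : ℝ × ℝ => (z.2, z.1)) (x := (t, s))
      (continuousAt_snd.prodMk continuousAt_fst)

theorem tendsto_average {P : ℝ → ℝ → ℝ} {t : ℝ}
    (h : ContinuousAt (fun z : ℝ × ℝ => P z.1 z.2) (t, t))
    (hi : ∀ᶠ τ in 𝓝[>] t, IntervalIntegrable (fun s => P s τ) volume t τ) :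
    Tendsto (fun τ => (τ - t)⁻¹ * ∫ s in t..τ, P s τ) (𝓝[>] t) (𝓝 (P t t)) := by
  rw [Metric.tendsto_nhds]
  intro ε hε
  obtain ⟨δ, hδ, hd⟩ := Metric.continuousAt_iff.1 h (ε / 2) (half_pos hε)
  have h2 : ∀ᶠ τ in 𝓝[>] t, τ < t + δ :=
    mem_nhdsWithin_of_mem_nhds (gt_mem_nhds (by linarith))
  filter_upwards [hi, h2, self_mem_nhdsWithin] with τ hiτ hτδ hτ
  have hτ0 : 0 < τ - t := sub_pos.2 hτ
  have e : (τ - t)⁻¹ * (∫ s in t..τ, P s τ) - P t t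
      = (τ - t)⁻¹ * ∫ s in t..τ, (P s τ - P t t) := by
    rw [intervalIntegral.integral_sub hiτ intervalIntegrable_const,
      intervalIntegral.integral_const, smul_eq_mul]
    field_simp
  have hb : ‖∫ s in t..τ, (P s τ - P t t)‖ ≤ ε / 2 * |τ - t| := by
    refine intervalIntegral.norm_integral_le_of_norm_le_const fun s hs => ?_
    rw [uIoc_of_le (le_of_lt hτ)] at hs
    refine (hd (x := (s, τ)) ?_).le
    rw [Prod.dist_eq, max_lt_iff, Real.dist_eq, Real.dist_eq, abs_lt, abs_lt]
    have := hs.1; have := hs.2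
    refine ⟨⟨?_, ?_⟩, ?_, ?_⟩ <;> dsimp only <;> linarith
  rw [Real.dist_eq, e, abs_mul, abs_inv, abs_of_pos hτ0, inv_mul_lt_iff₀ hτ0]
  rw [Real.norm_eq_abs, abs_of_pos hτ0] at hb
  nlinarith

theorem TimeKernel.hasDerivWithinAt (h : TimeKernel P Q C a b T) (ha : 0 ≤ a)
    (ha1 : a < 1) (hb : 0 ≤ b) (hb1 : b < 1) {t : ℝ} (ht : 0 < t) (htT : t < T) :
    HasDerivWithinAt (fun t => ∫ s in 0..t, P s t) (P t t + ∫ s in 0..t, Q s t) (Ici t) t := by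
  rw [← hasDerivWithinAt_Ioi_iff_Ici, hasDerivWithinAt_iff_tendsto_slope' self_notMem_Ioi]
  have hτT : ∀ᶠ τ in 𝓝[>] t, τ < T := mem_nhdsWithin_of_mem_nhds (gt_mem_nhds htT)
  have iP : ∀ {τ : ℝ}, 0 < τ → τ < T → IntervalIntegrable (fun s => P s τ) volume 0 τ :=
    fun h0 hT => (h.singP hT.le).integrable ha ha1 le_rfl one_pos h0
  have i0t : ∀ {τ : ℝ}, t < τ → τ < T → IntervalIntegrable (fun s => P s τ) volume 0 t :=
    fun h0 hT => (iP (ht.trans h0) hT).mono_set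
      (by rw [uIcc_of_le ht.le, uIcc_of_le (ht.trans h0).le]; exact Icc_subset_Icc_right h0.le)
  have itτ : ∀ {τ : ℝ}, t < τ → τ < T → IntervalIntegrable (fun s => P s τ) volume t τ :=
    fun h0 hT => (iP (ht.trans h0) hT).mono_set
      (by rw [uIcc_of_le h0.le, uIcc_of_le (ht.trans h0).le]; exact Icc_subset_Icc_left ht.le)
  have l1 : Tendsto (fun τ => (τ - t)⁻¹ * ∫ s in t..τ, P s τ) (𝓝[>] t) (𝓝 (P t t)) := by
    refine tendsto_average (h.contP t t ht) ?_
    filter_upwards [hτT, self_mem_nhdsWithin] with τ h1 h0 using itτ h0 h1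
  have l2 : Tendsto (fun τ => ∫ s in 0..t, (τ - t)⁻¹ * (P s τ - P s t)) (𝓝[>] t)
      (𝓝 (∫ s in 0..t, Q s t)) := by
    simp only [intervalIntegral.integral_of_le ht.le, integral_Ioc_eq_integral_Ioo]
    have iK := (intervalIntegrable_sker ha ha1 hb hb1 ht).const_mul C
    rw [intervalIntegrable_iff_integrableOn_Ioo_of_le ht.le] at iK
    refine tendsto_integral_filter_of_dominated_convergence (fun s => C * sker a b s t) ?_ ?_ iK ?_
    · filter_upwards [hτT, self_mem_nhdsWithin] with τ h1 h0
      refine ContinuousOn.aestronglyMeasurable ?_ measurableSet_Ioo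
      refine continuousOn_const.mul (((h.singP h1.le).cont.mono ?_).sub (h.singP htT.le).cont)
      exact Ioo_subset_Ioo_right (le_of_lt h0)
    · filter_upwards [hτT, self_mem_nhdsWithin] with τ h1 h0
      refine (ae_restrict_iff' measurableSet_Ioo).2 (Eventually.of_forall fun s hs => ?_)
      have h0' : 0 < τ - t := sub_pos.2 h0
      have := Convex.norm_image_sub_le_of_norm_hasDerivWithin_le (f := P s) (f' := Q s)
        (s := Icc t τ) (x := t) (y := τ) (C := C * sker a b s t)
        (fun θ hθ => (h.deriv s θ hs.1 (hs.2.trans_le hθ.1)).hasDerivWithinAt)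
        (fun θ hθ => ?_) (convex_Icc t τ) (left_mem_Icc.2 (le_of_lt h0))
        (right_mem_Icc.2 (le_of_lt h0))
      · rw [norm_mul, norm_inv, Real.norm_of_nonneg h0'.le, inv_mul_le_iff₀ h0']
        rwa [Real.norm_of_nonneg h0'.le, mul_comm] at this
      · have b1 := h.boundQ s t hs.1 hs.2 htT.le
        have b2 := h.boundQ s θ hs.1 (hs.2.trans_le hθ.1) (hθ.2.trans h1.le)
        have b3 := sker_anti (p := a) hb hs.1 hs.2 hθ.1
        have b4 : 0 < sker a b s θ :=
          mul_pos (Real.rpow_pos_of_pos hs.1 _)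
            (Real.rpow_pos_of_pos (sub_pos.2 (hs.2.trans_le hθ.1)) _)
        have hC : 0 ≤ C := nonneg_of_mul_nonneg_left ((abs_nonneg _).trans b2) b4
        exact b2.trans (mul_le_mul_of_nonneg_left b3 hC)
    · refine (ae_restrict_iff' measurableSet_Ioo).2 (Eventually.of_forall fun s hs => ?_)
      have := (hasDerivWithinAt_iff_tendsto_slope' self_notMem_Ioi).1
        ((h.deriv s t hs.1 hs.2).hasDerivWithinAt (s := Ioi t))
      refine this.congr fun τ => ?_
      rw [slope_def_field, div_eq_inv_mul]
  refine (l1.add l2).congr' ?_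
  filter_upwards [hτT, self_mem_nhdsWithin] with τ h1 h0
  rw [slope_def_field, div_eq_inv_mul, intervalIntegral.integral_const_mul,
    intervalIntegral.integral_sub (i0t h0 h1) (iP ht htT),
    ← intervalIntegral.integral_add_adjacent_intervals (i0t h0 h1) (itτ h0 h1)]
  ring

theorem TimeKernel.hasDerivAt (h : TimeKernel P Q C a b T) (hC : 0 ≤ C) (ha : 0 ≤ a)
    (ha1 : a < 1) (hb : 0 ≤ b) (hb1 : b < 1) {t : ℝ} (ht : 0 < t) (htT : t < T) :
    HasDerivAt (fun t => ∫ s in 0..t, P s t) (P t t + ∫ s in 0..t, Q s t) t := by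
  set J : ℝ → ℝ := fun t => ∫ s in 0..t, P s t
  set G : ℝ → ℝ := fun t => P t t + ∫ s in 0..t, Q s t
  have cJ : ∀ τ ∈ Ioo 0 T, ContinuousAt J τ := fun τ hτ => h.continuousAt_P hC ha ha1 hτ.1 hτ.2
  have cG : ∀ τ ∈ Ioo 0 T, ContinuousAt G τ := fun τ hτ =>
    ((h.contP τ τ hτ.1).comp (f := fun s => (s, s)) (continuousAt_id.prodMk continuousAt_id)).add
      (h.continuousAt_Q hC ha ha1 hb hb1 hτ.1 hτ.2)
  obtain ⟨l, hl0, hlt⟩ := exists_between ht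
  obtain ⟨m, hm0, hmT⟩ := exists_between htT
  have hsub : Icc l m ⊆ Ioo 0 T := fun τ hτ => ⟨hl0.trans_le hτ.1, hτ.2.trans_lt hmT⟩
  have cGl : ContinuousOn G (Icc l m) := fun τ hτ => (cG τ (hsub hτ)).continuousWithinAt
  have hlm : l ≤ m := (hlt.trans hm0).le
  have key : ∀ τ ∈ Icc l m, J τ = J l + ∫ s in l..τ, G s := by
    have dI : ∀ τ ∈ Ico l m, HasDerivWithinAt (fun τ => J l + ∫ s in l..τ, G s) (G τ) (Ici τ) τ := by
      intro τ hτ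
      have hτ' : τ ∈ Icc l m := ⟨hτ.1, hτ.2.le⟩
      have ii : IntervalIntegrable G volume l τ :=
        (cGl.mono (by rw [uIcc_of_le hτ.1]; exact Icc_subset_Icc_right hτ.2.le)).intervalIntegrable
      have hm : StronglyMeasurableAtFilter G (𝓝 τ) :=
        ContinuousOn.stronglyMeasurableAtFilter isOpen_Ioo
          (fun y hy => (cG y hy).continuousWithinAt) τ (hsub hτ')
      exact ((intervalIntegral.integral_hasDerivAt_right ii hm
        (cG τ (hsub hτ'))).const_add (J l)).hasDerivWithinAt
    refine eq_of_has_deriv_right_eq (f' := G)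
      (fun τ hτ => h.hasDerivWithinAt ha ha1 hb hb1 (hsub ⟨hτ.1, hτ.2.le⟩).1
        (hsub ⟨hτ.1, hτ.2.le⟩).2) dI
      (fun τ hτ => (cJ τ (hsub hτ)).continuousWithinAt) ?_ (by simp)
    refine continuousOn_const.add ?_
    have := intervalIntegral.continuousOn_primitive_interval (μ := volume) (f := G) (a := l) (b := m)
      (by rw [uIcc_of_le hlm]; exact cGl.integrableOn_Icc)
    rwa [uIcc_of_le hlm] at this
  have ii : IntervalIntegrable G volume l t :=
    (cGl.mono (by rw [uIcc_of_le hlt.le]; exact Icc_subset_Icc_right hm0.le)).intervalIntegrable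
  have hm : StronglyMeasurableAtFilter G (𝓝 t) :=
    ContinuousOn.stronglyMeasurableAtFilter isOpen_Ioo
      (fun y hy => (cG y hy).continuousWithinAt) t ⟨ht, htT⟩
  have := (intervalIntegral.integral_hasDerivAt_right ii hm (cG t ⟨ht, htT⟩)).const_add (J l)
  refine this.congr_of_eventuallyEq ?_
  filter_upwards [Icc_mem_nhds hlt hm0] with τ hτ using key τ hτ

end TimeDerivative

end Parabolic

namespace Parabolic

open Filter Topology

section FixedPoint

variable {N : ℕ}

/-- The weight `s ^ (-1/2) * exp (Λ s)` of admissible densities. -/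
def wt (Λ s : ℝ) : ℝ := s ^ (-(1 / 2) : ℝ) * Real.exp (Λ * s)

theorem wt_pos (Λ : ℝ) {s : ℝ} (hs : 0 < s) : 0 < wt Λ s :=
  mul_pos (Real.rpow_pos_of_pos hs _) (Real.exp_pos _)

theorem continuousAt_wt (Λ : ℝ) {s : ℝ} (hs : 0 < s) : ContinuousAt (wt Λ) s :=
  (Real.continuousAt_rpow_const s _ (Or.inl hs.ne')).mul (by fun_prop)

/-- Continuous densities on positive times dominated by a multiple of the weight. -/
structure Dens (f : Euc N → ℝ → ℝ) (F Λ : ℝ) : Prop where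
  cont : ∀ x s, 0 < s → ContinuousAt (fun p : Euc N × ℝ => f p.1 p.2) (x, s)
  bdd : ∀ x s, 0 < s → |f x s| ≤ F * wt Λ s

theorem Dens.continuous {f : Euc N → ℝ → ℝ} {F Λ : ℝ} (h : Dens f F Λ) {s : ℝ} (hs : 0 < s) :
    Continuous fun y => f y s :=
  continuous_iff_continuousAt.2 fun y => (h.cont y s hs).comp (f := fun y => (y, s))
    (continuousAt_id.prodMk continuousAt_const)

theorem Dens.nonneg {f : Euc N → ℝ → ℝ} {F Λ : ℝ} (h : Dens f F Λ) : 0 ≤ F :=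
  nonneg_of_mul_nonneg_left ((abs_nonneg _).trans (h.bdd 0 1 one_pos)) (wt_pos Λ one_pos)

theorem Dens.fam {X : Type*} [TopologicalSpace X] {f : Euc N → ℝ → ℝ} {F Λ : ℝ} (h : Dens f F Λ)
    {s : X → ℝ} {ξ : X} (hs : ContinuousAt s ξ) (h0 : 0 < s ξ) :
    Fam (fun η y => f y (s η)) ξ (F * (wt Λ (s ξ) + 1)) where
  cont := by
    filter_upwards [hs.eventually (lt_mem_nhds h0)] with η hη using h.continuous hη
  bdd := by
    filter_upwards [hs.eventually (lt_mem_nhds h0),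
      ((continuousAt_wt Λ h0).comp hs).eventually (gt_mem_nhds (lt_add_one (wt Λ (s ξ))))]
      with η hη h1 y
    exact (h.bdd y _ hη).trans (mul_le_mul_of_nonneg_left (le_of_lt h1) h.nonneg)
  joint y := (h.cont y _ h0).comp (f := fun p : X × Euc N => (p.2, s p.1)) (x := (ξ, y))
    (continuousAt_snd.prodMk (hs.comp continuousAt_fst))

theorem integrableOn_rpow_mul_exp {l : ℝ} (hl : 0 < l) :
    IntegrableOn (fun r : ℝ => r ^ (-(1 / 2) : ℝ) * Real.exp (-(l * r))) (Ioi 0) ∧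
      ∫ r in Ioi 0, r ^ (-(1 / 2) : ℝ) * Real.exp (-(l * r)) = √(Real.pi / l) := by
  have h := Real.integral_rpow_mul_exp_neg_mul_Ioi (a := 1 / 2) (by norm_num) hl
  have e : (1 / 2 : ℝ) - 1 = -(1 / 2) := by norm_num
  rw [e, Real.Gamma_one_half_eq, ← Real.sqrt_eq_rpow, ← Real.sqrt_mul (by positivity)] at h
  rw [h, one_div_mul_eq_div]
  refine ⟨?_, rfl⟩
  by_contra hc
  rw [integral_undef hc] at h
  have : 0 < √(1 / l * Real.pi) := Real.sqrt_pos.2 (by positivity)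
  linarith

theorem integral_rpow_mul_exp_le {l t : ℝ} (hl : 0 < l) (ht : 0 ≤ t) :
    IntervalIntegrable (fun r : ℝ => r ^ (-(1 / 2) : ℝ) * Real.exp (-(l * r))) volume 0 t ∧
      ∫ r in 0..t, r ^ (-(1 / 2) : ℝ) * Real.exp (-(l * r)) ≤ √(Real.pi / l) := by
  obtain ⟨h1, h2⟩ := integrableOn_rpow_mul_exp hl
  rw [intervalIntegrable_iff_integrableOn_Ioc_of_le ht, intervalIntegral.integral_of_le ht, ← h2]
  refine ⟨h1.mono_set Ioc_subset_Ioi_self, setIntegral_mono_set h1 ?_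
    Ioc_subset_Ioi_self.eventuallyLE⟩
  refine (ae_restrict_iff' measurableSet_Ioi).2 (Eventually.of_forall fun r hr => ?_)
  have : (0:ℝ) ≤ r ^ (-(1 / 2) : ℝ) := Real.rpow_nonneg (le_of_lt hr) _
  simp only [Pi.zero_apply]
  positivity

theorem wt_conv_le {Λ s t : ℝ} (hΛ : 1 ≤ Λ) (hs : 0 < s) (hst : s < t) :
    wt Λ s * ((t - s) ^ (-(1 / 2) : ℝ) * Real.exp (t - s)) ≤
      wt Λ t * (2 * (s ^ (-(1 / 2) : ℝ) * Real.exp (-((Λ - 1) * s)) +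
        (t - s) ^ (-(1 / 2) : ℝ) * Real.exp (-((Λ - 1) * (t - s))))) := by
  have ht : 0 < t := hs.trans hst
  have hr : 0 < t - s := sub_pos.2 hst
  have e1 : Real.exp (Λ * s) * Real.exp (t - s)
      = Real.exp (Λ * t) * Real.exp (-((Λ - 1) * (t - s))) := by
    rw [← Real.exp_add, ← Real.exp_add]; ring_nf
  have e2 : wt Λ s * ((t - s) ^ (-(1 / 2) : ℝ) * Real.exp (t - s))
      = s ^ (-(1 / 2) : ℝ) * (t - s) ^ (-(1 / 2) : ℝ) *
        (Real.exp (Λ * t) * Real.exp (-((Λ - 1) * (t - s)))) := by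
    rw [← e1, wt]; ring
  rw [e2, wt]
  have p1 : (0:ℝ) < s ^ (-(1 / 2) : ℝ) := Real.rpow_pos_of_pos hs _
  have p2 : (0:ℝ) < (t - s) ^ (-(1 / 2) : ℝ) := Real.rpow_pos_of_pos hr _
  have p3 : (0:ℝ) < t ^ (-(1 / 2) : ℝ) := Real.rpow_pos_of_pos ht _
  rcases le_total s (t / 2) with h | h
  · have h1 : (t - s) ^ (-(1 / 2) : ℝ) ≤ 2 * t ^ (-(1 / 2) : ℝ) :=
      half_rpow_neg_le ht (by linarith) (by norm_num) (by norm_num)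
    have h2 : Real.exp (-((Λ - 1) * (t - s))) ≤ Real.exp (-((Λ - 1) * s)) := by
      refine Real.exp_le_exp.2 (neg_le_neg (mul_le_mul_of_nonneg_left ?_ ?_)) <;> linarith
    calc _ ≤ s ^ (-(1 / 2) : ℝ) * (2 * t ^ (-(1 / 2) : ℝ)) *
        (Real.exp (Λ * t) * Real.exp (-((Λ - 1) * s))) := by gcongr
      _ = t ^ (-(1 / 2) : ℝ) * Real.exp (Λ * t) *
          (2 * (s ^ (-(1 / 2) : ℝ) * Real.exp (-((Λ - 1) * s)))) := by ring
      _ ≤ _ := by gcongr; exact le_add_of_nonneg_right (by positivity)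
  · have h1 : s ^ (-(1 / 2) : ℝ) ≤ 2 * t ^ (-(1 / 2) : ℝ) :=
      half_rpow_neg_le ht h (by norm_num) (by norm_num)
    calc _ ≤ 2 * t ^ (-(1 / 2) : ℝ) * (t - s) ^ (-(1 / 2) : ℝ) *
        (Real.exp (Λ * t) * Real.exp (-((Λ - 1) * (t - s)))) := by gcongr
      _ = t ^ (-(1 / 2) : ℝ) * Real.exp (Λ * t) *
          (2 * ((t - s) ^ (-(1 / 2) : ℝ) * Real.exp (-((Λ - 1) * (t - s))))) := by ring
      _ ≤ _ := by gcongr; exact le_add_of_nonneg_left (by positivity)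

namespace Coef

variable (q : Coef N)

/-- The Volterra potential of a density. -/
def V (f : Euc N → ℝ → ℝ) (x : Euc N) (t : ℝ) : ℝ × Euc N × ℝ :=
  ∫ s in 0..t, q.Th (fun y => f y s) x s t

theorem Th_dens_continuousAt {f : Euc N → ℝ → ℝ} {F Λ : ℝ} (h : Dens f F Λ) {X : Type*}
    [TopologicalSpace X] [FirstCountableTopology X] {ξ : X} {x : X → Euc N} {s t : X → ℝ}
    (hx : ContinuousAt x ξ) (hs : ContinuousAt s ξ)
    (ht : ContinuousAt t ξ) (hs0 : 0 < s ξ) (hst : s ξ < t ξ) :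
    ContinuousAt (fun η => q.Th (fun y => f y (s η)) (x η) (s η) (t η)) ξ :=
  q.Th_cont (h.fam hs hs0) hx hs ht hst

theorem sing_Th : ∃ C, 0 ≤ C ∧ ∀ (f : Euc N → ℝ → ℝ) (F Λ : ℝ), Dens f F Λ → 1 ≤ Λ →
    ∀ x t, Sing (fun s => q.Th (fun y => f y s) x s t) (C * F * Real.exp (Λ * t)) (1 / 2) (1 / 2) t := by
  obtain ⟨C, hC, hb⟩ := q.Th_bound
  refine ⟨C, hC, fun f F Λ h hΛ x t => ⟨fun s hs => ?_, fun s hs => ?_⟩⟩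
  · exact (q.Th_dens_continuousAt h continuousAt_const continuousAt_id continuousAt_const
      hs.1 hs.2).continuousWithinAt
  · refine (hb _ _ (fun y => h.bdd y s hs.1) x s t hs.2).trans ?_
    have e : Real.exp (Λ * s) * Real.exp (t - s) ≤ Real.exp (Λ * t) := by
      rw [← Real.exp_add]
      refine Real.exp_le_exp.2 ?_
      nlinarith [sub_pos.2 hs.2]
    have := h.nonneg
    have p1 : (0:ℝ) < s ^ (-(1 / 2) : ℝ) := Real.rpow_pos_of_pos hs.1 _
    have p2 : (0:ℝ) < (t - s) ^ (-(1 / 2) : ℝ) := Real.rpow_pos_of_pos (sub_pos.2 hs.2) _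
    calc C * (F * wt Λ s) * ((t - s) ^ (-(1 / 2) : ℝ) * Real.exp (t - s))
        = C * F * (Real.exp (Λ * s) * Real.exp (t - s)) * sker (1 / 2) (1 / 2) s t := by
          unfold wt sker; ring
      _ ≤ _ := by
        gcongr
        exact sker_nonneg hs.1.le hs.2.le

theorem intervalIntegrable_Th {f : Euc N → ℝ → ℝ} {F Λ : ℝ} (h : Dens f F Λ) (hΛ : 1 ≤ Λ)
    (x : Euc N) {t : ℝ} (ht : 0 < t) :
    IntervalIntegrable (fun s => q.Th (fun y => f y s) x s t) volume 0 t := by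
  obtain ⟨C, -, hs⟩ := q.sing_Th
  exact (hs f F Λ h hΛ x t).integrable (by norm_num) (by norm_num) (by norm_num) (by norm_num) ht

theorem V_continuousAt {f : Euc N → ℝ → ℝ} {F Λ : ℝ} (h : Dens f F Λ) (hΛ : 1 ≤ Λ)
    (x : Euc N) {t : ℝ} (ht : 0 < t) :
    ContinuousAt (fun p : Euc N × ℝ => q.V f p.1 p.2) (x, t) := by
  obtain ⟨C, hC, hs⟩ := q.sing_Th
  have hF := h.nonneg
  refine continuousAt_volterra (p := 1 / 2) (q := 1 / 2) (C := C * F * Real.exp (Λ * (t + 1)))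
    (by norm_num) (by norm_num) (by norm_num) (by norm_num) (by positivity) continuousAt_snd ht ?_ ?_
  · filter_upwards [continuousAt_snd.eventually (gt_mem_nhds (lt_add_one t))] with p hp
    refine ⟨(hs f F Λ h hΛ p.1 p.2).cont, fun s hs' => ((hs f F Λ h hΛ p.1 p.2).bound s hs').trans ?_⟩
    have := sker_nonneg (p := 1 / 2) (q := 1 / 2) hs'.1.le hs'.2.le
    have : p.2 < t + 1 := hp
    gcongr
  · intro s hs'
    exact q.Th_dens_continuousAt h (X := (Euc N × ℝ) × ℝ) (x := fun p => p.1.1) (t := fun p => p.1.2)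
      (s := fun p => p.2) (by fun_prop) (by fun_prop) (by fun_prop) hs'.1 hs'.2

theorem V_sub {f g : Euc N → ℝ → ℝ} {F G Λ : ℝ} (hf : Dens f F Λ) (hg : Dens g G Λ) (hΛ : 1 ≤ Λ)
    (x : Euc N) {t : ℝ} (ht : 0 < t) :
    q.V (fun y s => f y s - g y s) x t = q.V f x t - q.V g x t := by
  unfold V
  rw [← intervalIntegral.integral_sub (q.intervalIntegrable_Th hf hΛ x ht)
    (q.intervalIntegrable_Th hg hΛ x ht), intervalIntegral.integral_of_le ht.le,
    intervalIntegral.integral_of_le ht.le]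
  refine setIntegral_congr_fun measurableSet_Ioc fun s hs => ?_
  exact q.Th_sub (hf.continuous hs.1) (hg.continuous hs.1) (fun y => hf.bdd y s hs.1)
    (fun y => hg.bdd y s hs.1) x s t

theorem V_bound : ∃ C, 0 ≤ C ∧ ∀ (f : Euc N → ℝ → ℝ) (F Λ : ℝ), Dens f F Λ → 1 < Λ →
    ∀ x t, 0 < t → ‖q.V f x t‖ ≤ C * F * wt Λ t * √(Real.pi / (Λ - 1)) := by
  obtain ⟨C, hC, hb⟩ := q.Th_bound
  refine ⟨4 * C, by positivity, fun f F Λ h hΛ x t ht => ?_⟩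
  obtain ⟨i1, b1⟩ := integral_rpow_mul_exp_le (sub_pos.2 hΛ) ht.le
  set g : ℝ → ℝ := fun r => r ^ (-(1 / 2) : ℝ) * Real.exp (-((Λ - 1) * r)) with hg
  have i2 : IntervalIntegrable (fun s => g (t - s)) volume 0 t := by
    have := (i1.symm).comp_sub_left (c := t)
    simpa using this
  have b2 : ∫ s in 0..t, g (t - s) ≤ √(Real.pi / (Λ - 1)) := by
    rw [intervalIntegral.integral_comp_sub_left g t]
    simpa using b1
  have hw := (wt_pos Λ ht).le
  have hF := h.nonneg
  have i3 : IntervalIntegrable (fun s => C * F * wt Λ t * 2 * (g s + g (t - s))) volume 0 t :=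
    (i1.add i2).const_mul _
  have h1 : ‖q.V f x t‖ ≤ ∫ s in 0..t, ‖q.Th (fun y => f y s) x s t‖ :=
    intervalIntegral.norm_integral_le_integral_norm ht.le
  refine h1.trans ((intervalIntegral.integral_mono_on_of_le_Ioo ht.le
    (q.intervalIntegrable_Th h hΛ.le x ht).norm i3 fun s hs => ?_).trans ?_)
  · refine (hb _ _ (fun y => h.bdd y s hs.1) x s t hs.2).trans ?_
    have := wt_conv_le hΛ.le hs.1 hs.2
    calc _ = C * F * (wt Λ s * ((t - s) ^ (-(1 / 2) : ℝ) * Real.exp (t - s))) := by ring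
      _ ≤ C * F * (wt Λ t * (2 * (g s + g (t - s)))) := by gcongr
      _ = _ := by ring
  · rw [intervalIntegral.integral_const_mul, intervalIntegral.integral_add i1 i2]
    calc _ ≤ C * F * wt Λ t * 2 * (√(Real.pi / (Λ - 1)) + √(Real.pi / (Λ - 1))) := by gcongr
      _ = _ := by ring

end Coef

end FixedPoint

end Parabolic

namespace Parabolic

open Filter Topology
open scoped BoundedContinuousFunction

section Banach

variable {N : ℕ}

/-- The density attached to a bounded continuous function in logarithmic time. -/
def dn (Λ : ℝ) (φ : Euc N × ℝ →ᵇ ℝ) (y : Euc N) (s : ℝ) : ℝ := φ (y, Real.log s) * wt Λ s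

theorem dn_dens (Λ : ℝ) (φ : Euc N × ℝ →ᵇ ℝ) : Dens (dn Λ φ) ‖φ‖ Λ where
  cont x s hs := by
    refine ContinuousAt.mul ?_ ((continuousAt_wt Λ hs).comp
      (f := fun p : Euc N × ℝ => p.2) (x := (x, s)) continuousAt_snd)
    exact φ.continuous.continuousAt.comp (f := fun p : Euc N × ℝ => (p.1, Real.log p.2))
      (continuousAt_fst.prodMk ((Real.continuousAt_log hs.ne').comp
        (f := fun p : Euc N × ℝ => p.2) (x := (x, s)) continuousAt_snd))
  bdd x s hs := by
    rw [dn, abs_mul, abs_of_pos (wt_pos Λ hs)]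
    exact mul_le_mul_of_nonneg_right (φ.norm_coe_le_norm _) (wt_pos Λ hs).le

theorem one_le_wt {Λ t : ℝ} (hΛ : 1 ≤ Λ) (ht : 0 < t) : 1 ≤ wt Λ t := by
  have hl : 0 < √t := Real.sqrt_pos.2 ht
  have e0 : √t ≤ Real.exp t := by
    have := Real.add_one_le_exp t
    nlinarith [Real.sq_sqrt ht.le, sq_nonneg (√t - 1)]
  have e1 : Real.exp t ≤ Real.exp (Λ * t) := Real.exp_le_exp.2 (by nlinarith)
  rw [wt, ← inv_sqrt ht, inv_mul_eq_div, one_le_div hl]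
  exact e0.trans e1

theorem wt_mono {Λ Λ' t : ℝ} (h : Λ ≤ Λ') (ht : 0 < t) : wt Λ t ≤ wt Λ' t :=
  mul_le_mul_of_nonneg_left (Real.exp_le_exp.2 (mul_le_mul_of_nonneg_right h ht.le))
    (Real.rpow_nonneg ht.le _)

/-- A nonlinearity which is continuous, Lipschitz in the unknown and bounded at zero. -/
structure Nonlin (Hh : ℝ × Euc N × ℝ → Euc N → ℝ → ℝ) (K : ℝ) : Prop where
  nonneg : 0 ≤ K
  cont : Continuous fun p : (ℝ × Euc N × ℝ) × Euc N × ℝ => Hh p.1 p.2.1 p.2.2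
  lip : ∀ w w' x t, |Hh w x t - Hh w' x t| ≤ K * ‖w - w'‖
  zero : ∀ x t, |Hh 0 x t| ≤ K

theorem Nonlin.growth {Hh : ℝ × Euc N × ℝ → Euc N → ℝ → ℝ} {K : ℝ} (h : Nonlin Hh K)
    (w : ℝ × Euc N × ℝ) (x : Euc N) (t : ℝ) : |Hh w x t| ≤ K + K * ‖w‖ := by
  have h1 := h.lip w 0 x t
  have h2 := h.zero x t
  rw [sub_zero] at h1
  calc |Hh w x t| = |Hh 0 x t + (Hh w x t - Hh 0 x t)| := by ring_nf
    _ ≤ |Hh 0 x t| + |Hh w x t - Hh 0 x t| := abs_add_le _ _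
    _ ≤ _ := by gcongr

namespace Coef

variable (q : Coef N)

/-- The pointwise right-hand side of the fixed point equation. -/
def rhs (Hh : ℝ × Euc N × ℝ → Euc N → ℝ → ℝ) (β : Euc N → ℝ) (f : Euc N → ℝ → ℝ) (x : Euc N)
    (t : ℝ) : ℝ :=
  Hh (q.Th β x 0 t + q.V f x t) x t

theorem rhs_continuousAt {Hh : ℝ × Euc N × ℝ → Euc N → ℝ → ℝ} {K : ℝ} (hH : Nonlin Hh K)
    {β : Euc N → ℝ} (hβ : Continuous β) {B : ℝ} (hB : ∀ y, |β y| ≤ B) {f : Euc N → ℝ → ℝ}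
    {F Λ : ℝ} (hf : Dens f F Λ) (hΛ : 1 ≤ Λ) (x : Euc N) {t : ℝ} (ht : 0 < t) :
    ContinuousAt (fun p : Euc N × ℝ => q.rhs Hh β f p.1 p.2) (x, t) := by
  refine hH.cont.continuousAt.comp
    (f := fun p : Euc N × ℝ => (q.Th β p.1 0 p.2 + q.V f p.1 p.2, p.1, p.2)) ?_
  refine ContinuousAt.prodMk ?_ continuousAt_id
  exact (q.Th_cont (Fam.const hβ hB (x, t)) continuousAt_fst continuousAt_const continuousAt_snd
    ht).add (q.V_continuousAt hf hΛ x ht)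

theorem rhs_bound : ∃ C, 0 ≤ C ∧ ∀ {Hh : ℝ × Euc N × ℝ → Euc N → ℝ → ℝ} {K : ℝ}, Nonlin Hh K →
    ∀ {β : Euc N → ℝ} {B : ℝ}, (∀ y, |β y| ≤ B) → ∀ {f : Euc N → ℝ → ℝ} {F Λ : ℝ}, Dens f F Λ →
    1 < Λ → ∀ x t, 0 < t →
    |q.rhs Hh β f x t| ≤ (K + K * (C * B + C * F * √(Real.pi / (Λ - 1)))) * wt Λ t := by
  obtain ⟨C, hC, hb⟩ := q.Th_bound
  obtain ⟨C', hC', hb'⟩ := q.V_bound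
  refine ⟨C + C', by positivity, fun {Hh K} hH β B hB f F Λ hf hΛ x t ht => ?_⟩
  have hK := hH.nonneg
  have hB0 : 0 ≤ B := (abs_nonneg _).trans (hB 0)
  have hF := hf.nonneg
  have h1 : ‖q.Th β x 0 t‖ ≤ (C + C') * B * wt Λ t := by
    refine (hb β B hB x 0 t ht).trans ?_
    have : wt 1 t ≤ wt Λ t := wt_mono hΛ.le ht
    have e : (t - 0) ^ (-(1 / 2) : ℝ) * Real.exp (t - 0) = wt 1 t := by
      rw [wt, sub_zero, one_mul]
    rw [e]
    have := (wt_pos 1 ht).le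
    gcongr
    linarith
  have h2 : ‖q.V f x t‖ ≤ (C + C') * F * √(Real.pi / (Λ - 1)) * wt Λ t := by
    refine (hb' f F Λ hf hΛ x t ht).trans ?_
    rw [mul_right_comm]
    have := wt_pos Λ ht
    gcongr
    linarith
  have h3 := one_le_wt hΛ.le ht
  calc |q.rhs Hh β f x t| ≤ K + K * ‖q.Th β x 0 t + q.V f x t‖ := hH.growth _ _ _
    _ ≤ K * wt Λ t + K * ((C + C') * B * wt Λ t + (C + C') * F * √(Real.pi / (Λ - 1)) * wt Λ t) := by
      gcongr
      · exact le_mul_of_one_le_right hK h3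
      · exact (norm_add_le _ _).trans (add_le_add h1 h2)
    _ = _ := by ring

theorem exists_density {Hh : ℝ × Euc N × ℝ → Euc N → ℝ → ℝ} {K : ℝ} (hH : Nonlin Hh K)
    {β : Euc N → ℝ} (hβ : Continuous β) {B : ℝ} (hB : ∀ y, |β y| ≤ B) :
    ∃ (f : Euc N → ℝ → ℝ) (F Λ : ℝ), Dens f F Λ ∧ 1 ≤ Λ ∧
      ∀ x t, 0 < t → f x t = Hh (q.Th β x 0 t + q.V f x t) x t := by
  obtain ⟨C, hC, hb⟩ := q.V_bound
  obtain ⟨C', hC', hb'⟩ := q.rhs_bound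
  have hK := hH.nonneg
  set D : ℝ := 2 * K * C + 1 with hD
  have hD0 : 0 < D := by positivity
  set Λ : ℝ := 1 + Real.pi * D ^ 2 with hΛd
  have hΛ : 1 < Λ := by
    have : 0 < Real.pi * D ^ 2 := by positivity
    linarith
  have hsq : √(Real.pi / (Λ - 1)) = 1 / D := by
    rw [hΛd, add_sub_cancel_left, div_mul_cancel_left₀ Real.pi_ne_zero, ← one_div,
      Real.sqrt_div zero_le_one, Real.sqrt_one, Real.sqrt_sq hD0.le]
  have bdd : ∀ (φ : Euc N × ℝ →ᵇ ℝ) (p : Euc N × ℝ),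
      ‖(wt Λ (Real.exp p.2))⁻¹ * q.rhs Hh β (dn Λ φ) p.1 (Real.exp p.2)‖ ≤
        K + K * (C' * B + C' * ‖φ‖ * √(Real.pi / (Λ - 1))) := fun φ p => by
    have h0 := wt_pos Λ (Real.exp_pos p.2)
    rw [norm_mul, norm_inv, Real.norm_of_nonneg h0.le, inv_mul_le_iff₀ h0, mul_comm (wt _ _)]
    exact hb' hH hB (dn_dens Λ φ) hΛ _ _ (Real.exp_pos _)
  have cont : ∀ φ : Euc N × ℝ →ᵇ ℝ, Continuous fun p : Euc N × ℝ =>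
      (wt Λ (Real.exp p.2))⁻¹ * q.rhs Hh β (dn Λ φ) p.1 (Real.exp p.2) := fun φ => by
    refine continuous_iff_continuousAt.2 fun p => ?_
    refine ContinuousAt.mul (ContinuousAt.inv₀ ?_ (wt_pos Λ (Real.exp_pos p.2)).ne') ?_
    · exact (continuousAt_wt Λ (Real.exp_pos p.2)).comp (f := fun p : Euc N × ℝ => Real.exp p.2)
        (by fun_prop)
    · exact (q.rhs_continuousAt hH hβ hB (dn_dens Λ φ) hΛ.le p.1 (Real.exp_pos p.2)).comp
        (f := fun p : Euc N × ℝ => (p.1, Real.exp p.2)) (by fun_prop)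
  let S : (Euc N × ℝ →ᵇ ℝ) → (Euc N × ℝ →ᵇ ℝ) := fun φ =>
    BoundedContinuousFunction.ofNormedAddCommGroup _ (cont φ) _ (bdd φ)
  have hS : ContractingWith (1 / 2) S := by
    refine ⟨by norm_num, LipschitzWith.of_dist_le_mul fun φ ψ => ?_⟩
    have hrhs : ((1 / 2 : NNReal) : ℝ) * dist φ ψ = 1 / 2 * ‖φ - ψ‖ := by
      rw [dist_eq_norm]; simp
    rw [hrhs, BoundedContinuousFunction.dist_le (by positivity)]
    intro p
    have ht := Real.exp_pos p.2
    set t := Real.exp p.2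
    have h0 := wt_pos Λ ht
    change dist ((wt Λ t)⁻¹ * q.rhs Hh β (dn Λ φ) p.1 t)
      ((wt Λ t)⁻¹ * q.rhs Hh β (dn Λ ψ) p.1 t) ≤ _
    rw [Real.dist_eq, ← mul_sub, abs_mul, abs_inv, abs_of_pos h0, inv_mul_le_iff₀ h0]
    have e := q.V_sub (dn_dens Λ φ) (dn_dens Λ ψ) hΛ.le p.1 ht
    have e' : (fun y s => dn Λ φ y s - dn Λ ψ y s) = dn Λ (φ - ψ) := by
      funext y s
      simp only [dn, BoundedContinuousFunction.coe_sub, Pi.sub_apply, sub_mul]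
    rw [e'] at e
    refine (hH.lip _ _ _ _).trans ?_
    rw [add_sub_add_left_eq_sub, ← e]
    have hv := hb _ _ _ (dn_dens Λ (φ - ψ)) hΛ p.1 t ht
    rw [hsq] at hv
    have hn := norm_nonneg (φ - ψ)
    have hkc : K * (C * (1 / D)) ≤ 1 / 2 := by
      rw [mul_one_div, ← mul_div_assoc, div_le_div_iff₀ hD0 two_pos]
      linarith
    calc K * ‖q.V (dn Λ (φ - ψ)) p.1 t‖ ≤ K * (C * ‖φ - ψ‖ * wt Λ t * (1 / D)) := by gcongr
      _ = wt Λ t * ((K * (C * (1 / D))) * ‖φ - ψ‖) := by ring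
      _ ≤ wt Λ t * (1 / 2 * ‖φ - ψ‖) := by gcongr
  have fix := hS.fixedPoint_isFixedPt
  set φ := hS.fixedPoint S
  refine ⟨dn Λ φ, ‖φ‖, Λ, dn_dens Λ φ, hΛ.le, fun x t ht => ?_⟩
  have h1 : S φ (x, Real.log t) = φ (x, Real.log t) := by rw [fix]
  have h2 : S φ (x, Real.log t) = (wt Λ t)⁻¹ * q.rhs Hh β (dn Λ φ) x t := by
    change (wt Λ (Real.exp (Real.log t)))⁻¹ * q.rhs Hh β (dn Λ φ) x (Real.exp (Real.log t)) = _
    rw [Real.exp_log ht]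
  rw [dn, ← h1, h2, mul_comm, mul_inv_cancel_left₀ (wt_pos Λ ht).ne']
  rfl

end Coef

end Banach

end Parabolic

namespace Parabolic

open Filter Topology
open scoped RealInnerProductSpace

section Regularity

variable {N : ℕ}

theorem Sing.fst {W W' : Type*} [NormedAddCommGroup W] [NormedAddCommGroup W'] {Φ : ℝ → W × W'}
    {C p q t : ℝ} (h : Sing Φ C p q t) : Sing (fun s => (Φ s).1) C p q t :=
  ⟨continuous_fst.comp_continuousOn h.cont, fun s hs => (norm_fst_le _).trans (h.bound s hs)⟩

theorem Sing.snd {W W' : Type*} [NormedAddCommGroup W] [NormedAddCommGroup W'] {Φ : ℝ → W × W'}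
    {C p q t : ℝ} (h : Sing Φ C p q t) : Sing (fun s => (Φ s).2) C p q t :=
  ⟨continuous_snd.comp_continuousOn h.cont, fun s hs => (norm_snd_le _).trans (h.bound s hs)⟩

theorem rpow_neg_le_rpow_neg {t T p p' : ℝ} (ht : 0 < t) (htT : t ≤ T) (hp : p ≤ p') :
    t ^ (-p) ≤ T ^ (p' - p) * t ^ (-p') := by
  have e : t ^ (-p) = t ^ (p' - p) * t ^ (-p') := by rw [← Real.rpow_add ht]; ring_nf
  rw [e]
  gcongr

namespace Coef

variable (q : Coef N)

theorem Th_holder : ∃ C, 0 ≤ C ∧ ∀ (φ : Euc N → ℝ) (F : ℝ), Continuous φ → (∀ y, |φ y| ≤ F) →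
    ∀ x x' s t, s < t → ‖(q.Th φ x s t).2 - (q.Th φ x' s t).2‖ ≤
      C * F * (t - s) ^ (-(3 / 4) : ℝ) * ‖x - x'‖ ^ (1 / 2 : ℝ) := by
  obtain ⟨C1, h1, b1⟩ := q.P1_holder
  obtain ⟨C2, h2, b2⟩ := q.Kk_holder
  refine ⟨max C1 C2, le_max_of_le_left h1, fun φ F hφ hF x x' s t hst => ?_⟩
  have hF0 : 0 ≤ F := (abs_nonneg _).trans (hF 0)
  have p1 : (0:ℝ) ≤ (t - s) ^ (-(3 / 4) : ℝ) := Real.rpow_nonneg (sub_pos.2 hst).le _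
  refine max_le ((b1 φ F hφ hF x x' s t hst).trans ?_) ((b2 φ F hφ hF x x' s t hst).trans ?_)
  · gcongr; exact le_max_left _ _
  · gcongr; exact le_max_right _ _

end Coef

/-- The data of the Cauchy problem together with a density solving the fixed point equation. -/
structure Setup (q : Coef N) (h : Euc N → ℝ → Euc N → ℝ → ℝ) (β : Euc N → ℝ)
    (f : Euc N → ℝ → ℝ) (B Q K F Λ T : ℝ) : Prop where
  T_pos : 0 < T
  Q_nonneg : 0 ≤ Q
  K_nonneg : 0 ≤ K
  β_cont : Continuous β
  β_bdd : ∀ y, |β y| ≤ B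
  β_lip : ∀ x y, |β x - β y| ≤ Q * ‖x - y‖
  h_cont : Continuous fun z : Euc N × ℝ × Euc N × ℝ => h z.1 z.2.1 z.2.2.1 z.2.2.2
  h_lip : ∀ p p' v v' x t, |h p v x t - h p' v' x t| ≤ K * (|v - v'| + ‖p - p'‖)
  h_holder : ∀ R, ∃ C α : ℝ, 0 ≤ C ∧ 0 < α ∧ ∀ p v x x' t, ‖p‖ ≤ R → |v| ≤ R → ‖x‖ ≤ R → ‖x'‖ ≤ R →
    |h p v x t - h p v x' t| ≤ C * ‖x - x'‖ ^ α
  dens : Dens f F Λ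
  Λ_ge : 1 ≤ Λ
  eqn : ∀ x t, 0 < t → f x t = (q.Th β x 0 t + q.V f x t).2.2 +
    h (q.Th β x 0 t + q.V f x t).2.1 (q.Th β x 0 t + q.V f x t).1 x t

namespace Setup

variable {q : Coef N} {h : Euc N → ℝ → Euc N → ℝ → ℝ} {β : Euc N → ℝ} {f : Euc N → ℝ → ℝ}
  {B Q K F Λ T : ℝ}

theorem f_bdd (S : Setup q h β f B Q K F Λ T) {s : ℝ} (hs : 0 < s) (hsT : s ≤ T) (y : Euc N) :
    |f y s| ≤ F * Real.exp (Λ * T) * s ^ (-(1 / 2) : ℝ) := by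
  refine (S.dens.bdd y s hs).trans ?_
  have := S.dens.nonneg
  have := S.Λ_ge
  have p1 : (0:ℝ) ≤ s ^ (-(1 / 2) : ℝ) := Real.rpow_nonneg hs.le _
  calc F * wt Λ s = F * Real.exp (Λ * s) * s ^ (-(1 / 2) : ℝ) := by unfold wt; ring
    _ ≤ _ := by gcongr

theorem V_fst (S : Setup q h β f B Q K F Λ T) (x : Euc N) {t : ℝ} (ht : 0 < t) :
    (q.V f x t).1 = ∫ s in 0..t, q.P (fun y => f y s) x s t :=
  ((ContinuousLinearMap.fst ℝ ℝ (Euc N × ℝ)).intervalIntegral_comp_comm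
    (q.intervalIntegrable_Th S.dens S.Λ_ge x ht)).symm

theorem V_snd (S : Setup q h β f B Q K F Λ T) (x : Euc N) {t : ℝ} (ht : 0 < t) :
    (q.V f x t).2 = ∫ s in 0..t, (q.Th (fun y => f y s) x s t).2 :=
  ((ContinuousLinearMap.snd ℝ ℝ (Euc N × ℝ)).intervalIntegral_comp_comm
    (q.intervalIntegrable_Th S.dens S.Λ_ge x ht)).symm

theorem V_snd_fst (S : Setup q h β f B Q K F Λ T) (x : Euc N) {t : ℝ} (ht : 0 < t) :
    (q.V f x t).2.1 = ∫ s in 0..t, q.P1 (fun y => f y s) x s t :=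
  (((ContinuousLinearMap.fst ℝ (Euc N) ℝ).comp
    (ContinuousLinearMap.snd ℝ ℝ (Euc N × ℝ))).intervalIntegral_comp_comm
    (q.intervalIntegrable_Th S.dens S.Λ_ge x ht)).symm

theorem V_snd_snd (S : Setup q h β f B Q K F Λ T) (x : Euc N) {t : ℝ} (ht : 0 < t) :
    (q.V f x t).2.2 = ∫ s in 0..t, q.Kk (fun y => f y s) x s t :=
  (((ContinuousLinearMap.snd ℝ (Euc N) ℝ).comp
    (ContinuousLinearMap.snd ℝ ℝ (Euc N × ℝ))).intervalIntegral_comp_comm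
    (q.intervalIntegrable_Th S.dens S.Λ_ge x ht)).symm

theorem V_bdd (S : Setup q h β f B Q K F Λ T) :
    ∃ C, 0 ≤ C ∧ ∀ x t, 0 < t → t ≤ T → ‖q.V f x t‖ ≤ C := by
  obtain ⟨C, hC, hs⟩ := q.sing_Th
  have hF := S.dens.nonneg
  have hΛ := S.Λ_ge
  refine ⟨C * F * Real.exp (Λ * T) * 8, by positivity, fun x t ht htT => ?_⟩
  refine ((hs f F Λ S.dens S.Λ_ge x t).norm_integral_le (by positivity) (by norm_num)
    (by norm_num) (by norm_num) (by norm_num) ht).trans ?_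
  have e : (1 - 1 / 2 - 1 / 2 : ℝ) = 0 := by norm_num
  rw [e, Real.rpow_zero]
  have : (2 * (1 / (1 - 1 / 2) + 1 / (1 - 1 / 2)) * 1 : ℝ) = 8 := by norm_num
  rw [this]
  gcongr

theorem bdd (S : Setup q h β f B Q K F Λ T) : ∃ C, 0 ≤ C ∧ ∀ x t, 0 < t → t ≤ T →
    |(q.Th β x 0 t + q.V f x t).1| ≤ C ∧ ‖(q.Th β x 0 t + q.V f x t).2.1‖ ≤ C := by
  obtain ⟨C, hC, hV⟩ := S.V_bdd
  obtain ⟨C0, hC0, h0⟩ := q.P_bound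
  obtain ⟨C1, hC1, h1⟩ := q.P1_lip_bound
  have hB : 0 ≤ B := (abs_nonneg _).trans (S.β_bdd 0)
  have hQ := S.Q_nonneg
  refine ⟨C + C0 * B + C1 * (Q + B), by positivity, fun x t ht htT => ⟨?_, ?_⟩⟩
  · have a1 := h0 β B S.β_bdd x 0 t
    have a2 : |(q.V f x t).1| ≤ C := (norm_fst_le _).trans (hV x t ht htT)
    have : 0 ≤ C1 * (Q + B) := by positivity
    have a3 := abs_add_le (q.P β x 0 t) (q.V f x t).1
    change |q.P β x 0 t + (q.V f x t).1| ≤ _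
    linarith
  · have a1 := h1 β B Q S.β_cont S.β_bdd hQ S.β_lip x 0 t ht
    have a2 : ‖(q.V f x t).2.1‖ ≤ C :=
      (norm_fst_le _).trans ((norm_snd_le _).trans (hV x t ht htT))
    have : 0 ≤ C0 * B := by positivity
    have a3 := norm_add_le (q.P1 β x 0 t) (q.V f x t).2.1
    change ‖q.P1 β x 0 t + (q.V f x t).2.1‖ ≤ _
    linarith

theorem hasFDerivAt_fst (S : Setup q h β f B Q K F Λ T) (x : Euc N) {t : ℝ} (ht : 0 < t) :
    HasFDerivAt (fun y => (q.Th β y 0 t + q.V f y t).1)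
      (innerSL ℝ (q.Th β x 0 t + q.V f x t).2.1) x := by
  obtain ⟨C, hC, hs⟩ := q.sing_Th
  have hsi := fun y => hs f F Λ S.dens S.Λ_ge y t
  have hΦ' : ∀ y, Sing (fun s => innerSL ℝ (q.P1 (fun y => f y s) y s t))
      (C * F * Real.exp (Λ * t)) (1 / 2) (1 / 2) t := fun y => by
    refine ⟨(innerSL ℝ).continuous.comp_continuousOn (hsi y).snd.fst.cont, fun s hs => ?_⟩
    rw [innerSL_apply_norm]
    exact (hsi y).snd.fst.bound s hs
  have hd := hasFDerivAt_volterra (x := x) one_pos ht (by norm_num) (by norm_num) (by norm_num)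
    (by norm_num) (by norm_num) (by norm_num) (by norm_num) (by norm_num)
    (fun y => (hsi y).fst) (fun y _ => hΦ' y) (fun y s hs =>
      q.P_hasFDerivAt (S.dens.continuous hs.1) (fun y => S.dens.bdd y s hs.1) y hs.2)
  have hI : ∫ s in 0..t, innerSL ℝ (q.P1 (fun y => f y s) x s t)
      = innerSL ℝ (q.V f x t).2.1 := by
    rw [S.V_snd_fst x ht]
    ext v
    have i1 := (hΦ' x).integrable (by norm_num) (by norm_num) (by norm_num) (by norm_num) ht
    have i2 := (hsi x).snd.fst.integrable (by norm_num) (by norm_num) (by norm_num) (by norm_num) ht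
    rw [ContinuousLinearMap.intervalIntegral_apply i1]
    simp only [innerSL_apply_apply]
    rw [real_inner_comm, intervalIntegral.integral_of_le ht.le, intervalIntegral.integral_of_le ht.le,
      ← integral_inner (f := fun s => q.P1 (fun y => f y s) x s t)
        ((intervalIntegrable_iff_integrableOn_Ioc_of_le ht.le).1 i2)]
    simp only [real_inner_comm]
  rw [hI] at hd
  have := (q.P_hasFDerivAt S.β_cont S.β_bdd x ht).add hd
  have e : (fun y => (q.Th β y 0 t + q.V f y t).1) = fun y =>
      q.P β y 0 t + ∫ s in 0..t, (q.Th (fun y => f y s) y s t).1 := by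
    funext y
    rw [Prod.fst_add, S.V_fst y ht]
    rfl
  rw [e]
  refine this.congr_fderiv ?_
  rw [← map_add]
  rfl

theorem snd_holder (S : Setup q h β f B Q K F Λ T) : ∃ C, 0 ≤ C ∧ ∀ x x' t, 0 < t → t ≤ T →
    ‖(q.Th β x 0 t + q.V f x t).2 - (q.Th β x' 0 t + q.V f x' t).2‖ ≤
      C * t ^ (-(3 / 4) : ℝ) * ‖x - x'‖ ^ (1 / 2 : ℝ) := by
  obtain ⟨C, hC, hb⟩ := q.Th_holder
  obtain ⟨C', -, hs⟩ := q.sing_Th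
  have hB : 0 ≤ B := (abs_nonneg _).trans (S.β_bdd 0)
  have hF := S.dens.nonneg
  have hT := S.T_pos
  refine ⟨C * B + C * (F * Real.exp (Λ * T)) * (12 * T ^ ((3 / 4 : ℝ) - 1 / 4)), by positivity,
    fun x x' t ht htT => ?_⟩
  have hd : (0:ℝ) ≤ ‖x - x'‖ ^ (1 / 2 : ℝ) := by positivity
  have hsi := fun y => hs f F Λ S.dens S.Λ_ge y t
  have hS : Sing (fun s => (q.Th (fun y => f y s) x s t).2 - (q.Th (fun y => f y s) x' s t).2)
      (C * (F * Real.exp (Λ * T)) * ‖x - x'‖ ^ (1 / 2 : ℝ)) (1 / 2) (3 / 4) t := by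
    refine ⟨(hsi x).snd.cont.sub (hsi x').snd.cont, fun s hs => ?_⟩
    refine (hb _ _ (S.dens.continuous hs.1) (S.f_bdd hs.1 (hs.2.le.trans htT)) x x' s t
      hs.2).trans_eq ?_
    unfold sker
    ring
  have hI := hS.norm_integral_le (by positivity) (by norm_num) (by norm_num) (by norm_num)
    (by norm_num) ht
  have i := fun y => (hsi y).snd.integrable (by norm_num) (by norm_num) (by norm_num)
    (by norm_num) ht
  rw [intervalIntegral.integral_sub (i x) (i x'), ← S.V_snd x ht, ← S.V_snd x' ht] at hI
  have e : (1 - 1 / 2 - 3 / 4 : ℝ) = -(1 / 4) := by norm_num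
  have e2 : (2 * (1 / (1 - 1 / 2) + 1 / (1 - 3 / 4)) : ℝ) = 12 := by norm_num
  rw [e, e2] at hI
  have e3 : t ^ (-(1 / 4) : ℝ) ≤ T ^ ((3 / 4 : ℝ) - 1 / 4) * t ^ (-(3 / 4) : ℝ) :=
    rpow_neg_le_rpow_neg ht htT (by norm_num)
  have hβ := hb β B S.β_cont S.β_bdd x x' 0 t ht
  rw [sub_zero] at hβ
  calc _ = ‖((q.Th β x 0 t).2 - (q.Th β x' 0 t).2) + ((q.V f x t).2 - (q.V f x' t).2)‖ := by
        rw [Prod.snd_add, Prod.snd_add]; congr 1; abel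
    _ ≤ _ := norm_add_le _ _
    _ ≤ _ := add_le_add hβ hI
    _ ≤ C * B * t ^ (-(3 / 4) : ℝ) * ‖x - x'‖ ^ (1 / 2 : ℝ) +
        C * (F * Real.exp (Λ * T)) * ‖x - x'‖ ^ (1 / 2 : ℝ) *
          (12 * (T ^ ((3 / 4 : ℝ) - 1 / 4) * t ^ (-(3 / 4) : ℝ))) := by gcongr
    _ = _ := by ring

theorem f_holder (S : Setup q h β f B Q K F Λ T)
    (R : ℝ) : ∃ C α : ℝ, 0 ≤ C ∧ 0 < α ∧ α ≤ 1 ∧ ∀ x x' t, ‖x‖ ≤ R → 0 < t → t ≤ T →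
    |f x' t - f x t| ≤ C * t ^ (-(3 / 4) : ℝ) * ‖x - x'‖ ^ α := by
  obtain ⟨M, hM, hb⟩ := S.bdd
  obtain ⟨C1, hC1, h1⟩ := S.snd_holder
  obtain ⟨C2, α, hC2, hα, h2⟩ := S.h_holder (max M (R + 1))
  have hT := S.T_pos
  have hK := S.K_nonneg
  have hF := S.dens.nonneg
  set γ := min (1 / 2) α with hγ
  have hγ0 : 0 < γ := lt_min (by norm_num) hα
  have hγ1 : γ ≤ 1 := (min_le_left _ _).trans (by norm_num)
  set T' := T ^ (3 / 4 : ℝ) with hT'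
  have hT'0 : 0 ≤ T' := by positivity
  refine ⟨2 * (F * Real.exp (Λ * T)) * T ^ ((3 / 4 : ℝ) - 1 / 2) + (C1 + C2 * T' +
    K * (M * T' + C1)), γ, by positivity, hγ0, hγ1, fun x x' t hx ht htT => ?_⟩
  have pt : (0:ℝ) ≤ t ^ (-(3 / 4) : ℝ) := by positivity
  have ptT : 1 ≤ T' * t ^ (-(3 / 4) : ℝ) := by
    have := rpow_neg_le_rpow_neg (p := 0) (p' := 3 / 4) ht htT (by norm_num)
    simpa using this
  rcases le_total 1 ‖x - x'‖ with hd | hd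
  · have e1 : 1 ≤ ‖x - x'‖ ^ γ := Real.one_le_rpow hd hγ0.le
    have e2 : t ^ (-(1 / 2) : ℝ) ≤ T ^ ((3 / 4 : ℝ) - 1 / 2) * t ^ (-(3 / 4) : ℝ) :=
      rpow_neg_le_rpow_neg ht htT (by norm_num)
    have b1 := S.f_bdd ht htT x
    have b2 := S.f_bdd ht htT x'
    calc |f x' t - f x t| ≤ |f x' t| + |f x t| := abs_sub _ _
      _ ≤ 2 * (F * Real.exp (Λ * T)) * t ^ (-(1 / 2) : ℝ) := by linarith
      _ ≤ 2 * (F * Real.exp (Λ * T)) * (T ^ ((3 / 4 : ℝ) - 1 / 2) * t ^ (-(3 / 4) : ℝ)) := by gcongr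
      _ = 2 * (F * Real.exp (Λ * T)) * T ^ ((3 / 4 : ℝ) - 1 / 2) * t ^ (-(3 / 4) : ℝ) * 1 := by ring
      _ ≤ _ := by
        gcongr
        exact le_add_of_nonneg_right (by positivity)
  · have hn := norm_nonneg (x - x')
    have hx' : ‖x'‖ ≤ R + 1 := by
      have := norm_sub_le x (x - x')
      rw [sub_sub_cancel] at this
      linarith
    have pw : ∀ {δ : ℝ}, γ ≤ δ → ‖x - x'‖ ^ δ ≤ ‖x - x'‖ ^ γ := fun hδ => by
      rcases hn.eq_or_lt with h0 | h0
      · rw [← h0, Real.zero_rpow hγ0.ne', Real.zero_rpow (hγ0.trans_le hδ).ne']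
      · exact Real.rpow_le_rpow_of_exponent_ge h0 hd hδ
    set w := q.Th β x 0 t + q.V f x t with hw
    set w' := q.Th β x' 0 t + q.V f x' t with hw'
    have bx := hb x t ht htT
    have bx' := hb x' t ht htT
    have d1 := h1 x x' t ht htT
    have d2 : ‖w.2 - w'.2‖ ≤ C1 * t ^ (-(3 / 4) : ℝ) * ‖x - x'‖ ^ γ :=
      d1.trans (mul_le_mul_of_nonneg_left (pw (min_le_left _ _)) (by positivity))
    have d3 : ‖w.2.1 - w'.2.1‖ ≤ C1 * t ^ (-(3 / 4) : ℝ) * ‖x - x'‖ ^ γ :=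
      (norm_fst_le (w.2 - w'.2)).trans d2
    have d4 : |w.2.2 - w'.2.2| ≤ C1 * t ^ (-(3 / 4) : ℝ) * ‖x - x'‖ ^ γ :=
      (norm_snd_le (w.2 - w'.2)).trans d2
    have d5 : |w.1 - w'.1| ≤ M * T' * t ^ (-(3 / 4) : ℝ) * ‖x - x'‖ ^ γ := by
      have := Convex.norm_image_sub_le_of_norm_hasFDerivWithin_le
        (fun y _ => (S.hasFDerivAt_fst y ht).hasFDerivWithinAt) (C := M)
        (fun y _ => by rw [innerSL_apply_norm]; exact (hb y t ht htT).2) convex_univ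
        (mem_univ x') (mem_univ x)
      refine this.trans ?_
      have h3 : ‖x - x'‖ ≤ ‖x - x'‖ ^ γ := by simpa using pw hγ1
      calc M * ‖x - x'‖ ≤ M * (T' * t ^ (-(3 / 4) : ℝ)) * ‖x - x'‖ ^ γ := by
            gcongr
            exact le_mul_of_one_le_right hM ptT
        _ = _ := by ring
    have d6 : |h w.2.1 w.1 x t - h w.2.1 w.1 x' t| ≤
        C2 * T' * t ^ (-(3 / 4) : ℝ) * ‖x - x'‖ ^ γ := by
      refine (h2 _ _ x x' t (bx.2.trans (le_max_left _ _)) (bx.1.trans (le_max_left _ _))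
        (le_max_of_le_right (by linarith)) (le_max_of_le_right hx')).trans ?_
      calc C2 * ‖x - x'‖ ^ α ≤ C2 * (T' * t ^ (-(3 / 4) : ℝ)) * ‖x - x'‖ ^ γ := by
            exact mul_le_mul (le_mul_of_one_le_right hC2 ptT) (pw (min_le_right _ _))
              (by positivity) (by positivity)
        _ = _ := by ring
    have d7 := S.h_lip w.2.1 w'.2.1 w.1 w'.1 x' t
    have e := S.eqn x t ht
    have e' := S.eqn x' t ht
    rw [← hw] at e
    rw [← hw'] at e'
    have tot : |f x t - f x' t| ≤ |w.2.2 - w'.2.2| + |h w.2.1 w.1 x t - h w.2.1 w.1 x' t| +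
        |h w.2.1 w.1 x' t - h w'.2.1 w'.1 x' t| := by
      rw [e, e']
      refine le_trans (le_of_eq ?_) (abs_add_three _ _ _)
      congr 1
      ring
    rw [abs_sub_comm]
    have hnn : (0:ℝ) ≤ ‖x - x'‖ ^ γ := by positivity
    have d8 : |h w.2.1 w.1 x' t - h w'.2.1 w'.1 x' t| ≤
        K * (M * T' * t ^ (-(3 / 4) : ℝ) * ‖x - x'‖ ^ γ + C1 * t ^ (-(3 / 4) : ℝ) * ‖x - x'‖ ^ γ) :=
      d7.trans (by gcongr)
    calc |f x t - f x' t| ≤ (C1 + C2 * T' + K * (M * T' + C1)) * t ^ (-(3 / 4) : ℝ) *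
          ‖x - x'‖ ^ γ := by linarith
      _ ≤ _ := mul_le_mul_of_nonneg_right (mul_le_mul_of_nonneg_right
        (le_add_of_nonneg_left (by positivity)) pt) hnn

end Setup

end Regularity

end Parabolic

namespace Parabolic

open Filter Topology
open scoped RealInnerProductSpace

section Classical

variable {N : ℕ}

theorem continuousAt_trL {X : Type*} [TopologicalSpace X] {ξ : X}
    {m : X → Matrix (Fin N) (Fin N) ℝ} {D : X → Opr N}
    (hm : ∀ i j, ContinuousAt (fun η => m η i j) ξ) (hD : ContinuousAt D ξ) :
    ContinuousAt (fun η => trL (m η) (D η)) ξ := by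
  simp only [trL_apply]
  refine tendsto_finsetSum _ fun i _ => tendsto_finsetSum _ fun j _ => (hm i j).mul ?_
  have h1 : ContinuousAt (fun η => D η (EuclideanSpace.single j 1)) ξ :=
    hD.clm_apply continuousAt_const
  exact (EuclideanSpace.proj i : Euc N →L[ℝ] ℝ).continuous.continuousAt.comp h1

theorem Coef.exists_abs_trL_le (q : Coef N) :
    ∃ C, 0 ≤ C ∧ ∀ x t (D : Opr N), |trL (q.a x t) D| ≤ C * ‖D‖ := by
  have hM := q.M_nonneg
  refine ⟨∑ i : Fin N, ∑ j : Fin N, q.M, by positivity, fun x t D => ?_⟩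
  rw [trL_apply, Finset.sum_mul]
  refine (Finset.abs_sum_le_sum_abs _ _).trans (Finset.sum_le_sum fun i _ => ?_)
  rw [Finset.sum_mul]
  refine (Finset.abs_sum_le_sum_abs _ _).trans (Finset.sum_le_sum fun j _ => ?_)
  rw [abs_mul]
  have h1 : |(D (EuclideanSpace.single j 1)) i| ≤ ‖D‖ := by
    refine (PiLp.norm_apply_le (D (EuclideanSpace.single j 1)) i).trans ?_
    simpa using D.le_opNorm (EuclideanSpace.single j 1)
  exact mul_le_mul (q.bdd x t i j) h1 (abs_nonneg _) hM

namespace Setup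

variable {q : Coef N} {h : Euc N → ℝ → Euc N → ℝ → ℝ} {β : Euc N → ℝ} {f : Euc N → ℝ → ℝ}
  {B Q K F Λ T : ℝ}

theorem P2_continuousAt (S : Setup q h β f B Q K F Λ T)
    {X : Type*} [TopologicalSpace X] [FirstCountableTopology X] {ξ : X}
    {x : X → Euc N} {s t : X → ℝ} (hx : ContinuousAt x ξ) (hs : ContinuousAt s ξ)
    (ht : ContinuousAt t ξ) (hs0 : 0 < s ξ) (hst : s ξ < t ξ) :
    ContinuousAt (fun η => q.P2 (fun y => f y (s η)) (x η) (s η) (t η)) ξ :=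
  q.P2_cont (S.dens.fam hs hs0) hx hs ht hst

theorem sing_P2 (S : Setup q h β f B Q K F Λ T)
    (R : ℝ) : ∃ C b, 0 ≤ C ∧ 0 ≤ b ∧ b < 1 ∧ ∀ x t, ‖x‖ ≤ R → t ≤ T →
    Sing (fun s => q.P2 (fun y => f y s) x s t) C (3 / 4) b t := by
  obtain ⟨C0, hC0, h0⟩ := q.P2_bound
  obtain ⟨C1, γ, hC1, hγ, hγ1, h1⟩ := S.f_holder R
  have hF := S.dens.nonneg
  have hT := S.T_pos
  set F1 := F * Real.exp (Λ * T) with hF1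
  have hF1' : 0 ≤ F1 := by positivity
  refine ⟨C0 * (C1 + F1 * T ^ ((3 / 4 : ℝ) - 1 / 2) * T ^ (1 / 2 - γ / 2)), 1 - γ / 2,
    by positivity, by linarith, by linarith, fun x t hx htT => ⟨fun s hs => ?_, fun s hs => ?_⟩⟩
  · exact (S.P2_continuousAt continuousAt_const continuousAt_id continuousAt_const
      hs.1 hs.2).continuousWithinAt
  · have hsT : s ≤ T := hs.2.le.trans htT
    have hr : 0 < t - s := sub_pos.2 hs.2
    have hrT : t - s ≤ T := by linarith [hs.1]
    have hs0 := hs.1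
    have ps : (0:ℝ) < s ^ (-(3 / 4) : ℝ) := Real.rpow_pos_of_pos hs0 _
    refine (h0 (fun y => f y s) (F1 * s ^ (-(1 / 2) : ℝ)) (C1 * s ^ (-(3 / 4) : ℝ)) γ x
      (S.dens.continuous hs0) (S.f_bdd hs0 hsT) (by positivity) hγ.le hγ1
      (fun y => h1 x y s hx hs0 hsT) s t hs.2).trans ?_
    have e1 : (√(t - s)) ^ γ = (t - s) ^ (γ / 2) := by
      rw [Real.sqrt_eq_rpow, ← Real.rpow_mul hr.le]; ring_nf
    have e2 : √(t - s) ≤ T ^ (1 / 2 - γ / 2) * (t - s) ^ (γ / 2) := by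
      have e : √(t - s) = (t - s) ^ (1 / 2 - γ / 2) * (t - s) ^ (γ / 2) := by
        rw [Real.sqrt_eq_rpow, ← Real.rpow_add hr]; ring_nf
      rw [e]
      gcongr
      linarith
    have e3 : (t - s)⁻¹ * (t - s) ^ (γ / 2) = (t - s) ^ (-(1 - γ / 2)) := by
      rw [← Real.rpow_neg_one, ← Real.rpow_add hr]; ring_nf
    have e4 : s ^ (-(1 / 2) : ℝ) ≤ T ^ ((3 / 4 : ℝ) - 1 / 2) * s ^ (-(3 / 4) : ℝ) :=
      rpow_neg_le_rpow_neg hs0 hsT (by norm_num)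
    rw [e1]
    calc _ ≤ C0 * (t - s)⁻¹ * (C1 * s ^ (-(3 / 4) : ℝ) * (t - s) ^ (γ / 2) +
          F1 * (T ^ ((3 / 4 : ℝ) - 1 / 2) * s ^ (-(3 / 4) : ℝ)) *
            (T ^ (1 / 2 - γ / 2) * (t - s) ^ (γ / 2))) := by gcongr
      _ = C0 * (C1 + F1 * T ^ ((3 / 4 : ℝ) - 1 / 2) * T ^ (1 / 2 - γ / 2)) *
          (s ^ (-(3 / 4) : ℝ) * ((t - s)⁻¹ * (t - s) ^ (γ / 2))) := by ring
      _ = _ := by rw [e3]; rfl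

theorem hasFDerivAt_snd (S : Setup q h β f B Q K F Λ T)
    (x : Euc N) {t : ℝ} (ht : 0 < t) (htT : t ≤ T) :
    HasFDerivAt (fun y => (q.Th β y 0 t + q.V f y t).2.1)
      (q.P2 β x 0 t + ∫ s in 0..t, q.P2 (fun y => f y s) x s t) x := by
  obtain ⟨C, hC, hs⟩ := q.sing_Th
  obtain ⟨C2, b, hC2, hb, hb1, h2⟩ := S.sing_P2 (‖x‖ + 1)
  have hsi := fun y => hs f F Λ S.dens S.Λ_ge y t
  have hd := hasFDerivAt_volterra (x := x) one_pos ht (by norm_num) (by norm_num) (by norm_num)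
    (by norm_num) (by norm_num) (by norm_num) hb hb1
    (fun y => (hsi y).snd.fst) (fun y hy => h2 y t (by
      have h3 := norm_sub_norm_le y x
      have h4 := mem_ball_iff_norm.1 hy
      linarith) htT) (fun y s hs =>
      q.P1_hasFDerivAt (S.dens.continuous hs.1) (fun y => S.dens.bdd y s hs.1) y hs.2)
  have := (q.P1_hasFDerivAt S.β_cont S.β_bdd x ht).add hd
  have e : (fun y => (q.Th β y 0 t + q.V f y t).2.1) = fun y =>
      q.P1 β y 0 t + ∫ s in 0..t, (q.Th (fun y => f y s) y s t).2.1 := by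
    funext y
    rw [Prod.snd_add, Prod.fst_add, S.V_snd_fst y ht]
    rfl
  rw [e]
  exact this

theorem hess_continuousAt (S : Setup q h β f B Q K F Λ T)
    (x : Euc N) {t : ℝ} (ht : 0 < t) (htT : t < T) :
    ContinuousAt (fun p : Euc N × ℝ => q.P2 β p.1 0 p.2 +
      ∫ s in 0..p.2, q.P2 (fun y => f y s) p.1 s p.2) (x, t) := by
  obtain ⟨C, b, hC, hb, hb1, h2⟩ := S.sing_P2 (‖x‖ + 1)
  refine ContinuousAt.add (q.P2_cont (Fam.const S.β_cont S.β_bdd (x, t)) continuousAt_fst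
    continuousAt_const continuousAt_snd ht) ?_
  refine continuousAt_volterra (Φ := fun (p : Euc N × ℝ) s => q.P2 (fun y => f y s) p.1 s p.2)
    (by norm_num) (by norm_num : (3 / 4 : ℝ) < 1) hb hb1 hC continuousAt_snd ht ?_ ?_
  · filter_upwards [continuousAt_snd.eventually (gt_mem_nhds htT),
      continuousAt_fst.norm.eventually (gt_mem_nhds (lt_add_one ‖x‖))] with p hp hp'
    exact h2 p.1 p.2 (le_of_lt hp') (le_of_lt hp)
  · intro s hs
    exact S.P2_continuousAt (X := (Euc N × ℝ) × ℝ) (x := fun p => p.1.1) (t := fun p => p.1.2)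
      (s := fun p => p.2) (by fun_prop) (by fun_prop) (by fun_prop) hs.1 hs.2

theorem exists_timeKernel (S : Setup q h β f B Q K F Λ T)
    (x : Euc N) : ∃ C b, 0 ≤ C ∧ 0 ≤ b ∧ b < 1 ∧
    TimeKernel (fun s t => q.P (fun y => f y s) x s t)
      (fun s t => 1 / 2 * trL (q.a x t) (q.P2 (fun y => f y s) x s t) -
        q.Kk (fun y => f y s) x s t) C (3 / 4) b T := by
  obtain ⟨C0, hC0, h0⟩ := q.P_bound
  obtain ⟨C1, hC1, h1⟩ := q.Kk_bound
  obtain ⟨C2, b, hC2, hb, hb1, h2⟩ := S.sing_P2 ‖x‖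
  obtain ⟨C3, hC3, h3⟩ := q.exists_abs_trL_le
  have hF := S.dens.nonneg
  have hT := S.T_pos
  set F1 := F * Real.exp (Λ * T) with hF1
  have hF1' : 0 ≤ F1 := by positivity
  set b' := max b (1 / 2) with hb'
  set D := F1 * T ^ ((3 / 4 : ℝ) - 1 / 2) with hD
  have hD0 : 0 ≤ D := by positivity
  have fb : ∀ s, 0 < s → s ≤ T → ∀ y, |f y s| ≤ D * s ^ (-(3 / 4) : ℝ) := fun s hs hsT y => by
    refine (S.f_bdd hs hsT y).trans ?_
    have e4 : s ^ (-(1 / 2) : ℝ) ≤ T ^ ((3 / 4 : ℝ) - 1 / 2) * s ^ (-(3 / 4) : ℝ) :=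
      rpow_neg_le_rpow_neg hs hsT (by norm_num)
    rw [hD, mul_assoc F1]
    exact mul_le_mul_of_nonneg_left e4 hF1'
  have cP : 0 ≤ C0 * D + C3 * C2 * T ^ (b' - b) + C1 * D * T ^ (b' - 1 / 2) := by positivity
  refine ⟨_, b', cP, le_max_of_le_left hb, max_lt hb1 (by norm_num), ?_⟩
  refine ⟨fun s t hs => ?_, fun s t hs hst => ?_, fun s t hs hst htT => ?_,
    fun s t hs hst htT => ?_, fun s t hs hst => ?_⟩
  · exact q.P_cont (X := ℝ × ℝ) (S.dens.fam continuousAt_fst hs) continuousAt_const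
      continuousAt_fst continuousAt_snd
  · refine ContinuousAt.sub (continuousAt_const.mul (continuousAt_trL (fun i j => ?_) ?_)) ?_
    · exact ((q.cont i j).comp (f := fun z : ℝ × ℝ => (x, z.2))
        (continuous_const.prodMk continuous_snd)).continuousAt
    · exact S.P2_continuousAt (X := ℝ × ℝ) continuousAt_const continuousAt_fst continuousAt_snd hs hst
    · exact q.Kk_cont (X := ℝ × ℝ) (S.dens.fam continuousAt_fst hs) continuousAt_const
        continuousAt_fst continuousAt_snd hst
  · have p1 : (0:ℝ) ≤ s ^ (-(3 / 4) : ℝ) := Real.rpow_nonneg hs.le _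
    have e : sker (3 / 4) 0 s t = s ^ (-(3 / 4) : ℝ) := by simp [sker]
    rw [e]
    refine (h0 _ _ (fb s hs (hst.le.trans htT)) x s t).trans ?_
    rw [← mul_assoc]
    gcongr
    rw [add_assoc]
    exact le_add_of_nonneg_right (by positivity)
  · have hr : 0 < t - s := sub_pos.2 hst
    have hrT : t - s ≤ T := by linarith
    have p1 : (0:ℝ) ≤ s ^ (-(3 / 4) : ℝ) := Real.rpow_nonneg hs.le _
    have p2 : (0:ℝ) ≤ (t - s) ^ (-b') := Real.rpow_nonneg hr.le _
    have a1 := h3 x t (q.P2 (fun y => f y s) x s t)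
    have a2 := (h2 x t le_rfl htT).bound s ⟨hs, hst⟩
    have a3 := h1 _ _ (fb s hs (hst.le.trans htT)) x s t hst
    rw [inv_sqrt hr] at a3
    have a4 : (t - s) ^ (-b) ≤ T ^ (b' - b) * (t - s) ^ (-b') :=
      rpow_neg_le_rpow_neg hr hrT (le_max_left _ _)
    have a5 : (t - s) ^ (-(1 / 2) : ℝ) ≤ T ^ (b' - 1 / 2) * (t - s) ^ (-b') :=
      rpow_neg_le_rpow_neg hr hrT (le_max_right _ _)
    have a6 : |trL (q.a x t) (q.P2 (fun y => f y s) x s t)| ≤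
        C3 * (C2 * (s ^ (-(3 / 4) : ℝ) * (T ^ (b' - b) * (t - s) ^ (-b')))) := by
      refine a1.trans (mul_le_mul_of_nonneg_left (a2.trans ?_) hC3)
      unfold sker
      gcongr
    have a7 : |q.Kk (fun y => f y s) x s t| ≤
        C1 * (D * s ^ (-(3 / 4) : ℝ)) * (T ^ (b' - 1 / 2) * (t - s) ^ (-b')) :=
      a3.trans (by gcongr)
    have a8 := abs_sub (1 / 2 * trL (q.a x t) (q.P2 (fun y => f y s) x s t))
      (q.Kk (fun y => f y s) x s t)
    rw [abs_mul, abs_of_pos (by norm_num : (0:ℝ) < 1 / 2)] at a8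
    have a9 := abs_nonneg (trL (q.a x t) (q.P2 (fun y => f y s) x s t))
    have a10 : 0 ≤ C0 * D * (s ^ (-(3 / 4) : ℝ) * (t - s) ^ (-b')) := by positivity
    unfold sker
    calc _ ≤ C3 * (C2 * (s ^ (-(3 / 4) : ℝ) * (T ^ (b' - b) * (t - s) ^ (-b')))) +
          C1 * (D * s ^ (-(3 / 4) : ℝ)) * (T ^ (b' - 1 / 2) * (t - s) ^ (-b')) := by linarith
      _ ≤ _ := by linarith
  · exact q.P_hasDerivAt_time (S.dens.continuous hs) (fun y => S.dens.bdd y s hs) x hst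

theorem hasDerivAt_time (S : Setup q h β f B Q K F Λ T)
    (x : Euc N) {t : ℝ} (ht : 0 < t) (htT : t < T) :
    HasDerivAt (fun t => q.P β x 0 t + ∫ s in 0..t, q.P (fun y => f y s) x s t)
      (1 / 2 * trL (q.a x t) (q.P2 β x 0 t + ∫ s in 0..t, q.P2 (fun y => f y s) x s t) +
        h (q.Th β x 0 t + q.V f x t).2.1 (q.Th β x 0 t + q.V f x t).1 x t) t := by
  obtain ⟨C, b, hC, hb, hb1, hk⟩ := S.exists_timeKernel x
  obtain ⟨C2, b2, hC2, hb2, hb21, h2⟩ := S.sing_P2 ‖x‖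
  obtain ⟨C3, hC3, h3⟩ := q.sing_Th
  have i2 := (h2 x t le_rfl htT.le).integrable (by norm_num) (by norm_num) hb2 hb21 ht
  have i3 := (h3 f F Λ S.dens S.Λ_ge x t).snd.snd.integrable (by norm_num) (by norm_num)
    (by norm_num) (by norm_num) ht
  have i4 : IntervalIntegrable (fun s => trL (q.a x t) (q.P2 (fun y => f y s) x s t)) volume 0 t :=
    ⟨(trL (q.a x t)).integrable_comp i2.1, (trL (q.a x t)).integrable_comp i2.2⟩
  have hd := (q.P_hasDerivAt_time S.β_cont S.β_bdd x ht).add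
    (hk.hasDerivAt hC (by norm_num) (by norm_num) hb hb1 ht htT)
  refine hd.congr_deriv ?_
  have e : ∫ s in 0..t, (1 / 2 * trL (q.a x t) (q.P2 (fun y => f y s) x s t) -
        q.Kk (fun y => f y s) x s t) =
      1 / 2 * trL (q.a x t) (∫ s in 0..t, q.P2 (fun y => f y s) x s t) - (q.V f x t).2.2 := by
    rw [S.V_snd_snd x ht, ← (trL (q.a x t)).intervalIntegral_comp_comm i2,
      ← intervalIntegral.integral_const_mul]
    exact intervalIntegral.integral_sub (i4.const_mul _) i3
  have e2 : (q.Th β x 0 t + q.V f x t).2.2 = q.Kk β x 0 t + (q.V f x t).2.2 := rfl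
  rw [e, q.P_self, S.eqn x t ht, e2, map_add]
  ring

theorem continuousWithinAt_zero (S : Setup q h β f B Q K F Λ T) (x : Euc N) :
    ContinuousWithinAt (fun p : Euc N × ℝ => q.P β p.1 0 p.2 +
      ∫ s in 0..p.2, q.P (fun y => f y s) p.1 s p.2) (univ ×ˢ Icc 0 T) (x, 0) := by
  refine ContinuousWithinAt.add (q.P_cont (Fam.const S.β_cont S.β_bdd (x, 0)) continuousAt_fst
    continuousAt_const continuousAt_snd).continuousWithinAt ?_
  obtain ⟨C0, hC0, h0⟩ := q.P_bound
  have hF := S.dens.nonneg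
  set F1 := F * Real.exp (Λ * T) with hF1
  have hF1' : 0 ≤ F1 := by positivity
  have hb : ∀ p ∈ (univ : Set (Euc N)) ×ˢ Icc 0 T,
      ‖∫ s in 0..p.2, q.P (fun y => f y s) p.1 s p.2‖ ≤ C0 * F1 * 6 * √p.2 := by
    rintro ⟨y, t⟩ ⟨-, ht0, htT⟩
    dsimp only at ht0 htT ⊢
    rcases ht0.eq_or_lt with rfl | ht
    · simp
    have hs : Sing (fun s => q.P (fun y => f y s) y s t) (C0 * F1) (1 / 2) 0 t := by
      refine ⟨fun s hs => ?_, fun s hs => ?_⟩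
      · exact (q.P_cont (S.dens.fam continuousAt_id hs.1) continuousAt_const
          continuousAt_id continuousAt_const).continuousWithinAt
      · refine (h0 _ _ (S.f_bdd hs.1 (hs.2.le.trans htT)) y s t).trans_eq ?_
        simp only [sker, neg_zero, Real.rpow_zero]
        ring
    refine (hs.norm_integral_le (by positivity) (by norm_num) (by norm_num) le_rfl one_pos
      ht).trans_eq ?_
    rw [Real.sqrt_eq_rpow]
    norm_num
    ring
  rw [ContinuousWithinAt]
  simp only [intervalIntegral.integral_same]
  refine squeeze_zero_norm' (a := fun p : Euc N × ℝ => C0 * F1 * 6 * √p.2) ?_ ?_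
  · filter_upwards [self_mem_nhdsWithin] with p hp using hb p hp
  · have : ContinuousAt (fun p : Euc N × ℝ => C0 * F1 * 6 * √p.2) (x, 0) := by fun_prop
    have h1 := this.tendsto
    simp only [Real.sqrt_zero, mul_zero] at h1
    exact h1.mono_left nhdsWithin_le_nhds

end Setup

end Classical

end Parabolic

namespace Parabolic

open Filter Topology
open scoped RealInnerProductSpace

variable {N : ℕ}

section TimeReversal

variable {q : Coef N} {h : Euc N → ℝ → Euc N → ℝ → ℝ} {β : Euc N → ℝ} {f : Euc N → ℝ → ℝ}
  {B Q K F Λ T' : ℝ}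

theorem Setup.jet_continuousAt (S : Setup q h β f B Q K F Λ T') (x : Euc N) {t : ℝ}
    (ht : 0 < t) :
    ContinuousAt (fun p : Euc N × ℝ => q.Th β p.1 0 p.2 + q.V f p.1 p.2) (x, t) :=
  (q.Th_cont (Fam.const S.β_cont S.β_bdd (x, t)) continuousAt_fst continuousAt_const
    continuousAt_snd ht).add (q.V_continuousAt S.dens S.Λ_ge x ht)

/-- Reversing time in the solution of the initial value problem. -/
theorem Setup.exists_isClassicalSolution (S : Setup q h β f B Q K F Λ T') {T : ℝ} (hT : 0 < T)
    (hTT : T < T') {a : Euc N → ℝ → Matrix (Fin N) (Fin N) ℝ} {H : Euc N → ℝ → Euc N → ℝ → ℝ}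
    (ha : ∀ x t, t ∈ Icc 0 T → q.a x (T - t) = a x t)
    (hH : ∀ p v x t, t ∈ Icc 0 T → h p v x (T - t) = H p v x t) :
    ∃ (u : Euc N → ℝ → ℝ) (Du : Euc N → ℝ → Euc N)
      (D2u : Euc N → ℝ → (Euc N →L[ℝ] Euc N)) (ut : Euc N → ℝ → ℝ),
      IsClassicalSolution N T a H β u Du D2u ut ∧
      ∃ C, (∀ x t, t ∈ Icc (0:ℝ) T → |u x t| ≤ C) ∧
           (∀ x t, t ∈ Ico (0:ℝ) T → ‖Du x t‖ ≤ C) := by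
  set u₀ : Euc N → ℝ → ℝ := fun x t => q.P β x 0 t + ∫ s in 0..t, q.P (fun y => f y s) x s t
    with hu₀
  set w : Euc N → ℝ → ℝ × Euc N × ℝ := fun x t => q.Th β x 0 t + q.V f x t with hw
  set A : Euc N → ℝ → Opr N := fun x t =>
    q.P2 β x 0 t + ∫ s in 0..t, q.P2 (fun y => f y s) x s t with hA
  set D : Euc N → ℝ → ℝ := fun x t => 1 / 2 * trL (q.a x t) (A x t) +
    h (w x t).2.1 (w x t).1 x t with hD
  have uw : ∀ x t, 0 < t → u₀ x t = (w x t).1 := fun x t ht => by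
    rw [hw, hu₀]
    simp only [Prod.fst_add]
    rw [S.V_fst x ht]
    rfl
  have u0 : ∀ x, u₀ x 0 = β x := fun x => by simp [hu₀, q.P_self]
  have cw : ∀ x t, 0 < t → ContinuousAt (fun p : Euc N × ℝ => w p.1 p.2) (x, t) :=
    fun x t ht => S.jet_continuousAt x ht
  have cA : ∀ x t, 0 < t → t ≤ T → ContinuousAt (fun p : Euc N × ℝ => A p.1 p.2) (x, t) :=
    fun x t ht htT => S.hess_continuousAt x ht (htT.trans_lt hTT)
  have cD : ∀ x t, 0 < t → t ≤ T → ContinuousAt (fun p : Euc N × ℝ => D p.1 p.2) (x, t) := by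
    intro x t ht htT
    refine (continuousAt_const.mul (continuousAt_trL (fun i j => (q.cont i j).continuousAt)
      (cA x t ht htT))).add ?_
    exact S.h_cont.continuousAt.comp (x := (x, t))
      (f := fun p : Euc N × ℝ => ((w p.1 p.2).2.1, (w p.1 p.2).1, p.1, p.2))
      ((cw x t ht).snd.fst.prodMk ((cw x t ht).fst.prodMk
        (continuousAt_fst.prodMk continuousAt_snd)))
  have cu : ContinuousOn (fun p : Euc N × ℝ => u₀ p.1 p.2) (univ ×ˢ Icc 0 T) := by
    rintro ⟨x, t⟩ ⟨-, ht0, htT⟩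
    dsimp only at ht0 htT
    rcases ht0.eq_or_lt with rfl | ht
    · exact (S.continuousWithinAt_zero x).mono (prod_mono_right (Icc_subset_Icc_right hTT.le))
    · refine ((cw x t ht).fst.congr ?_).continuousWithinAt
      filter_upwards [continuousAt_snd.eventually (lt_mem_nhds ht)] with p hp
      exact (uw p.1 p.2 hp).symm
  have cr : Continuous fun p : Euc N × ℝ => (p.1, T - p.2) := by fun_prop
  have hrev : ∀ t, t ∈ Ico 0 T → 0 < T - t ∧ T - t ≤ T := fun t ht =>
    ⟨sub_pos.2 ht.2, sub_le_self _ ht.1⟩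
  obtain ⟨C, hC, hb⟩ := S.bdd
  refine ⟨fun x t => u₀ x (T - t), fun x t => (w x (T - t)).2.1, fun x t => A x (T - t),
    fun x t => - D x (T - t), ⟨?_, ?_, ?_, ?_, ?_, ?_, ?_, ?_, ?_⟩, max B C, ?_, ?_⟩
  · refine ContinuousOn.comp (g := fun p : Euc N × ℝ => u₀ p.1 p.2)
      (f := fun p : Euc N × ℝ => (p.1, T - p.2)) cu cr.continuousOn fun p hp => ⟨mem_univ _, ?_⟩
    have h1 := hp.2.1
    have h2 := hp.2.2
    exact ⟨sub_nonneg.2 h2, sub_le_self _ h1⟩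
  · intro x t ht
    have h1 := S.hasFDerivAt_fst x (hrev t ht).1
    have e : (fun y => u₀ y (T - t)) = fun y => (w y (T - t)).1 :=
      funext fun y => uw y _ (hrev t ht).1
    rw [e, hasGradientAt_iff_hasFDerivAt]
    refine h1.congr_fderiv ?_
    ext y
    simp [hw]
  · intro x t ht
    exact S.hasFDerivAt_snd x (hrev t ht).1 ((hrev t ht).2.trans hTT.le)
  · intro x t ht
    have h1 := S.hasDerivAt_time x (hrev t ht).1 ((hrev t ht).2.trans_lt hTT)
    have h2 := h1.comp_const_sub T t
    exact h2.hasDerivWithinAt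
  · rintro ⟨x, t⟩ ⟨-, ht⟩
    exact ((cw x (T - t) (hrev t ht).1).comp (x := (x, t))
      (f := fun p : Euc N × ℝ => (p.1, T - p.2)) cr.continuousAt).snd.fst.continuousWithinAt
  · rintro ⟨x, t⟩ ⟨-, ht⟩
    exact ((cA x (T - t) (hrev t ht).1 (hrev t ht).2).comp (x := (x, t))
      (f := fun p : Euc N × ℝ => (p.1, T - p.2)) cr.continuousAt).continuousWithinAt
  · rintro ⟨x, t⟩ ⟨-, ht⟩
    exact ((cD x (T - t) (hrev t ht).1 (hrev t ht).2).comp (x := (x, t))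
      (f := fun p : Euc N × ℝ => (p.1, T - p.2)) cr.continuousAt).neg.continuousWithinAt
  · intro x t ht
    have ht' : t ∈ Icc 0 T := ⟨ht.1, ht.2.le⟩
    have e : D x (T - t) = 1 / 2 * trL (a x t) (A x (T - t)) +
        H (w x (T - t)).2.1 (w x (T - t)).1 x t := by
      rw [← ha x t ht', ← hH _ _ _ t ht']
    dsimp only
    rw [e, uw x _ (hrev t ht).1, trL_apply]
    ring
  · intro x
    dsimp only
    rw [sub_self, u0]
  · intro x t ht
    dsimp only
    rcases ht.2.eq_or_lt with rfl | h1
    · rw [sub_self, u0]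
      exact (S.β_bdd x).trans (le_max_left _ _)
    · have h2 := hrev t ⟨ht.1, h1⟩
      rw [uw x _ h2.1]
      exact (hb x _ h2.1 (h2.2.trans hTT.le)).1.trans (le_max_right _ _)
  · intro x t ht
    have h2 := hrev t ht
    exact (hb x _ h2.1 (h2.2.trans hTT.le)).2.trans (le_max_right _ _)

end TimeReversal

section Data

/-- Time reversal on `[0, T]`, extended to the real line by constants. -/
def clampRev (T t : ℝ) : ℝ := max 0 (min (T - t) T)

theorem clampRev_mem {T : ℝ} (hT : 0 < T) (t : ℝ) : clampRev T t ∈ Icc 0 T :=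
  ⟨le_max_left _ _, max_le hT.le (min_le_right _ _)⟩

theorem clampRev_sub {T t : ℝ} (ht : t ∈ Icc 0 T) : clampRev T (T - t) = t := by
  rw [clampRev, sub_sub_cancel, min_eq_left ht.2, max_eq_right ht.1]

theorem continuous_clampRev (T : ℝ) : Continuous (clampRev T) := by
  unfold clampRev
  fun_prop

theorem continuousAt_of_abs_sub_le {X : Type*} [TopologicalSpace X] {g b : X → ℝ} {ξ : X}
    (h : ∀ᶠ y in 𝓝 ξ, |g y - g ξ| ≤ b y) (hb : Tendsto b (𝓝 ξ) (𝓝 0)) : ContinuousAt g ξ := by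
  rw [ContinuousAt, tendsto_iff_norm_sub_tendsto_zero]
  exact squeeze_zero' (Eventually.of_forall fun _ => norm_nonneg _) h hb

theorem exists_coef {T : ℝ} (hT : 0 < T) {σ : Euc N → ℝ → Matrix (Fin N) (Fin N) ℝ}
    (hbdd : ∃ M, ∀ x t, t ∈ Icc (0:ℝ) T → ∀ i j, |σ x t i j| ≤ M)
    (hloc : ∀ R : ℝ, ∃ L, ∀ (x x' : Euc N) (t t' : ℝ),
        ‖x‖ ≤ R → ‖x'‖ ≤ R → t ∈ Icc (0:ℝ) T → t' ∈ Icc (0:ℝ) T →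
        ∀ i j, |σ x t i j - σ x' t' i j| ≤ L * (‖x - x'‖ + |t - t'|))
    (hlip : ∃ L, ∀ (x x' : Euc N) (t : ℝ), t ∈ Icc (0:ℝ) T →
        ∀ i j, |σ x t i j - σ x' t i j| ≤ L * ‖x - x'‖)
    {μ : ℝ} (hμ : 0 < μ)
    (hell : ∀ x t, t ∈ Icc (0:ℝ) T → ∀ ξ : Fin N → ℝ,
        μ * ∑ i, ξ i ^ 2 ≤ ∑ i, ∑ j, (σ x t * (σ x t)ᵀ) i j * ξ i * ξ j) :
    ∃ q : Coef N, ∀ x t, q.a x t = σ x (clampRev T t) * (σ x (clampRev T t))ᵀ := by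
  obtain ⟨M, hM⟩ := hbdd
  obtain ⟨L, hL⟩ := hlip
  have hc := clampRev_mem hT
  have hM' : ∀ x t i j, |σ x (clampRev T t) i j| ≤ |M| := fun x t i j =>
    (hM x _ (hc t) i j).trans (le_abs_self _)
  have hL' : ∀ x x' t i j, |σ x (clampRev T t) i j - σ x' (clampRev T t) i j| ≤
      |L| * ‖x - x'‖ := fun x x' t i j =>
    (hL x x' _ (hc t) i j).trans (mul_le_mul_of_nonneg_right (le_abs_self _) (norm_nonneg _))
  have e : ∀ x t i j, (σ x t * (σ x t)ᵀ) i j = ∑ k, σ x t i k * σ x t j k :=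
    fun x t i j => by simp [Matrix.mul_apply]
  have cσ : ∀ i j, Continuous fun p : Euc N × ℝ => σ p.1 (clampRev T p.2) i j := by
    intro i j
    refine continuous_iff_continuousAt.2 fun ξ => ?_
    obtain ⟨L', hL'⟩ := hloc (‖ξ.1‖ + 1)
    refine continuousAt_of_abs_sub_le
      (b := fun p => L' * (‖p.1 - ξ.1‖ + |clampRev T p.2 - clampRev T ξ.2|)) ?_ ?_
    · filter_upwards [continuousAt_fst.norm.eventually (gt_mem_nhds (lt_add_one ‖ξ.1‖))] with p hp
      exact hL' _ _ _ _ (le_of_lt hp) (by linarith) (hc _) (hc _) i j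
    · have h1 := continuous_clampRev T
      have h2 : Continuous fun p : Euc N × ℝ =>
          L' * (‖p.1 - ξ.1‖ + |clampRev T p.2 - clampRev T ξ.2|) := by fun_prop
      simpa using h2.tendsto ξ
  refine ⟨⟨fun x t => σ x (clampRev T t) * (σ x (clampRev T t))ᵀ, ∑ _k : Fin N, |M| * |M|,
    ∑ _k : Fin N, 2 * |M| * |L|, μ, by positivity, by positivity, hμ, fun i j => ?_,
    fun x t i j => ?_, fun x x' t i j => ?_, fun x t i j => ?_, fun x t ξ => ?_⟩, fun _ _ => rfl⟩
  · simp only [e]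
    exact continuous_finsetSum _ fun k _ => (cσ i k).mul (cσ j k)
  · rw [e]
    refine (Finset.abs_sum_le_sum_abs _ _).trans (Finset.sum_le_sum fun k _ => ?_)
    rw [abs_mul]
    exact mul_le_mul (hM' _ _ _ _) (hM' _ _ _ _) (abs_nonneg _) (abs_nonneg _)
  · rw [e, e, ← Finset.sum_sub_distrib, Finset.sum_mul]
    refine (Finset.abs_sum_le_sum_abs _ _).trans (Finset.sum_le_sum fun k _ => ?_)
    set r := clampRev T t
    have e1 : σ x r i k * σ x r j k - σ x' r i k * σ x' r j k =
        σ x r i k * (σ x r j k - σ x' r j k) + (σ x r i k - σ x' r i k) * σ x' r j k := by ring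
    have e2 : |σ x r i k * (σ x r j k - σ x' r j k)| ≤ |M| * (|L| * ‖x - x'‖) := by
      rw [abs_mul]
      exact mul_le_mul (hM' x t i k) (hL' x x' t j k) (abs_nonneg _) (abs_nonneg _)
    have e3 : |(σ x r i k - σ x' r i k) * σ x' r j k| ≤ (|L| * ‖x - x'‖) * |M| := by
      rw [abs_mul]
      exact mul_le_mul (hL' x x' t i k) (hM' x' t j k) (abs_nonneg _) (by positivity)
    rw [e1]
    refine (abs_add_le _ _).trans ?_
    linarith
  · rw [e, e]
    exact Finset.sum_congr rfl fun k _ => mul_comm _ _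
  · rw [EuclideanSpace.real_norm_sq_eq]
    refine (hell x _ (hc t) ξ).trans_eq (Finset.sum_congr rfl fun i _ =>
      Finset.sum_congr rfl fun j _ => ?_)
    ring

theorem exists_holder_const {T : ℝ} {H : Euc N → ℝ → Euc N → ℝ → ℝ}
    (hH : ∀ R : ℝ, ∃ C α : ℝ, 0 < α ∧ α ≤ 1 ∧
        ∀ (p p' : Euc N) (v v' : ℝ) (x x' : Euc N) (t t' : ℝ),
          ‖p‖ ≤ R → ‖p'‖ ≤ R → |v| ≤ R → |v'| ≤ R → ‖x‖ ≤ R → ‖x'‖ ≤ R →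
          t ∈ Icc (0:ℝ) T → t' ∈ Icc (0:ℝ) T →
          |H p v x t - H p' v' x' t'| ≤
            C * (‖p - p'‖ + |v - v'| + ‖x - x'‖ + |t - t'|) ^ α) {t : ℝ → ℝ}
    (ht : ∀ s, t s ∈ Icc 0 T) (R : ℝ) :
    ∃ C α : ℝ, 0 ≤ C ∧ 0 < α ∧ ∀ p v x x' s, ‖p‖ ≤ R → |v| ≤ R → ‖x‖ ≤ R → ‖x'‖ ≤ R →
      |H p v x (t s) - H p v x' (t s)| ≤ C * ‖x - x'‖ ^ α := by
  obtain ⟨C, α, hα, -, h1⟩ := hH R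
  refine ⟨|C|, α, abs_nonneg _, hα, fun p v x x' s hp hv hx hx' => ?_⟩
  have h2 := h1 p p v v x x' _ _ hp hp hv hv hx hx' (ht s) (ht s)
  simp only [sub_self, norm_zero, abs_zero, zero_add, add_zero] at h2
  exact h2.trans (mul_le_mul_of_nonneg_right (le_abs_self _)
    (Real.rpow_nonneg (norm_nonneg _) _))

theorem continuous_of_holder {T : ℝ} {H : Euc N → ℝ → Euc N → ℝ → ℝ}
    (hH : ∀ R : ℝ, ∃ C α : ℝ, 0 < α ∧ α ≤ 1 ∧
        ∀ (p p' : Euc N) (v v' : ℝ) (x x' : Euc N) (t t' : ℝ),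
          ‖p‖ ≤ R → ‖p'‖ ≤ R → |v| ≤ R → |v'| ≤ R → ‖x‖ ≤ R → ‖x'‖ ≤ R →
          t ∈ Icc (0:ℝ) T → t' ∈ Icc (0:ℝ) T →
          |H p v x t - H p' v' x' t'| ≤
            C * (‖p - p'‖ + |v - v'| + ‖x - x'‖ + |t - t'|) ^ α) {t : ℝ → ℝ}
    (ht : ∀ s, t s ∈ Icc 0 T) (htc : Continuous t) :
    Continuous fun z : Euc N × ℝ × Euc N × ℝ => H z.1 z.2.1 z.2.2.1 (t z.2.2.2) := by
  refine continuous_iff_continuousAt.2 fun ξ => ?_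
  set R := ‖ξ‖ + 1
  obtain ⟨C, α, hα, -, h1⟩ := hH R
  have hz : ∀ z : Euc N × ℝ × Euc N × ℝ, ‖z‖ ≤ R → ‖z.1‖ ≤ R ∧ |z.2.1| ≤ R ∧ ‖z.2.2.1‖ ≤ R :=
    fun z hz => ⟨(norm_fst_le z).trans hz, (norm_fst_le z.2).trans ((norm_snd_le z).trans hz),
      (norm_fst_le z.2.2).trans ((norm_snd_le z.2).trans ((norm_snd_le z).trans hz))⟩
  have hξ := hz ξ (by linarith)
  refine continuousAt_of_abs_sub_le (b := fun z => C * (‖z.1 - ξ.1‖ + |z.2.1 - ξ.2.1| +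
    ‖z.2.2.1 - ξ.2.2.1‖ + |t z.2.2.2 - t ξ.2.2.2|) ^ α) ?_ ?_
  · filter_upwards [continuousAt_id.norm.eventually (gt_mem_nhds (lt_add_one ‖ξ‖))] with z h2
    obtain ⟨a1, a2, a3⟩ := hz z (le_of_lt h2)
    exact h1 _ _ _ _ _ _ _ _ a1 hξ.1 a2 hξ.2.1 a3 hξ.2.2 (ht _) (ht _)
  · have h2 : Continuous fun z : Euc N × ℝ × Euc N × ℝ => C * (‖z.1 - ξ.1‖ + |z.2.1 - ξ.2.1| +
        ‖z.2.2.1 - ξ.2.2.1‖ + |t z.2.2.2 - t ξ.2.2.2|) ^ α :=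
      continuous_const.mul (Continuous.rpow_const (by fun_prop) fun _ => Or.inr hα.le)
    simpa [Real.zero_rpow hα.ne'] using h2.tendsto ξ

theorem nonlin_of_lipschitz {h : Euc N → ℝ → Euc N → ℝ → ℝ} {K : ℝ} (hK : 0 ≤ K)
    (hc : Continuous fun z : Euc N × ℝ × Euc N × ℝ => h z.1 z.2.1 z.2.2.1 z.2.2.2)
    (hl : ∀ p p' v v' x t, |h p v x t - h p' v' x t| ≤ K * (|v - v'| + ‖p - p'‖))
    (h0 : ∀ x t, |h 0 0 x t| ≤ K) :
    Nonlin (fun w x t => w.2.2 + h w.2.1 w.1 x t) (1 + 2 * K) := by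
  refine ⟨by positivity, ?_, fun w w' x t => ?_, fun x t => ?_⟩
  · refine Continuous.add (by fun_prop) (hc.comp
      (g := fun z : Euc N × ℝ × Euc N × ℝ => h z.1 z.2.1 z.2.2.1 z.2.2.2)
      (f := fun p : (ℝ × Euc N × ℝ) × Euc N × ℝ => (p.1.2.1, p.1.1, p.2.1, p.2.2)) (by fun_prop))
  · have h1 : |w.1 - w'.1| ≤ ‖w - w'‖ := norm_fst_le (w - w')
    have h2 : ‖w.2.1 - w'.2.1‖ ≤ ‖w - w'‖ :=
      (norm_fst_le (w - w').2).trans (norm_snd_le (w - w'))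
    have h3 : |w.2.2 - w'.2.2| ≤ ‖w - w'‖ :=
      (norm_snd_le (w - w').2).trans (norm_snd_le (w - w'))
    have h4 := hl w.2.1 w'.2.1 w.1 w'.1 x t
    calc |w.2.2 + h w.2.1 w.1 x t - (w'.2.2 + h w'.2.1 w'.1 x t)|
        = |(w.2.2 - w'.2.2) + (h w.2.1 w.1 x t - h w'.2.1 w'.1 x t)| := by ring_nf
      _ ≤ |w.2.2 - w'.2.2| + |h w.2.1 w.1 x t - h w'.2.1 w'.1 x t| := abs_add_le _ _
      _ ≤ ‖w - w'‖ + K * (‖w - w'‖ + ‖w - w'‖) :=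
        add_le_add h3 (h4.trans (mul_le_mul_of_nonneg_left (add_le_add h1 h2) hK))
      _ = _ := by ring
  · have := h0 x t
    simp only [Prod.snd_zero, Prod.fst_zero, zero_add]
    linarith

end Data

end Parabolic

/-- under assumptions (A1)–(A3) there exists a classical solution
of the semilinear terminal-value problem which is bounded together with its
spatial gradient. -/
theorem existence_classical_solution_A
    (N : ℕ) (hN : 1 ≤ N) (T : ℝ) (hT : 0 < T)
    (σm a : Euc N → ℝ → Matrix (Fin N) (Fin N) ℝ)
    -- (A1)
    (ha : ∀ x t, a x t = σm x t * (σm x t)ᵀ)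
    (hsymm : ∀ x t, t ∈ Set.Icc (0:ℝ) T → (a x t).IsSymm)
    (hσbdd : ∃ M, ∀ x t, t ∈ Set.Icc (0:ℝ) T → ∀ i j, |σm x t i j| ≤ M)
    (hσlocLip : ∀ R : ℝ, ∃ L, ∀ (x x' : Euc N) (t t' : ℝ),
        ‖x‖ ≤ R → ‖x'‖ ≤ R → t ∈ Set.Icc (0:ℝ) T → t' ∈ Set.Icc (0:ℝ) T →
        ∀ i j, |σm x t i j - σm x' t' i j| ≤ L * (‖x - x'‖ + |t - t'|))
    (hσLipx : ∃ L, ∀ (x x' : Euc N) (t : ℝ), t ∈ Set.Icc (0:ℝ) T →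
        ∀ i j, |σm x t i j - σm x' t i j| ≤ L * ‖x - x'‖)
    (μ : ℝ) (hμ : 0 < μ)
    (hell : ∀ x t, t ∈ Set.Icc (0:ℝ) T → ∀ ξ : Fin N → ℝ,
        μ * ∑ i, ξ i ^ 2 ≤ ∑ i, ∑ j, a x t i j * ξ i * ξ j)
    -- (A2)
    (β : Euc N → ℝ)
    (hβbdd : ∃ C, ∀ x, |β x| ≤ C)
    (hβLip : ∃ L, ∀ x y : Euc N, |β x - β y| ≤ L * ‖x - y‖)
    -- (A3)
    (H : Euc N → ℝ → Euc N → ℝ → ℝ)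
    (hHhold : ∀ R : ℝ, ∃ C α : ℝ, 0 < α ∧ α ≤ 1 ∧
        ∀ (p p' : Euc N) (v v' : ℝ) (x x' : Euc N) (t t' : ℝ),
          ‖p‖ ≤ R → ‖p'‖ ≤ R → |v| ≤ R → |v'| ≤ R → ‖x‖ ≤ R → ‖x'‖ ≤ R →
          t ∈ Set.Icc (0:ℝ) T → t' ∈ Set.Icc (0:ℝ) T →
          |H p v x t - H p' v' x' t'| ≤
            C * (‖p - p'‖ + |v - v'| + ‖x - x'‖ + |t - t'|) ^ α)
    (K : ℝ) (hK : 0 < K)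
    (hHgrowth : ∀ (p : Euc N) (v : ℝ) (x : Euc N) (t : ℝ), t ∈ Set.Icc (0:ℝ) T →
        |H p v x t| ≤ K * (1 + |v| + ‖p‖))
    (hHlip : ∀ (p p' : Euc N) (v v' : ℝ) (x : Euc N) (t : ℝ), t ∈ Set.Icc (0:ℝ) T →
        |H p v x t - H p' v' x t| ≤ K * (|v - v'| + ‖p - p'‖)) :
    ∃ (u : Euc N → ℝ → ℝ) (Du : Euc N → ℝ → Euc N)
      (D2u : Euc N → ℝ → (Euc N →L[ℝ] Euc N)) (ut : Euc N → ℝ → ℝ),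
      IsClassicalSolution N T a H β u Du D2u ut ∧
      ∃ C, (∀ x t, t ∈ Set.Icc (0:ℝ) T → |u x t| ≤ C) ∧
           (∀ x t, t ∈ Set.Ico (0:ℝ) T → ‖Du x t‖ ≤ C) := by
  obtain ⟨B, hB⟩ := hβbdd
  obtain ⟨Q, hQ⟩ := hβLip
  have hQ1 : ∀ x y, |β x - β y| ≤ |Q| * ‖x - y‖ := fun x y =>
    (hQ x y).trans (mul_le_mul_of_nonneg_right (le_abs_self _) (norm_nonneg _))
  have hβc : Continuous β :=
    (LipschitzWith.of_dist_le_mul (K := ⟨|Q|, abs_nonneg Q⟩) fun x y => by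
      rw [Real.dist_eq, dist_eq_norm]
      exact hQ1 x y).continuous
  have hc := Parabolic.clampRev_mem hT
  obtain ⟨q, hq⟩ := Parabolic.exists_coef hT hσbdd hσlocLip hσLipx hμ
    (by simpa only [ha] using hell)
  have hhc := Parabolic.continuous_of_holder hHhold hc (Parabolic.continuous_clampRev T)
  have hhl : ∀ (p p' : Euc N) (v v' : ℝ) (x : Euc N) (t : ℝ),
      |H p v x (Parabolic.clampRev T t) - H p' v' x (Parabolic.clampRev T t)| ≤
        K * (|v - v'| + ‖p - p'‖) :=
    fun p p' v v' x t => hHlip p p' v v' x _ (hc t)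
  have hnl := Parabolic.nonlin_of_lipschitz (h := fun p v x t => H p v x (Parabolic.clampRev T t))
    hK.le hhc hhl fun x t => by simpa using hHgrowth 0 0 x _ (hc t)
  obtain ⟨f, F, Λ, hf, hΛ, heq⟩ := q.exists_density hnl hβc hB
  have S : Parabolic.Setup q (fun p v x t => H p v x (Parabolic.clampRev T t)) β f B |Q| K F Λ
      (T + 1) :=
    ⟨by positivity, abs_nonneg _, hK.le, hβc, hB, hQ1, hhc, hhl,
      Parabolic.exists_holder_const hHhold hc, hf, hΛ, heq⟩
  exact S.exists_isClassicalSolution hT (lt_add_one T)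
    (fun x t ht => by rw [hq, Parabolic.clampRev_sub ht, ha])
    (fun p v x t ht => by rw [Parabolic.clampRev_sub ht])
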